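/- The measures ν_⋆ and ζ_⋆ vanish on Ω \ 𝔖_⋆ and are absolutely continuous with respect to λ = ℋ¹ restricted to 𝔖_⋆. Writing ν_⋆ = 𝕖_⋆ dλ and ζ_⋆ = Θ_⋆ dλ for the Radon–Nikodym densities, there exist a constant η₁ > 0 depending only on V and a function K : (0,∞) → (0,∞) depending only on V and M₀ such that for λ-almost every x ∈ 𝔖_⋆: η₁ ≤ 𝕖_⋆(x) ≤ K(d(x))·Θ_⋆(x) and Θ_⋆(x) ≤ M₀/d(x), where d(x) = dist(x,∂Ω). -/

import Mathlib

open MeasureTheory Metric Filter Topology Bornology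
open scoped RealInnerProductSpace ENNReal Topology

noncomputable section

/-- The euclidean plane. -/
abbrev E2 : Type := EuclideanSpace ℝ (Fin 2)

/-- The euclidean space `ℝ^k`. -/
abbrev Evec (k : ℕ) : Type := EuclideanSpace ℝ (Fin k)

/-- The `i`-th standard basis vector of the plane. -/
def b2 (i : Fin 2) : E2 := EuclideanSpace.single i (1 : ℝ)

/-- The partial derivative of `u` in the `i`-th coordinate direction. -/
def pder {k : ℕ} (u : E2 → Evec k) (i : Fin 2) (x : E2) : Evec k :=
  fderiv ℝ u x (b2 i)

/-- The Laplacian of a map defined on the plane. -/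
def lap {k : ℕ} (u : E2 → Evec k) (x : E2) : Evec k :=
  ∑ i : Fin 2, fderiv ℝ (pder u i) x (b2 i)

/-- `u` is a smooth solution of the vectorial Allen-Cahn system
`Δu = ε⁻² ∇V(u)` on the open set `U`. -/
def IsSolution {k : ℕ} (V : Evec k → ℝ) (ε : ℝ) (U : Set E2) (u : E2 → Evec k) : Prop :=
  ContDiffOn ℝ (⊤ : ℕ∞) u U ∧ ∀ x ∈ U, lap u x = (ε ^ 2)⁻¹ • gradient V (u x)

/-- The squared modulus `|∇u|²` of the full gradient. -/
def gradSq {k : ℕ} (u : E2 → Evec k) (x : E2) : ℝ :=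
  ∑ i : Fin 2, ‖pder u i x‖ ^ 2

/-- The energy density `e_ε(u) = (ε/2)|∇u|² + ε⁻¹ V(u)`. -/
def eDens {k : ℕ} (V : Evec k → ℝ) (ε : ℝ) (u : E2 → Evec k) (x : E2) : ℝ :=
  ε / 2 * gradSq u x + ε⁻¹ * V (u x)

/-- The energy `E_ε(u, G)`. -/
def energy {k : ℕ} (V : Evec k → ℝ) (ε : ℝ) (u : E2 → Evec k) (G : Set E2) : ℝ :=
  ∫ x in G, eDens V ε u x

/-- The hypotheses (H₁), (H₂), (H₃) on the multi-well potential `V`: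
smooth, nonnegative with `inf V = 0`, finitely many zeros (at least two),
positive definite Hessian at each zero, quadratic growth of `y·∇V(y)` at
infinity and coercivity. -/
structure IsMultiWell {k : ℕ} (V : Evec k → ℝ) : Prop where
  smooth : ContDiff ℝ (⊤ : ℕ∞) V
  nonneg : ∀ y, 0 ≤ V y
  finite_zeros : {y : Evec k | V y = 0}.Finite
  two_le_card : 2 ≤ {y : Evec k | V y = 0}.ncard
  hess_posdef : ∀ σ : Evec k, V σ = 0 → ∀ w : Evec k, w ≠ 0 →
    0 < iteratedFDeriv ℝ 2 V σ ![w, w]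
  growth : ∃ α > (0 : ℝ), ∃ R > (0 : ℝ), ∀ y : Evec k, R < ‖y‖ →
    α * ‖y‖ ^ 2 ≤ ⟪y, gradient V y⟫
  coercive : ∀ C : ℝ, ∃ R : ℝ, ∀ y : Evec k, R ≤ ‖y‖ → C ≤ V y

/-- A continuous test function compactly supported in `Ω`. -/
def TestFun (Ω : Set E2) (f : E2 → ℝ) : Prop :=
  Continuous f ∧ HasCompactSupport f ∧ tsupport f ⊆ Ω

/-- The lower one-dimensional density of the measure `ν` at `x`. -/
def densLow (ν : Measure E2) (x : E2) : ℝ :=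
  Filter.liminf (fun r : ℝ => (ν (closedBall x r)).toReal / r) (𝓝[>] 0)

/-- The concentration set `𝔖⋆ = {x ∈ Ω | liminf_{r→0} ν(D̄(x,r))/r ≥ η}`. -/
def concSet (ν : Measure E2) (Ω : Set E2) (η : ℝ) : Set E2 :=
  {x ∈ Ω | η ≤ densLow ν x}

/-- A `C¹` test function compactly supported in `Ω`. -/
def C1Test (Ω : Set E2) (χ : E2 → ℝ) : Prop :=
  ContDiff ℝ 1 χ ∧ HasCompactSupport χ ∧ tsupport χ ⊆ Ω

/-- The `i`-th partial derivative of a scalar function. -/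
def pd (χ : E2 → ℝ) (i : Fin 2) (x : E2) : ℝ := fderiv ℝ χ x (b2 i)

theorem TestFun.mul_continuousOn {Ω : Set E2} (hΩ : IsOpen Ω) {f g : E2 → ℝ} (hf : TestFun Ω f)
    (hg : ContinuousOn g Ω) : TestFun Ω (fun x => f x * g x) := by
  have hsub : tsupport (fun x => f x * g x) ⊆ tsupport f := tsupport_mul_subset_left
  refine ⟨?_, hf.2.1.mul_right, hsub.trans hf.2.2⟩
  refine continuous_iff_continuousAt.2 fun x => ?_
  by_cases hx : x ∈ tsupport f
  · exact hf.1.continuousAt.mul (hg.continuousAt (hΩ.mem_nhds (hf.2.2 hx)))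
  · have h0 : (fun x => f x * g x) =ᶠ[𝓝 x] fun _ => 0 := by
      filter_upwards [(isClosed_tsupport f).isOpen_compl.mem_nhds hx] with y hy
      rw [image_eq_zero_of_notMem_tsupport hy, zero_mul]
    exact continuousAt_const.congr h0.symm

theorem TestFun.integrable {Ω : Set E2} {f : E2 → ℝ} (hf : TestFun Ω f) (μ : Measure E2)
    [IsFiniteMeasureOnCompacts μ] : Integrable f μ :=
  hf.1.integrable_of_hasCompactSupport hf.2.1

theorem TestFun.integrable_mul {Ω : Set E2} (hΩ : IsOpen Ω) {f g : E2 → ℝ} (hf : TestFun Ω f)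
    (hg : ContinuousOn g Ω) (μ : Measure E2) [IsFiniteMeasureOnCompacts μ] :
    Integrable (fun x => f x * g x) μ :=
  (hf.mul_continuousOn hΩ hg).integrable μ

theorem TestFun.setIntegral_mul {Ω : Set E2} {f : E2 → ℝ} (hf : TestFun Ω f) (g : E2 → ℝ)
    (μ : Measure E2) : ∫ x in Ω, f x * g x ∂μ = ∫ x, f x * g x ∂μ := by
  refine setIntegral_eq_integral_of_forall_compl_eq_zero fun x hx => ?_
  rw [image_eq_zero_of_notMem_tsupport (fun h => hx (hf.2.2 h)), zero_mul]

theorem TestFun.abs {Ω : Set E2} {f : E2 → ℝ} (hf : TestFun Ω f) :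
    TestFun Ω (fun x => |f x|) :=
  ⟨hf.1.abs, hf.2.1.comp_left (g := fun t : ℝ => |t|) abs_zero,
    (closure_mono (fun x hx => by
      simp only [Function.mem_support, ne_eq, abs_eq_zero] at hx; exact hx)).trans hf.2.2⟩

theorem C1Test.test {Ω : Set E2} {χ : E2 → ℝ} (h : C1Test Ω χ) : TestFun Ω χ :=
  ⟨h.1.continuous, h.2.1, h.2.2⟩

theorem C1Test.mono {Ω Ω' : Set E2} {χ : E2 → ℝ} (h : C1Test Ω χ) (hs : Ω ⊆ Ω') : C1Test Ω' χ :=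
  ⟨h.1, h.2.1, h.2.2.trans hs⟩

theorem TestFun.mono {Ω Ω' : Set E2} {χ : E2 → ℝ} (h : TestFun Ω χ) (hs : Ω ⊆ Ω') :
    TestFun Ω' χ :=
  ⟨h.1, h.2.1, h.2.2.trans hs⟩

theorem C1Test.pd_test {Ω : Set E2} {χ : E2 → ℝ} (h : C1Test Ω χ) (i : Fin 2) :
    TestFun Ω (pd χ i) := by
  refine ⟨(h.1.continuous_fderiv (by simp)).clm_apply continuous_const,
    h.2.1.fderiv_apply ℝ (b2 i), (tsupport_fderiv_apply_subset ℝ (b2 i)).trans h.2.2⟩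

theorem C1Test.mul_left {Ω : Set E2} {χ : E2 → ℝ} (h : C1Test Ω χ) {f : E2 → ℝ}
    (hf : ContDiff ℝ 1 f) : C1Test Ω (fun x => f x * χ x) :=
  ⟨hf.mul h.1, h.2.1.mul_left, tsupport_mul_subset_right.trans h.2.2⟩

theorem pd_mul {f g : E2 → ℝ} {x : E2} (hf : DifferentiableAt ℝ f x)
    (hg : DifferentiableAt ℝ g x) (i : Fin 2) :
    pd (fun y => f y * g y) i x = f x * pd g i x + pd f i x * g x := by
  have := fderiv_mul hf hg
  simp only [pd]
  rw [show (fun y => f y * g y) = f * g from rfl, this]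
  simp [mul_comm]

/-- Integration by parts against a compactly supported test function. -/
theorem integral_pd_mul_test {Ω : Set E2} (hΩ : IsOpen Ω) {T χ : E2 → ℝ}
    (hT : ContDiffOn ℝ 1 T Ω) (hχ : C1Test Ω χ) (i : Fin 2) :
    ∫ x, pd χ i x * T x = - ∫ x, χ x * pd T i x := by
  have hcT : ContinuousOn (fun x => fderiv ℝ T x (b2 i)) Ω :=
    (hT.continuousOn_fderiv_of_isOpen hΩ (by simp)).clm_apply continuousOn_const
  have key := integral_mul_fderiv_eq_neg_fderiv_mul_of_integrable (μ := (volume : Measure E2))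
    (f := T) (g := χ) (v := b2 i) ?_ ?_ ?_ ?_ ?_
  · have e1 : ∀ x, pd χ i x * T x = T x * fderiv ℝ χ x (b2 i) := fun x => mul_comm _ _
    have e2 : ∀ x, χ x * pd T i x = fderiv ℝ T x (b2 i) * χ x := fun x => mul_comm _ _
    simp only [e1, e2]
    exact key
  · simpa only [mul_comm] using hχ.test.integrable_mul hΩ hcT volume
  · simpa only [mul_comm, pd] using (hχ.pd_test i).integrable_mul hΩ hT.continuousOn volume
  · simpa only [mul_comm] using hχ.test.integrable_mul hΩ hT.continuousOn volume
  · exact fun x hx => (hT.contDiffAt (hΩ.mem_nhds (hχ.2.2 hx))).differentiableAt (by simp)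
  · exact fun x _ => hχ.1.differentiable (by simp) x

/-- At a local maximum the second derivative in any direction is nonpositive. -/
theorem fderiv_fderiv_nonpos_of_isLocalMax {f : E2 → ℝ} {x v : E2}
    (hf : ∀ᶠ y in 𝓝 x, DifferentiableAt ℝ f y)
    (hf2 : DifferentiableAt ℝ (fun y => fderiv ℝ f y v) x) (hmax : IsLocalMax f x) :
    fderiv ℝ (fun y => fderiv ℝ f y v) x v ≤ 0 := by
  by_contra! hpos
  set g : ℝ → ℝ := fun t => f (x + t • v) with hg
  have hline : ∀ t : ℝ, HasDerivAt (fun t : ℝ => x + t • v) v t := fun t => by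
    simpa using ((hasDerivAt_id t).smul_const v).const_add x
  have hcont : ContinuousAt (fun t : ℝ => x + t • v) 0 := (hline 0).continuousAt
  have htend : Tendsto (fun t : ℝ => x + t • v) (𝓝 0) (𝓝 x) := by
    simpa [ContinuousAt] using hcont
  have hg' : deriv g =ᶠ[𝓝 0] fun t => fderiv ℝ f (x + t • v) v := by
    filter_upwards [htend.eventually hf] with t ht
    exact (ht.hasFDerivAt.comp_hasDerivAt t (hline t)).deriv
  have hg2 : deriv (deriv g) 0 = fderiv ℝ (fun y => fderiv ℝ f y v) x v := by
    rw [hg'.deriv_eq]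
    have h2 : HasFDerivAt (fun y => fderiv ℝ f y v) (fderiv ℝ (fun y => fderiv ℝ f y v) x)
        (x + (0 : ℝ) • v) := by simpa using hf2.hasFDerivAt
    exact (h2.comp_hasDerivAt (0 : ℝ) (hline 0)).deriv
  have hgmax : IsLocalMax g 0 := by
    have : ∀ᶠ t in 𝓝 (0 : ℝ), f (x + t • v) ≤ f x := htend.eventually hmax
    simpa [IsLocalMax, IsMaxFilter, hg] using this
  have hgc : ContinuousAt g 0 := by
    have : ContinuousAt f (x + (0 : ℝ) • v) := by simpa using hf.self_of_nhds.continuousAt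
    exact ContinuousAt.comp (f := fun t : ℝ => x + t • v) this hcont
  have hgmin : IsLocalMin g 0 :=
    isLocalMin_of_deriv_deriv_pos (hg2 ▸ hpos) hgmax.deriv_eq_zero hgc
  have hconst : g =ᶠ[𝓝 0] fun _ => g 0 := by
    filter_upwards [hgmin, hgmax] with t h1 h2 using le_antisymm h2 h1
  have hd : deriv g =ᶠ[𝓝 0] fun _ => 0 := by
    filter_upwards [hconst.eventuallyEq_nhds] with t ht
    rw [ht.deriv_eq]; simp
  rw [← hg2, hd.deriv_eq] at hpos
  simp at hpos

theorem gradSq_eq {k : ℕ} (u : E2 → Evec k) (x : E2) :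
    gradSq u x = ‖pder u 0 x‖ ^ 2 + ‖pder u 1 x‖ ^ 2 := by
  simp [gradSq, Fin.sum_univ_two]

theorem gradSq_nonneg {k : ℕ} (u : E2 → Evec k) (x : E2) : 0 ≤ gradSq u x := by
  rw [gradSq_eq]; positivity

theorem sq_norm_pder_le_gradSq {k : ℕ} (u : E2 → Evec k) (i : Fin 2) (x : E2) :
    ‖pder u i x‖ ^ 2 ≤ gradSq u x :=
  Finset.single_le_sum (f := fun i => ‖pder u i x‖ ^ 2) (fun _ _ => by positivity)
    (Finset.mem_univ i)

theorem eDens_nonneg {k : ℕ} {V : Evec k → ℝ} (hV : ∀ y, 0 ≤ V y) {ε : ℝ} (hε : 0 < ε)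
    (u : E2 → Evec k) (x : E2) : 0 ≤ eDens V ε u x := by
  have := gradSq_nonneg u x
  have := hV (u x)
  unfold eDens; positivity

theorem inner_gradient_eq_fderiv {k : ℕ} (V : Evec k → ℝ) (y w : Evec k) :
    ⟪gradient V y, w⟫ = fderiv ℝ V y w := by
  simp [gradient]

/-- The stress-energy tensor. -/
def stress {k : ℕ} (V : Evec k → ℝ) (ε : ℝ) (u : E2 → Evec k) (i j : Fin 2) (x : E2) : ℝ :=
  (if i = j then eDens V ε u x else 0) - ε * ⟪pder u i x, pder u j x⟫

theorem stress_trace {k : ℕ} (V : Evec k → ℝ) (ε : ℝ) (u : E2 → Evec k) (x : E2) :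
    stress V ε u 0 0 x + stress V ε u 1 1 x = 2 * (ε⁻¹ * V (u x)) := by
  simp only [stress, eDens, gradSq_eq, real_inner_self_eq_norm_sq, if_true]
  ring

theorem stress_comm {k : ℕ} (V : Evec k → ℝ) (ε : ℝ) (u : E2 → Evec k) (i j : Fin 2) (x : E2) :
    stress V ε u i j x = stress V ε u j i x := by
  simp only [stress, eq_comm (a := i), real_inner_comm (pder u i x)]

theorem abs_stress_le {k : ℕ} {V : Evec k → ℝ} (hV : ∀ y, 0 ≤ V y) {ε : ℝ} (hε : 0 < ε)
    (u : E2 → Evec k) (i j : Fin 2) (x : E2) : |stress V ε u i j x| ≤ eDens V ε u x := by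
  have h1 : 0 ≤ ε⁻¹ * V (u x) := mul_nonneg (by positivity) (hV _)
  have habs := abs_real_inner_le_norm (pder u i x) (pder u j x)
  have hi := sq_norm_pder_le_gradSq u i x
  have hd : eDens V ε u x = ε / 2 * gradSq u x + ε⁻¹ * V (u x) := rfl
  by_cases hij : i = j
  · subst hij
    simp only [stress, if_true, real_inner_self_eq_norm_sq]
    rw [abs_le]
    constructor <;> nlinarith [sq_nonneg ‖pder u i x‖]
  · have hs : ‖pder u i x‖ ^ 2 + ‖pder u j x‖ ^ 2 = gradSq u x := by
      rw [gradSq_eq]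
      fin_cases i <;> fin_cases j <;> simp_all [add_comm]
    have h2 : ‖pder u i x‖ * ‖pder u j x‖ ≤ gradSq u x / 2 := by
      nlinarith [sq_nonneg (‖pder u i x‖ - ‖pder u j x‖)]
    simp only [stress, hij, if_false, zero_sub, abs_neg, abs_mul, abs_of_pos hε]
    nlinarith

section Regularity

variable {k : ℕ} {V : Evec k → ℝ} {ε : ℝ} {Ω : Set E2} {u : E2 → Evec k}

theorem contDiffOn_pder (hΩ : IsOpen Ω) (hu : ContDiffOn ℝ (⊤ : ℕ∞) u Ω) (i : Fin 2) :
    ContDiffOn ℝ (⊤ : ℕ∞) (pder u i) Ω :=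
  (hu.fderiv_of_isOpen hΩ (by simp)).clm_apply contDiffOn_const

theorem contDiffOn_gradSq (hΩ : IsOpen Ω) (hu : ContDiffOn ℝ (⊤ : ℕ∞) u Ω) :
    ContDiffOn ℝ (⊤ : ℕ∞) (gradSq u) Ω := by
  unfold gradSq
  exact ContDiffOn.sum fun i _ => (contDiffOn_pder hΩ hu i).norm_sq ℝ

theorem contDiffOn_potential (hV : ContDiff ℝ (⊤ : ℕ∞) V)
    (hu : ContDiffOn ℝ (⊤ : ℕ∞) u Ω) : ContDiffOn ℝ (⊤ : ℕ∞) (fun x => V (u x)) Ω :=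
  hV.comp_contDiffOn hu

theorem contDiffOn_eDens (hΩ : IsOpen Ω) (hV : ContDiff ℝ (⊤ : ℕ∞) V)
    (hu : ContDiffOn ℝ (⊤ : ℕ∞) u Ω) : ContDiffOn ℝ (⊤ : ℕ∞) (eDens V ε u) Ω := by
  unfold eDens
  exact (contDiffOn_const.mul (contDiffOn_gradSq hΩ hu)).add
    (contDiffOn_const.mul (contDiffOn_potential hV hu))

theorem contDiffOn_stress (hΩ : IsOpen Ω) (hV : ContDiff ℝ (⊤ : ℕ∞) V)
    (hu : ContDiffOn ℝ (⊤ : ℕ∞) u Ω) (i j : Fin 2) :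
    ContDiffOn ℝ (⊤ : ℕ∞) (stress V ε u i j) Ω := by
  have h1 : ContDiffOn ℝ (⊤ : ℕ∞) (fun x => ⟪pder u i x, pder u j x⟫) Ω :=
    (contDiffOn_pder hΩ hu i).inner ℝ (contDiffOn_pder hΩ hu j)
  unfold stress
  by_cases hij : i = j
  · simp only [hij, if_true] at *
    exact (contDiffOn_eDens hΩ hV hu).sub (contDiffOn_const.mul h1)
  · simp only [hij, if_false]
    exact contDiffOn_const.sub (contDiffOn_const.mul h1)

theorem differentiableAt_of_contDiffOn {F : Type*} [NormedAddCommGroup F] [NormedSpace ℝ F]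
    {f : E2 → F} (hΩ : IsOpen Ω) (hf : ContDiffOn ℝ (⊤ : ℕ∞) f Ω) {x : E2} (hx : x ∈ Ω) :
    DifferentiableAt ℝ f x :=
  (hf.contDiffAt (hΩ.mem_nhds hx)).differentiableAt (by simp)

theorem fderiv_pder_comm (hΩ : IsOpen Ω) (hu : ContDiffOn ℝ (⊤ : ℕ∞) u Ω) {x : E2} (hx : x ∈ Ω)
    (i j : Fin 2) : fderiv ℝ (pder u i) x (b2 j) = fderiv ℝ (pder u j) x (b2 i) := by
  have hc : ContDiffAt ℝ (⊤ : ℕ∞) u x := hu.contDiffAt (hΩ.mem_nhds hx)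
  have hsym : IsSymmSndFDerivAt ℝ u x :=
    hc.isSymmSndFDerivAt (by simp; exact WithTop.coe_le_coe.2 le_top)
  have hd : DifferentiableAt ℝ (fderiv ℝ u) x :=
    (hc.fderiv_right (m := 1) (by norm_cast)).differentiableAt (by simp)
  have h : ∀ a b : Fin 2, fderiv ℝ (pder u a) x (b2 b) = fderiv ℝ (fderiv ℝ u) x (b2 b) (b2 a) := by
    intro a b
    have : fderiv ℝ (pder u a) x = (fderiv ℝ (fderiv ℝ u) x).flip (b2 a) := by
      have h1 := (hd.hasFDerivAt.clm_apply (hasFDerivAt_const (b2 a) x)).fderiv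
      change fderiv ℝ (fun y => fderiv ℝ u y (b2 a)) x = _
      simpa using h1
    rw [this]; rfl
  rw [h, h]
  exact hsym _ _

theorem pd_inner_pder (hΩ : IsOpen Ω) (hu : ContDiffOn ℝ (⊤ : ℕ∞) u Ω) {x : E2} (hx : x ∈ Ω)
    (i j l : Fin 2) : pd (fun y => ⟪pder u i y, pder u j y⟫) l x
      = ⟪pder u i x, fderiv ℝ (pder u j) x (b2 l)⟫
        + ⟪fderiv ℝ (pder u i) x (b2 l), pder u j x⟫ :=
  fderiv_inner_apply ℝ (differentiableAt_of_contDiffOn hΩ (contDiffOn_pder hΩ hu i) hx)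
    (differentiableAt_of_contDiffOn hΩ (contDiffOn_pder hΩ hu j) hx) _

theorem pd_comp_sol (hΩ : IsOpen Ω) (hu : ContDiffOn ℝ (⊤ : ℕ∞) u Ω) {H : Evec k → ℝ} {x : E2}
    (hx : x ∈ Ω) (hH : DifferentiableAt ℝ H (u x)) (i : Fin 2) :
    pd (fun y => H (u y)) i x = fderiv ℝ H (u x) (pder u i x) := by
  have := (hH.hasFDerivAt.comp x (differentiableAt_of_contDiffOn hΩ hu hx).hasFDerivAt).fderiv
  simp only [pd, pder]
  rw [show (fun y => H (u y)) = H ∘ u from rfl, this]; rfl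

theorem pd_eDens (hΩ : IsOpen Ω) (hV : ContDiff ℝ (⊤ : ℕ∞) V)
    (hu : ContDiffOn ℝ (⊤ : ℕ∞) u Ω) {x : E2} (hx : x ∈ Ω) (l : Fin 2) :
    pd (eDens V ε u) l x = ε * (⟪pder u 0 x, fderiv ℝ (pder u 0) x (b2 l)⟫
      + ⟪pder u 1 x, fderiv ℝ (pder u 1) x (b2 l)⟫) + ε⁻¹ * ⟪gradient V (u x), pder u l x⟫ := by
  have hf : eDens V ε u = fun y => (ε / 2) * (⟪pder u 0 y, pder u 0 y⟫ + ⟪pder u 1 y, pder u 1 y⟫)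
      + ε⁻¹ * V (u y) := by
    funext y; simp only [eDens, gradSq_eq, real_inner_self_eq_norm_sq]
  have hd : ∀ i, DifferentiableAt ℝ (fun y => ⟪pder u i y, pder u i y⟫) x := fun i =>
    differentiableAt_of_contDiffOn hΩ
      ((contDiffOn_pder hΩ hu i).inner ℝ (contDiffOn_pder hΩ hu i)) hx
  have hdV : DifferentiableAt ℝ (fun y => V (u y)) x :=
    differentiableAt_of_contDiffOn hΩ (contDiffOn_potential hV hu) hx
  have h0 := pd_inner_pder hΩ hu hx 0 0 l
  have h1 := pd_inner_pder hΩ hu hx 1 1 l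
  have h2 := pd_comp_sol hΩ hu hx (hV.differentiable (by simp) (u x)) l
  simp only [pd] at h0 h1 h2 ⊢
  rw [hf, fderiv_fun_add (((hd 0).fun_add (hd 1)).const_mul _) (hdV.const_mul _),
    fderiv_const_mul ((hd 0).fun_add (hd 1)), fderiv_const_mul hdV, fderiv_fun_add (hd 0) (hd 1)]
  simp only [add_apply, smul_apply, smul_eq_mul, h0, h1, h2,
    inner_gradient_eq_fderiv, real_inner_comm (pder u 0 x), real_inner_comm (pder u 1 x)]
  ring

/-- The stress-energy tensor of a solution is divergence free. -/
theorem sum_pd_stress (hΩ : IsOpen Ω) (hV : ContDiff ℝ (⊤ : ℕ∞) V) (hε : 0 < ε)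
    (hs : IsSolution V ε Ω u) {x : E2} (hx : x ∈ Ω) (i : Fin 2) :
    ∑ j, pd (stress V ε u i j) j x = 0 := by
  have hu := hs.1
  have he : DifferentiableAt ℝ (eDens V ε u) x :=
    differentiableAt_of_contDiffOn hΩ (contDiffOn_eDens hΩ hV hu) hx
  have hd : ∀ i j, DifferentiableAt ℝ (fun y => ⟪pder u i y, pder u j y⟫) x := fun i j =>
    differentiableAt_of_contDiffOn hΩ
      ((contDiffOn_pder hΩ hu i).inner ℝ (contDiffOn_pder hΩ hu j)) hx
  have h1 : ∀ j, pd (stress V ε u i j) j x = (if i = j then pd (eDens V ε u) i x else 0)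
      - ε * (⟪pder u i x, fderiv ℝ (pder u j) x (b2 j)⟫
        + ⟪fderiv ℝ (pder u j) x (b2 i), pder u j x⟫) := by
    intro j
    rw [← fderiv_pder_comm hΩ hu hx i j, ← pd_inner_pder hΩ hu hx]
    by_cases hij : i = j
    · subst hij
      simp only [if_true, pd]
      have : stress V ε u i i = fun y => eDens V ε u y - ε * ⟪pder u i y, pder u i y⟫ := by
        funext y; simp [stress]
      rw [this, fderiv_fun_sub he ((hd _ _).const_mul _), fderiv_const_mul (hd _ _)]
      simp
    · simp only [hij, if_false, pd]
      have : stress V ε u i j = fun y => - (ε * ⟪pder u i y, pder u j y⟫) := by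
        funext y; simp [stress, hij]
      rw [this, fderiv_fun_neg, fderiv_const_mul (hd _ _)]
      simp
  have hlap : ⟪pder u i x, fderiv ℝ (pder u 0) x (b2 0)⟫ +
      ⟪pder u i x, fderiv ℝ (pder u 1) x (b2 1)⟫
      = (ε ^ 2)⁻¹ * ⟪gradient V (u x), pder u i x⟫ := by
    rw [← inner_add_right, ← real_inner_smul_left, ← hs.2 x hx, lap, Fin.sum_univ_two,
      real_inner_comm]
  simp only [h1, Fin.sum_univ_two]
  have hsum : (if i = 0 then pd (eDens V ε u) i x else 0)
      + (if i = 1 then pd (eDens V ε u) i x else 0) = pd (eDens V ε u) i x := by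
    fin_cases i <;> simp
  have hε2 : ε * (ε ^ 2)⁻¹ = ε⁻¹ := by field_simp
  have hpe := pd_eDens (ε := ε) hΩ hV hu hx i
  rw [real_inner_comm (fderiv ℝ (pder u 0) x (b2 i)),
    real_inner_comm (fderiv ℝ (pder u 1) x (b2 i))]
    at hpe
  rw [← hε2, mul_assoc, ← hlap] at hpe
  linarith

theorem integral_stress_pd (hΩ : IsOpen Ω) (hV : ContDiff ℝ (⊤ : ℕ∞) V) (hε : 0 < ε)
    (hs : IsSolution V ε Ω u) {χ : E2 → ℝ} (hχ : C1Test Ω χ) (i : Fin 2) :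
    ∑ j, ∫ x, pd χ j x * stress V ε u i j x = 0 := by
  have h : ∀ j, ContDiffOn ℝ 1 (stress V ε u i j) Ω := fun j =>
    (contDiffOn_stress hΩ hV hs.1 i j).of_le (by norm_cast)
  simp only [fun j => integral_pd_mul_test hΩ (h j) hχ j, Finset.sum_neg_distrib, neg_eq_zero]
  rw [← integral_finsetSum]
  · rw [← integral_zero E2 ℝ]
    congr 1
    funext x
    rw [← Finset.mul_sum]
    by_cases hx : x ∈ Ω
    · rw [sum_pd_stress hΩ hV hε hs hx, mul_zero]
    · rw [image_eq_zero_of_notMem_tsupport (fun hh => hx (hχ.2.2 hh)), zero_mul]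
  · exact fun j _ => hχ.test.integrable_mul hΩ
      (((h j).continuousOn_fderiv_of_isOpen hΩ (by simp)).clm_apply continuousOn_const) volume

end Regularity

section WellTest

variable {k : ℕ} {V : Evec k → ℝ} {ε : ℝ} {Ω : Set E2} {u : E2 → Evec k}

theorem pd_well_field (hΩ : IsOpen Ω) (hu : ContDiffOn ℝ (⊤ : ℕ∞) u Ω) {ψ : ℝ → ℝ}
    (hψ : ContDiff ℝ 1 ψ) (σ : Evec k) {x : E2} (hx : x ∈ Ω) (j : Fin 2) :
    pd (fun y => ψ (‖u y - σ‖ ^ 2) * ⟪pder u j y, u y - σ⟫) j x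
      = ψ (‖u x - σ‖ ^ 2) * (⟪fderiv ℝ (pder u j) x (b2 j), u x - σ⟫ + ‖pder u j x‖ ^ 2)
        + 2 * deriv ψ (‖u x - σ‖ ^ 2) * ⟪pder u j x, u x - σ⟫ ^ 2 := by
  have hud : DifferentiableAt ℝ u x := differentiableAt_of_contDiffOn hΩ hu hx
  have hsub : HasFDerivAt (fun y => u y - σ) (fderiv ℝ u x) x := hud.hasFDerivAt.sub_const σ
  have hpd : DifferentiableAt ℝ (pder u j) x :=
    differentiableAt_of_contDiffOn hΩ (contDiffOn_pder hΩ hu j) hx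
  have h1 := hpd.hasFDerivAt.inner ℝ hsub
  have h2 := ((hψ.differentiable (by simp) _).hasDerivAt.comp_hasFDerivAt x hsub.norm_sq)
  have h3 := h2.fun_mul h1
  simp only [pd]
  have := h3.fderiv
  simp only [Function.comp_apply] at this
  rw [this]
  simp only [add_apply, smul_apply, ContinuousLinearMap.comp_apply, fderivInnerCLM_apply,
    ContinuousLinearMap.prod_apply, innerSL_apply_apply, smul_eq_mul,
    show fderiv ℝ u x (b2 j) = pder u j x from rfl,
    real_inner_comm (pder u j x) (u x - σ), real_inner_self_eq_norm_sq]
  ring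

theorem contDiffOn_well_field (hΩ : IsOpen Ω) (hu : ContDiffOn ℝ (⊤ : ℕ∞) u Ω) {ψ : ℝ → ℝ}
    (hψ : ContDiff ℝ 1 ψ) (σ : Evec k) (j : Fin 2) :
    ContDiffOn ℝ 1 (fun y => ψ (‖u y - σ‖ ^ 2) * ⟪pder u j y, u y - σ⟫) Ω := by
  have hs : ContDiffOn ℝ 1 (fun y => u y - σ) Ω := (hu.of_le (by norm_cast)).sub contDiffOn_const
  exact (hψ.comp_contDiffOn (hs.norm_sq ℝ)).mul
    (((contDiffOn_pder hΩ hu j).of_le (by norm_cast)).inner ℝ hs)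

theorem integral_well_field (hΩ : IsOpen Ω) (hs : IsSolution V ε Ω u) {ψ : ℝ → ℝ}
    (hψ : ContDiff ℝ 1 ψ) (σ : Evec k) {χ : E2 → ℝ} (hχ : C1Test Ω χ) :
    ∫ x, χ x * (ψ (‖u x - σ‖ ^ 2) * ((ε ^ 2)⁻¹ * ⟪gradient V (u x), u x - σ⟫ + gradSq u x)
        + 2 * deriv ψ (‖u x - σ‖ ^ 2) *
          (⟪pder u 0 x, u x - σ⟫ ^ 2 + ⟪pder u 1 x, u x - σ⟫ ^ 2))
      = - ∑ j, ∫ x, pd χ j x * (ψ (‖u x - σ‖ ^ 2) * ⟪pder u j x, u x - σ⟫) := by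
  have hc := contDiffOn_well_field hΩ hs.1 hψ σ
  have hI : ∀ j, Integrable (fun x => χ x *
      pd (fun y => ψ (‖u y - σ‖ ^ 2) * ⟪pder u j y, u y - σ⟫) j x) := fun j =>
    hχ.test.integrable_mul hΩ
      (((hc j).continuousOn_fderiv_of_isOpen hΩ (by simp)).clm_apply continuousOn_const) volume
  simp only [fun j => integral_pd_mul_test hΩ (hc j) hχ j, Finset.sum_neg_distrib, neg_neg,
    Fin.sum_univ_two]
  rw [← integral_add (hI 0) (hI 1)]
  congr 1
  funext x
  by_cases hx : x ∈ Ω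
  · rw [pd_well_field hΩ hs.1 hψ σ hx, pd_well_field hΩ hs.1 hψ σ hx, ← mul_add]
    have hl : ⟪fderiv ℝ (pder u 0) x (b2 0), u x - σ⟫ + ⟪fderiv ℝ (pder u 1) x (b2 1), u x - σ⟫
        = (ε ^ 2)⁻¹ * ⟪gradient V (u x), u x - σ⟫ := by
      rw [← inner_add_left, ← real_inner_smul_left, ← hs.2 x hx, lap, Fin.sum_univ_two]
    rw [← hl, gradSq_eq]
    ring
  · rw [image_eq_zero_of_notMem_tsupport (fun hh => hx (hχ.2.2 hh))]; simp

theorem sqrt_mul_le_one_add_eDens (hV : ∀ y, 0 ≤ V y) (hε : 0 < ε) (j : Fin 2) (x : E2) :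
    ε * ‖pder u j x‖ ≤ √ε * (1 + eDens V ε u x) := by
  have h1 := sq_norm_pder_le_gradSq u j x
  have h2 : ε / 2 * gradSq u x ≤ eDens V ε u x := by
    have : 0 ≤ ε⁻¹ * V (u x) := mul_nonneg (by positivity) (hV _)
    simp only [eDens]; linarith
  have h3 : √ε * √ε = ε := Real.mul_self_sqrt hε.le
  have h4 : √ε * ‖pder u j x‖ ≤ 1 + eDens V ε u x := by
    have : (√ε * ‖pder u j x‖) ^ 2 ≤ 2 * eDens V ε u x := by
      rw [mul_pow, pow_two √ε, h3]; nlinarith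
    nlinarith [sq_nonneg (√ε * ‖pder u j x‖ - 1)]
  calc ε * ‖pder u j x‖ = √ε * (√ε * ‖pder u j x‖) := by rw [← mul_assoc, h3]
    _ ≤ _ := by gcongr

/-- Energy near a well is controlled by the gradient energy on the transition annulus, up to a
vanishing error. -/
theorem integral_cutoff_eDens_le (hΩ : IsOpen Ω) (hV : ContDiff ℝ (⊤ : ℕ∞) V)
    (hV0 : ∀ y, 0 ≤ V y) (hε : 0 < ε) (hs : IsSolution V ε Ω u) {σ : Evec k} {b : ℝ} (hb : 0 ≤ b)
    (hconv : ∀ y, ‖y - σ‖ ≤ b → V y ≤ ⟪gradient V y, y - σ⟫) {ψ : ℝ → ℝ}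
    (hψ : ContDiff ℝ 1 ψ) (h0 : ∀ q, 0 ≤ ψ q) (h1 : ∀ q, ψ q ≤ 1) (hsup : ∀ q, b ^ 2 ≤ q → ψ q = 0)
    {χ : E2 → ℝ} (hχ : C1Test Ω χ) (hχ0 : ∀ x, 0 ≤ χ x) :
    ∫ x, χ x * (ψ (‖u x - σ‖ ^ 2) * eDens V ε u x) ≤
      (∫ x, χ x * (2 * ‖u x - σ‖ ^ 2 * |deriv ψ (‖u x - σ‖ ^ 2)| * (ε * gradSq u x)))
      + √ε * b * ∑ j, ∫ x, |pd χ j x| * (1 + eDens V ε u x) := by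
  have hu := hs.1
  have huc : ContinuousOn u Ω := hu.continuousOn
  have hq : ContinuousOn (fun x => ‖u x - σ‖ ^ 2) Ω := (huc.sub continuousOn_const).norm.pow 2
  have hψq : ContinuousOn (fun x => ψ (‖u x - σ‖ ^ 2)) Ω := hψ.continuous.comp_continuousOn hq
  have hdq : ContinuousOn (fun x => deriv ψ (‖u x - σ‖ ^ 2)) Ω :=
    (hψ.continuous_deriv (by simp)).comp_continuousOn hq
  have hec : ContinuousOn (eDens V ε u) Ω := (contDiffOn_eDens hΩ hV hu).continuousOn
  have hgc : ContinuousOn (gradSq u) Ω := (contDiffOn_gradSq hΩ hu).continuousOn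
  have hpc : ∀ j, ContinuousOn (fun x => ⟪pder u j x, u x - σ⟫) Ω := fun j =>
    (contDiffOn_pder hΩ hu j).continuousOn.inner (huc.sub continuousOn_const)
  have hgrad : ContinuousOn (fun x => ⟪gradient V (u x), u x - σ⟫) Ω := by
    have : Continuous (gradient V) := by
      unfold gradient
      exact (InnerProductSpace.toDual ℝ (Evec k)).symm.continuous.comp
        (hV.continuous_fderiv (by simp))
    exact (this.comp_continuousOn huc).inner (huc.sub continuousOn_const)
  have hid := integral_well_field hΩ hs hψ σ hχ
  have hI1 := hχ.test.integrable_mul hΩ (g := fun x => ψ (‖u x - σ‖ ^ 2) * eDens V ε u x)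
    (hψq.mul hec) volume
  have hI2 := hχ.test.integrable_mul hΩ
    (g := fun x => 2 * ‖u x - σ‖ ^ 2 * |deriv ψ (‖u x - σ‖ ^ 2)| * (ε * gradSq u x))
    (((continuousOn_const (c := (2 : ℝ))).mul hq).mul hdq.abs |>.mul
      ((continuousOn_const (c := ε)).mul hgc)) volume
  have hI3 := hχ.test.integrable_mul hΩ
    (g := fun x => ψ (‖u x - σ‖ ^ 2) * ((ε ^ 2)⁻¹ * ⟪gradient V (u x), u x - σ⟫ + gradSq u x)
      + 2 * deriv ψ (‖u x - σ‖ ^ 2) *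
        (⟪pder u 0 x, u x - σ⟫ ^ 2 + ⟪pder u 1 x, u x - σ⟫ ^ 2))
        ((hψq.mul (((continuousOn_const (c := (ε ^ 2)⁻¹)).mul
    hgrad).add hgc)).add (((continuousOn_const (c := (2 : ℝ))).mul hdq).mul
      (((hpc 0).pow 2).add ((hpc 1).pow 2)))) volume
  have hstep : ∫ x, χ x * (ψ (‖u x - σ‖ ^ 2) * eDens V ε u x) ≤
      (∫ x, χ x * (2 * ‖u x - σ‖ ^ 2 * |deriv ψ (‖u x - σ‖ ^ 2)| * (ε * gradSq u x)))
      + ε * ∫ x, χ x * (ψ (‖u x - σ‖ ^ 2) * ((ε ^ 2)⁻¹ * ⟪gradient V (u x), u x - σ⟫ + gradSq u x)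
        + 2 * deriv ψ (‖u x - σ‖ ^ 2) *
          (⟪pder u 0 x, u x - σ⟫ ^ 2 + ⟪pder u 1 x, u x - σ⟫ ^ 2)) := by
    rw [← integral_const_mul, ← integral_add hI2 (hI3.const_mul ε)]
    refine integral_mono hI1 (hI2.add (hI3.const_mul ε)) fun x => ?_
    have hcs : ⟪pder u 0 x, u x - σ⟫ ^ 2 + ⟪pder u 1 x, u x - σ⟫ ^ 2
        ≤ ‖u x - σ‖ ^ 2 * gradSq u x := by
      have : ∀ j, ⟪pder u j x, u x - σ⟫ ^ 2 ≤ ‖pder u j x‖ ^ 2 * ‖u x - σ‖ ^ 2 := fun j => by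
        rw [← mul_pow]
        exact sq_le_sq' (by linarith [neg_abs_le ⟪pder u j x, u x - σ⟫,
          abs_real_inner_le_norm (pder u j x) (u x - σ)]) (real_inner_le_norm _ _)
      rw [gradSq_eq]; nlinarith [this 0, this 1]
    have hs0 : 0 ≤ ⟪pder u 0 x, u x - σ⟫ ^ 2 + ⟪pder u 1 x, u x - σ⟫ ^ 2 := by positivity
    set S := ⟪pder u 0 x, u x - σ⟫ ^ 2 + ⟪pder u 1 x, u x - σ⟫ ^ 2
    set q := ‖u x - σ‖ ^ 2 with hqdef
    have hpot : ψ q * (ε⁻¹ * V (u x)) ≤ ψ q * (ε⁻¹ * ⟪gradient V (u x), u x - σ⟫) := by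
      by_cases hle : ‖u x - σ‖ ≤ b
      · exact mul_le_mul_of_nonneg_left
          (mul_le_mul_of_nonneg_left (hconv _ hle) (by positivity)) (h0 _)
      · rw [hsup q (by rw [hqdef]; gcongr; exact (not_le.1 hle).le)]; simp
    have hg := gradSq_nonneg u x
    have hεε : ε * (ε ^ 2)⁻¹ = ε⁻¹ := by field_simp
    have hgr : ψ q * (ε / 2 * gradSq u x) ≤ ψ q * (ε * gradSq u x) :=
      mul_le_mul_of_nonneg_left (by nlinarith) (h0 _)
    have hdd : - (2 * q * |deriv ψ q| * (ε * gradSq u x)) ≤ ε * (2 * deriv ψ q * S) := by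
      have e1 : - (|deriv ψ q| * S) ≤ deriv ψ q * S := by
        nlinarith [neg_abs_le (deriv ψ q)]
      have e2 : |deriv ψ q| * S ≤ |deriv ψ q| * (q * gradSq u x) := by gcongr
      nlinarith
    change χ x * (ψ q * eDens V ε u x) ≤ χ x * (2 * q * |deriv ψ q| * (ε * gradSq u x)) +
      ε * (χ x * (ψ q * ((ε ^ 2)⁻¹ * ⟪gradient V (u x), u x - σ⟫ + gradSq u x)
        + 2 * deriv ψ q * S))
    have : ψ q * eDens V ε u x ≤ 2 * q * |deriv ψ q| * (ε * gradSq u x) +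
      ε * (ψ q * ((ε ^ 2)⁻¹ * ⟪gradient V (u x), u x - σ⟫ + gradSq u x)
        + 2 * deriv ψ q * S) := by
      have e3 : ε * (ψ q * ((ε ^ 2)⁻¹ * ⟪gradient V (u x), u x - σ⟫ + gradSq u x))
          = ψ q * (ε⁻¹ * ⟪gradient V (u x), u x - σ⟫) + ψ q * (ε * gradSq u x) := by
        rw [← hεε]; ring
      rw [mul_add ε, e3]
      simp only [eDens]
      linarith
    calc _ ≤ χ x * _ := mul_le_mul_of_nonneg_left this (hχ0 x)
      _ = _ := by ring
  refine hstep.trans (add_le_add le_rfl ?_)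
  rw [hid, ← Finset.sum_neg_distrib, Finset.mul_sum, Finset.mul_sum]
  refine Finset.sum_le_sum fun j _ => ?_
  rw [← integral_neg, ← integral_const_mul, ← integral_const_mul]
  refine integral_mono ?_ ?_ fun x => ?_
  · exact (((hχ.pd_test j).integrable_mul hΩ (hψq.mul (hpc j)) volume).neg).const_mul ε
  · exact ((hχ.pd_test j).abs.integrable_mul hΩ (continuousOn_const.add hec) volume).const_mul _
  · have hbd : |ψ (‖u x - σ‖ ^ 2) * ⟪pder u j x, u x - σ⟫| ≤ ‖pder u j x‖ * b := by
      by_cases hle : ‖u x - σ‖ ≤ b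
      · rw [abs_mul, abs_of_nonneg (h0 _)]
        calc ψ (‖u x - σ‖ ^ 2) * |⟪pder u j x, u x - σ⟫|
            ≤ 1 * (‖pder u j x‖ * ‖u x - σ‖) := by
              gcongr
              exacts [h1 _, abs_real_inner_le_norm _ _]
          _ ≤ _ := by rw [one_mul]; gcongr
      · rw [hsup _ (by gcongr; exact (not_le.1 hle).le)]; simp; positivity
    have hP := sqrt_mul_le_one_add_eDens (u := u) hV0 hε j x
    calc ε * -(pd χ j x * (ψ (‖u x - σ‖ ^ 2) * ⟪pder u j x, u x - σ⟫))
        ≤ ε * (|pd χ j x| * (‖pder u j x‖ * b)) := by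
          gcongr
          calc _ ≤ |pd χ j x * (ψ (‖u x - σ‖ ^ 2) * ⟪pder u j x, u x - σ⟫)| := neg_le_abs _
            _ = |pd χ j x| * |ψ (‖u x - σ‖ ^ 2) * ⟪pder u j x, u x - σ⟫| := abs_mul _ _
            _ ≤ _ := by gcongr
      _ = |pd χ j x| * b * (ε * ‖pder u j x‖) := by ring
      _ ≤ |pd χ j x| * b * (√ε * (1 + eDens V ε u x)) := by gcongr
      _ = √ε * b * (|pd χ j x| * (1 + eDens V ε u x)) := by ring

end WellTest

theorem eventually_norm_fderiv_sub_lt {E F : Type*} [NormedAddCommGroup E] [NormedSpace ℝ E]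
    [NormedAddCommGroup F] [NormedSpace ℝ F] {f : E → F} (hf : ContDiff ℝ 1 f) (x : E) {c : ℝ}
    (hc : 0 < c) : ∀ᶠ y in 𝓝 x, ‖fderiv ℝ f y - fderiv ℝ f x‖ < c :=
  (((hf.continuous_fderiv (by simp)).sub continuous_const).norm).continuousAt.eventually
    (gt_mem_nhds (by simpa using hc))

section Potential

variable {k : ℕ} {V : Evec k → ℝ}

theorem IsMultiWell.exists_pos_le_of_away (hV : IsMultiWell V) {ρ : ℝ} (hρ : 0 < ρ) :
    ∃ m > 0, ∀ y, (∀ σ, V σ = 0 → ρ ≤ ‖y - σ‖) → m ≤ V y := by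
  obtain ⟨R, hR⟩ := hV.coercive 1
  have hcl : IsClosed {y : Evec k | ∀ σ, V σ = 0 → ρ ≤ ‖y - σ‖} := by
    simp only [Set.ofPred_forall]
    exact isClosed_iInter fun σ => isClosed_iInter fun _ =>
      isClosed_le continuous_const (continuous_id.sub continuous_const).norm
  have hcomp : IsCompact (closedBall (0 : Evec k) R ∩ {y | ∀ σ, V σ = 0 → ρ ≤ ‖y - σ‖}) :=
    (isCompact_closedBall _ _).inter_right hcl
  obtain ⟨m, hm, hle⟩ := hcomp.exists_forall_le' (a := 0) hV.smooth.continuous.continuousOn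
    fun y hy => lt_of_le_of_ne (hV.nonneg y) fun h => by
      have := hy.2 y h.symm
      simp only [sub_self, norm_zero] at this
      linarith
  refine ⟨min 1 m, lt_min one_pos hm, fun y hy => ?_⟩
  by_cases h : ‖y‖ ≤ R
  · exact (min_le_right _ _).trans (hle y ⟨by simpa using h, hy⟩)
  · exact (min_le_left _ _).trans (hR y (not_le.1 h).le)

theorem IsMultiWell.eventually_convex_near_zero (hV : IsMultiWell V) {σ : Evec k} (hσ : V σ = 0) :
    ∀ᶠ b in 𝓝[>] (0 : ℝ), ∀ y, ‖y - σ‖ ≤ b → V y ≤ ⟪gradient V y, y - σ⟫ := by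
  have hd1 : ContDiff ℝ 1 (fderiv ℝ V) := hV.smooth.fderiv_right (by norm_cast)
  obtain ⟨c, hc, hle⟩ := (isCompact_sphere (0 : Evec k) 1).exists_forall_le' (a := 0)
    (f := fun w => fderiv ℝ (fderiv ℝ V) σ w w)
    ((fderiv ℝ (fderiv ℝ V) σ).continuous.clm_apply continuous_id).continuousOn
    fun w hw => by
      have hw0 : w ≠ 0 := by
        rintro rfl
        simp at hw
      have := hV.hess_posdef σ hσ w hw0
      rwa [iteratedFDeriv_two_apply] at this
  have hle' : ∀ w, c * ‖w‖ ^ 2 ≤ fderiv ℝ (fderiv ℝ V) σ w w := by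
    intro w
    by_cases hw : w = 0
    · simp [hw]
    have hn : ‖w‖ ≠ 0 := norm_ne_zero_iff.2 hw
    have h1 := hle (‖w‖⁻¹ • w) (by simp [norm_smul, hn])
    simp only [map_smul, smul_apply, smul_eq_mul] at h1
    have h2 := mul_le_mul_of_nonneg_left h1 (sq_nonneg ‖w‖)
    calc c * ‖w‖ ^ 2 = ‖w‖ ^ 2 * c := mul_comm _ _
      _ ≤ _ := h2
      _ = _ := by field_simp
  have hev : ∀ᶠ y in 𝓝 σ, ‖fderiv ℝ (fderiv ℝ V) y - fderiv ℝ (fderiv ℝ V) σ‖ < c :=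
    eventually_norm_fderiv_sub_lt hd1 σ hc
  obtain ⟨b₀, hb₀, hball⟩ := Metric.eventually_nhds_iff.1 hev
  filter_upwards [Ioo_mem_nhdsGT hb₀] with b hb y hy
  have hlt : ‖y - σ‖ < b₀ := hy.trans_lt hb.2
  set w := y - σ with hw
  have hline : ∀ t : ℝ, HasDerivAt (fun t : ℝ => σ + t • w) w t := fun t => by
    simpa using ((hasDerivAt_id t).smul_const w).const_add σ
  have hg : ∀ t : ℝ, HasDerivAt (fun t : ℝ => V (σ + t • w)) (fderiv ℝ V (σ + t • w) w) t :=
    fun t => (hV.smooth.differentiable (by simp) _).hasFDerivAt.comp_hasDerivAt t (hline t)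
  have hg2 : ∀ t : ℝ, HasDerivAt (fun t : ℝ => fderiv ℝ V (σ + t • w) w)
      (fderiv ℝ (fderiv ℝ V) (σ + t • w) w w) t := fun t => by
    have h1 := (hd1.differentiable (by simp) (σ + t • w)).hasFDerivAt.comp_hasDerivAt t (hline t)
    simpa using h1.clm_apply (hasDerivAt_const t w)
  have hh : ∀ t : ℝ, HasDerivAt
      (fun t : ℝ => t * fderiv ℝ V (σ + t • w) w - V (σ + t • w))
      (t * fderiv ℝ (fderiv ℝ V) (σ + t • w) w w) t := fun t => by
    refine (((hasDerivAt_id' t).fun_mul (hg2 t)).fun_sub (hg t)).congr_deriv ?_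
    ring
  have hmono : MonotoneOn (fun t : ℝ => t * fderiv ℝ V (σ + t • w) w - V (σ + t • w))
      (Set.Icc 0 1) := by
    refine monotoneOn_of_deriv_nonneg (convex_Icc 0 1)
      (fun t _ => (hh t).continuousAt.continuousWithinAt)
      (fun t _ => (hh t).differentiableAt.differentiableWithinAt) fun t ht => ?_
    rw [interior_Icc] at ht
    rw [(hh t).deriv]
    refine mul_nonneg ht.1.le ?_
    have hdist : dist (σ + t • w) σ < b₀ := by
      rw [dist_eq_norm, add_sub_cancel_left, norm_smul, Real.norm_of_nonneg ht.1.le]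
      nlinarith [norm_nonneg w, ht.2]
    have hc2 := hball hdist
    have h3 : |(fderiv ℝ (fderiv ℝ V) (σ + t • w) - fderiv ℝ (fderiv ℝ V) σ) w w|
        ≤ c * ‖w‖ ^ 2 := by
      rw [← Real.norm_eq_abs]
      refine (ContinuousLinearMap.le_opNorm₂ _ w w).trans ?_
      rw [mul_assoc, ← pow_two]
      gcongr
    have h4 := hle' w
    rw [show (fderiv ℝ (fderiv ℝ V) (σ + t • w) - fderiv ℝ (fderiv ℝ V) σ) w w
      = fderiv ℝ (fderiv ℝ V) (σ + t • w) w w - fderiv ℝ (fderiv ℝ V) σ w w from rfl] at h3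
    have := (abs_le.1 h3).1
    linarith
  have h01 := hmono (by simp : (0 : ℝ) ∈ Set.Icc (0 : ℝ) 1) (by simp : (1 : ℝ) ∈ Set.Icc (0 : ℝ) 1)
    zero_le_one
  have hy' : σ + w = y := by rw [hw]; abel
  simp only [zero_mul, zero_smul, add_zero, hσ, one_mul, one_smul, hy', sub_zero] at h01
  rw [inner_gradient_eq_fderiv]
  linarith

/-- A radius below which the wells are separated and the potential is convex-like near each of
them. -/
theorem IsMultiWell.exists_well_radius (hV : IsMultiWell V) :
    ∃ b > 0, (∀ σ, V σ = 0 → ∀ y, ‖y - σ‖ ≤ b → V y ≤ ⟪gradient V y, y - σ⟫) ∧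
      ∀ σ σ', V σ = 0 → V σ' = 0 → σ ≠ σ' → 2 * b ≤ ‖σ - σ'‖ := by
  have h1 : ∀ᶠ b in 𝓝[>] (0 : ℝ), ∀ σ ∈ {y : Evec k | V y = 0}, ∀ y, ‖y - σ‖ ≤ b →
      V y ≤ ⟪gradient V y, y - σ⟫ :=
    (eventually_all_finite hV.finite_zeros).2 fun σ hσ => hV.eventually_convex_near_zero hσ
  have h2 : ∀ᶠ b in 𝓝[>] (0 : ℝ), ∀ σ ∈ {y : Evec k | V y = 0}, ∀ σ' ∈ {y : Evec k | V y = 0},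
      σ ≠ σ' → 2 * b ≤ ‖σ - σ'‖ := by
    refine (eventually_all_finite hV.finite_zeros).2 fun σ _ =>
      (eventually_all_finite hV.finite_zeros).2 fun σ' _ => ?_
    by_cases h : σ = σ'
    · simp [h]
    have hp : 0 < ‖σ - σ'‖ / 2 := half_pos (norm_pos_iff.2 (sub_ne_zero.2 h))
    filter_upwards [Ioo_mem_nhdsGT hp] with b hb _
    linarith [hb.2]
  obtain ⟨b, ⟨h1, h2⟩, hb⟩ := ((h1.and h2).and self_mem_nhdsWithin).exists
  exact ⟨b, hb, h1, fun σ σ' h h' hne => h2 σ h σ' h' hne⟩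

theorem exists_bound_deriv_smoothTransition :
    ∃ C ≥ 0, ∀ x, |deriv Real.smoothTransition x| ≤ C := by
  have hc : Continuous (deriv Real.smoothTransition) :=
    (Real.smoothTransition.contDiff (n := 1)).continuous_deriv (by simp)
  obtain ⟨C, hC⟩ := isCompact_Icc.exists_bound_of_continuousOn
    (hc.continuousOn (s := Set.Icc (0 : ℝ) 1))
  refine ⟨max C 0, le_max_right _ _, fun x => ?_⟩
  by_cases hx : x ∈ Set.Icc (0 : ℝ) 1
  · exact (hC x hx).trans (le_max_left _ _)
  have hz : deriv Real.smoothTransition x = 0 := by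
    rcases lt_or_ge x 0 with h | h
    · refine IsLocalMin.deriv_eq_zero (Eventually.of_forall fun y => ?_)
      rw [Real.smoothTransition.zero_of_nonpos h.le]
      exact Real.smoothTransition.nonneg y
    · refine IsLocalMax.deriv_eq_zero (Eventually.of_forall fun y => ?_)
      rw [Real.smoothTransition.one_of_one_le (not_lt.1 fun h1 => hx ⟨h, h1.le⟩)]
      exact Real.smoothTransition.le_one y
  simp [hz]

/-- `ψ` is a cutoff of the squared radius, equal to `1` below `δ`, to `0` above `b ^ 2`, with
logarithmic slope at most `κ`. -/
structure IsCutoff (b κ δ : ℝ) (ψ : ℝ → ℝ) : Prop where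
  pos : 0 < δ
  lt_sq : δ < b ^ 2
  contDiff : ContDiff ℝ 1 ψ
  nonneg : ∀ q, 0 ≤ ψ q
  le_one : ∀ q, ψ q ≤ 1
  eq_zero : ∀ q, b ^ 2 ≤ q → ψ q = 0
  eq_one : ∀ q, 0 ≤ q → q ≤ δ → ψ q = 1
  slope : ∀ q, 0 ≤ q → 2 * q * |deriv ψ q| ≤ κ

theorem IsCutoff.deriv_eq_zero {b κ δ : ℝ} {ψ : ℝ → ℝ} (h : IsCutoff b κ δ ψ) {q : ℝ} (hq : 0 ≤ q)
    (hq' : q ≤ δ ∨ b ^ 2 ≤ q) : deriv ψ q = 0 := by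
  rcases hq' with h' | h'
  · refine IsLocalMax.deriv_eq_zero (Eventually.of_forall fun y => ?_)
    rw [h.eq_one q hq h']
    exact h.le_one y
  · refine IsLocalMin.deriv_eq_zero (Eventually.of_forall fun y => ?_)
    rw [h.eq_zero q h']
    exact h.nonneg y

theorem exists_isCutoff {b κ : ℝ} (hb : 0 < b) (hκ : 0 < κ) : ∃ δ ψ, IsCutoff b κ δ ψ := by
  obtain ⟨C, hC0, hC⟩ := exists_bound_deriv_smoothTransition
  set L := 4 * C / κ + 1 with hL
  have hLpos : 0 < L := by positivity
  set δ := √(b ^ 4 * Real.exp (-L) / 2) with hδ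
  have hδ2 : δ ^ 2 = b ^ 4 * Real.exp (-L) / 2 := Real.sq_sqrt (by positivity)
  have hδpos : 0 < δ := Real.sqrt_pos.2 (by positivity)
  have hpos : ∀ q : ℝ, 0 < q ^ 2 + δ ^ 2 := fun q => by positivity
  set f : ℝ → ℝ := fun q => (Real.log (b ^ 4) - Real.log (q ^ 2 + δ ^ 2)) / L with hf
  have hfd : ∀ q, HasDerivAt f (-(2 * q / (q ^ 2 + δ ^ 2)) / L) q := fun q => by
    have h1 : HasDerivAt (fun q : ℝ => q ^ 2 + δ ^ 2) (2 * q) q := by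
      simpa using (hasDerivAt_pow 2 q).add_const (δ ^ 2)
    exact ((h1.log (hpos q).ne').const_sub _).div_const L
  have hfc : ContDiff ℝ 1 f :=
    (contDiff_const.sub ((contDiff_id.pow 2 |>.add contDiff_const).log
      fun q => (hpos q).ne')).div_const L
  refine ⟨δ, fun q => Real.smoothTransition (f q), hδpos, ?_,
    Real.smoothTransition.contDiff.comp hfc, fun q => Real.smoothTransition.nonneg _,
    fun q => Real.smoothTransition.le_one _, fun q hq => ?_, fun q hq0 hq => ?_, fun q hq0 => ?_⟩
  · have he : Real.exp (-L) < 1 := Real.exp_lt_one_iff.2 (by linarith)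
    have : δ ^ 2 < (b ^ 2) ^ 2 := by
      rw [hδ2]; nlinarith [pow_pos hb 4]
    exact lt_of_pow_lt_pow_left₀ 2 (by positivity) this
  · refine Real.smoothTransition.zero_of_nonpos (div_nonpos_of_nonpos_of_nonneg ?_ hLpos.le)
    have : Real.log (b ^ 4) ≤ Real.log (q ^ 2 + δ ^ 2) :=
      Real.log_le_log (by positivity) (by nlinarith [sq_nonneg δ, pow_pos hb 2])
    linarith
  · refine Real.smoothTransition.one_of_one_le ((one_le_div hLpos).2 ?_)
    have h1 : q ^ 2 + δ ^ 2 ≤ b ^ 4 * Real.exp (-L) := by nlinarith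
    have h2 := Real.log_le_log (hpos q) h1
    rw [Real.log_mul (by positivity) (Real.exp_pos _).ne', Real.log_exp] at h2
    linarith
  · have hd : HasDerivAt (fun q => Real.smoothTransition (f q))
        (deriv Real.smoothTransition (f q) * (-(2 * q / (q ^ 2 + δ ^ 2)) / L)) q :=
      (((Real.smoothTransition.contDiff (n := 1)).differentiable (by simp)
        (f q)).hasDerivAt).comp q (hfd q)
    rw [hd.deriv, abs_mul, abs_div, abs_neg, abs_of_nonneg (by positivity : 0 ≤ 2 * q /
      (q ^ 2 + δ ^ 2)), abs_of_pos hLpos]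
    have hfrac : 2 * q * (2 * q / (q ^ 2 + δ ^ 2)) ≤ 4 := by
      rw [mul_div_assoc', div_le_iff₀ (hpos q)]
      nlinarith [sq_nonneg δ]
    have hCL : 4 * C ≤ κ * L := by
      rw [hL, mul_add, mul_div_cancel₀ _ hκ.ne']; linarith
    calc 2 * q * (|deriv Real.smoothTransition (f q)| * (2 * q / (q ^ 2 + δ ^ 2) / L))
        = |deriv Real.smoothTransition (f q)| * (2 * q * (2 * q / (q ^ 2 + δ ^ 2))) / L := by ring
      _ ≤ C * 4 / L := by
        gcongr
        exact hC _
      _ ≤ κ := by rw [div_le_iff₀ hLpos]; linarith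

/-- `H` varies along any curve by at most the energy of the curve. -/
def SubEikonal (V H : Evec k → ℝ) : Prop :=
  ContDiff ℝ 1 H ∧ ∀ y w, |fderiv ℝ H y w| ≤ √(2 * V y) * ‖w‖

theorem fderiv_comp_norm_sub_sq {g : ℝ → ℝ} (hg : ContDiff ℝ 1 g) (σ y w : Evec k) :
    fderiv ℝ (fun y => g (‖y - σ‖ ^ 2)) y w = deriv g (‖y - σ‖ ^ 2) * (2 * ⟪y - σ, w⟫) := by
  have hsub : HasFDerivAt (fun y : Evec k => y - σ) (ContinuousLinearMap.id ℝ (Evec k)) y :=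
    (hasFDerivAt_id y).sub_const σ
  have h2 := ((hg.differentiable (by simp) _).hasDerivAt.comp_hasFDerivAt y hsub.norm_sq)
  change fderiv ℝ (g ∘ fun y => ‖y - σ‖ ^ 2) y w = _
  rw [h2.fderiv]
  simp only [smul_apply, ContinuousLinearMap.comp_apply, ContinuousLinearMap.id_apply,
    innerSL_apply_apply, smul_eq_mul, nsmul_eq_mul, Nat.cast_ofNat]

theorem contDiff_comp_norm_sub_sq {g : ℝ → ℝ} (hg : ContDiff ℝ 1 g) (σ : Evec k) :
    ContDiff ℝ 1 (fun y => g (‖y - σ‖ ^ 2)) :=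
  hg.comp ((contDiff_id.sub contDiff_const).norm_sq ℝ)

theorem IsMultiWell.exists_subEikonal_proper (hV : IsMultiWell V) :
    ∃ H, SubEikonal V H ∧ ∀ C, ∃ R, ∀ y, H y ≤ C → ‖y‖ ≤ R := by
  obtain ⟨R₁, hR₁⟩ := hV.coercive 1
  set R₀ := max R₁ 1 with hR₀
  have hR₀1 : 1 ≤ R₀ := le_max_right _ _
  have hden : ∀ t : ℝ, 0 < 2 * √(max t 0 + R₀ ^ 2) := fun t => by
    have : 0 ≤ max t 0 := le_max_right _ _
    positivity
  set g : ℝ → ℝ := fun t => min (max t 0) 1 / (2 * √(max t 0 + R₀ ^ 2)) with hg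
  have hgc : Continuous g := by
    refine Continuous.div (by fun_prop) (by fun_prop) fun t => (hden t).ne'
  have hg0 : ∀ t, 0 ≤ g t := fun t =>
    div_nonneg (le_min (le_max_right _ _) zero_le_one) (hden t).le
  set G : ℝ → ℝ := fun t => ∫ s in (0 : ℝ)..t, g s with hG
  have hGd : ∀ t, HasDerivAt G (g t) t := fun t =>
    intervalIntegral.integral_hasDerivAt_right (hgc.intervalIntegrable _ _)
      (hgc.stronglyMeasurableAtFilter _ _) hgc.continuousAt
  have hGderiv : deriv G = g := funext fun t => (hGd t).deriv
  have hG1 : ContDiff ℝ 1 G :=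
    contDiff_one_iff_deriv.2 ⟨fun t => (hGd t).differentiableAt, by rw [hGderiv]; exact hgc⟩
  have hG1' : ContDiff ℝ 1 fun t => G (t - R₀ ^ 2) := hG1.comp (contDiff_id.sub contDiff_const)
  refine ⟨fun y => G (‖y - 0‖ ^ 2 - R₀ ^ 2),
    ⟨contDiff_comp_norm_sub_sq hG1' 0, fun y w => ?_⟩, fun C => ?_⟩
  · rw [fderiv_comp_norm_sub_sq hG1', deriv_comp_sub_const, hGderiv, sub_zero]
    by_cases hy : ‖y‖ ≤ R₀
    · have hneg : ‖y‖ ^ 2 - R₀ ^ 2 ≤ 0 := by nlinarith [norm_nonneg y]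
      have : g (‖y‖ ^ 2 - R₀ ^ 2) = 0 := by simp [hg, max_eq_right hneg]
      rw [this, zero_mul, abs_zero]; positivity
    · have hy' : R₀ < ‖y‖ := not_le.1 hy
      have hpos : 0 ≤ ‖y‖ ^ 2 - R₀ ^ 2 := by nlinarith
      have hV1 : 1 ≤ V y := hR₁ y ((le_max_left _ _).trans hy'.le)
      have hs : 1 ≤ √(2 * V y) := Real.one_le_sqrt.2 (by linarith)
      have hgle : g (‖y‖ ^ 2 - R₀ ^ 2) ≤ 1 / (2 * ‖y‖) := by
        simp only [hg, max_eq_left hpos, sub_add_cancel, Real.sqrt_sq (norm_nonneg y)]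
        gcongr
        exact min_le_right _ _
      rw [abs_mul, abs_of_nonneg (hg0 _), abs_mul, abs_two]
      have hyp : 0 < ‖y‖ := by linarith
      calc g (‖y‖ ^ 2 - R₀ ^ 2) * (2 * |⟪y, w⟫|) ≤ 1 / (2 * ‖y‖) * (2 * (‖y‖ * ‖w‖)) := by
            gcongr
            exact abs_real_inner_le_norm _ _
        _ = 1 * ‖w‖ := by field_simp
        _ ≤ _ := by gcongr
  · refine ⟨2 * |C| + R₀ ^ 2 + 2, fun y hy => ?_⟩
    by_contra! hlt
    simp only [sub_zero] at hy
    have hC := le_abs_self C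
    have hC0 := abs_nonneg C
    have hR2 : 1 ≤ R₀ ^ 2 := by nlinarith
    set t := ‖y‖ ^ 2 - R₀ ^ 2 with ht
    have ht1 : 1 ≤ t := by nlinarith
    have hyp : 0 < ‖y‖ := by linarith
    have hlow : (t - 1) * (1 / (2 * ‖y‖)) ≤ G t := by
      have h1 : G t = (∫ s in (0 : ℝ)..1, g s) + ∫ s in (1 : ℝ)..t, g s :=
        (intervalIntegral.integral_add_adjacent_intervals (hgc.intervalIntegrable _ _)
          (hgc.intervalIntegrable _ _)).symm
      have h2 : 0 ≤ ∫ s in (0 : ℝ)..1, g s :=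
        intervalIntegral.integral_nonneg zero_le_one fun s _ => hg0 s
      have h3 : ∫ s in (1 : ℝ)..t, (1 / (2 * ‖y‖)) ≤ ∫ s in (1 : ℝ)..t, g s := by
        refine intervalIntegral.integral_mono_on ht1 intervalIntegrable_const
          (hgc.intervalIntegrable _ _) fun s hs => ?_
        have hs0 : 0 ≤ s := by linarith [hs.1]
        simp only [hg, max_eq_left hs0, min_eq_right hs.1]
        have : √(s + R₀ ^ 2) ≤ ‖y‖ := Real.sqrt_le_iff.2 ⟨hyp.le, by linarith [hs.2]⟩
        have : 0 < √(s + R₀ ^ 2) := Real.sqrt_pos.2 (by positivity)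
        gcongr
      rw [intervalIntegral.integral_const, smul_eq_mul] at h3
      linarith
    have h5 : (t - 1) * (1 / (2 * ‖y‖)) ≤ C := hlow.trans hy
    rw [mul_one_div, div_le_iff₀ (by positivity)] at h5
    nlinarith

theorem IsMultiWell.exists_subEikonal_trap (hV : IsMultiWell V) {b κ δ : ℝ} {ψ : ℝ → ℝ}
    (hb : 0 < b)
    (hsep : ∀ σ σ', V σ = 0 → V σ' = 0 → σ ≠ σ' → 2 * b ≤ ‖σ - σ'‖)
    (hψ : IsCutoff b κ δ ψ) :
    ∃ c > 0, ∀ σ, V σ = 0 → SubEikonal V fun y => c * (1 - ψ (‖y - σ‖ ^ 2)) := by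
  have hδ := hψ.pos
  have hsδ : 0 < √δ := Real.sqrt_pos.2 hδ
  obtain ⟨m, hm, hmV⟩ := hV.exists_pos_le_of_away hsδ
  have hκ0 : 0 ≤ κ := le_trans (by simp) (hψ.slope 0 le_rfl)
  refine ⟨√(2 * m) * √δ / (κ + 1), by positivity, fun σ hσ => ?_⟩
  set c := √(2 * m) * √δ / (κ + 1) with hc
  have hcpos : 0 < c := by positivity
  have hg : ContDiff ℝ 1 fun q => c * (1 - ψ q) :=
    contDiff_const.mul (contDiff_const.sub hψ.contDiff)
  refine ⟨contDiff_comp_norm_sub_sq hg σ, fun y w => ?_⟩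
  rw [fderiv_comp_norm_sub_sq hg]
  have hder : deriv (fun q => c * (1 - ψ q)) (‖y - σ‖ ^ 2) = - (c * deriv ψ (‖y - σ‖ ^ 2)) := by
    have hd := (hψ.contDiff.differentiable (by simp) (‖y - σ‖ ^ 2)).hasDerivAt
    have := ((hd.const_sub 1).const_mul c).deriv
    rw [this]; ring
  rw [hder]
  by_cases hin : δ < ‖y - σ‖ ^ 2 ∧ ‖y - σ‖ ^ 2 < b ^ 2
  · have hlow : √δ ≤ ‖y - σ‖ := Real.sqrt_le_iff.2 ⟨norm_nonneg _, hin.1.le⟩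
    have hup : ‖y - σ‖ < b := lt_of_pow_lt_pow_left₀ 2 hb.le hin.2
    have hVm : m ≤ V y := hmV y fun σ' hσ' => by
      by_cases h : σ' = σ
      · rw [h]; exact hlow
      · have h1 := hsep σ' σ hσ' hσ h
        have h2 : ‖σ' - σ‖ ≤ ‖y - σ'‖ + ‖y - σ‖ := by
          rw [norm_sub_rev y σ']; exact norm_sub_le_norm_sub_add_norm_sub _ _ _
        linarith
    have hs : √(2 * m) ≤ √(2 * V y) := Real.sqrt_le_sqrt (by linarith)
    have hnp : 0 < ‖y - σ‖ := hsδ.trans_le hlow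
    have hsl := hψ.slope (‖y - σ‖ ^ 2) (by positivity)
    have hsl2 : 2 * ‖y - σ‖ * |deriv ψ (‖y - σ‖ ^ 2)| * √δ ≤ κ := by
      refine le_trans ?_ hsl
      calc 2 * ‖y - σ‖ * |deriv ψ (‖y - σ‖ ^ 2)| * √δ
          ≤ 2 * ‖y - σ‖ * |deriv ψ (‖y - σ‖ ^ 2)| * ‖y - σ‖ := by gcongr
        _ = _ := by ring
    have hmain : c * (2 * ‖y - σ‖ * |deriv ψ (‖y - σ‖ ^ 2)|) ≤ √(2 * m) := by
      rw [hc, div_mul_eq_mul_div, div_le_iff₀ (by positivity)]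
      have := mul_le_mul_of_nonneg_left hsl2 (Real.sqrt_nonneg (2 * m))
      nlinarith [Real.sqrt_nonneg (2 * m)]
    rw [abs_mul, abs_neg, abs_mul, abs_of_pos hcpos, abs_mul, abs_two]
    calc c * |deriv ψ (‖y - σ‖ ^ 2)| * (2 * |⟪y - σ, w⟫|)
        ≤ c * |deriv ψ (‖y - σ‖ ^ 2)| * (2 * (‖y - σ‖ * ‖w‖)) := by
          gcongr
          exact abs_real_inner_le_norm _ _
      _ = c * (2 * ‖y - σ‖ * |deriv ψ (‖y - σ‖ ^ 2)|) * ‖w‖ := by ring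
      _ ≤ √(2 * V y) * ‖w‖ := by gcongr; exact hmain.trans hs
  · have : deriv ψ (‖y - σ‖ ^ 2) = 0 := hψ.deriv_eq_zero (by positivity) (by
      by_contra! h
      exact hin h)
    rw [this]
    simp only [mul_zero, neg_zero, zero_mul, abs_zero]
    positivity

end Potential

/-- The point of the plane whose `i`-th coordinate is `s` and whose other coordinate is `t`. -/
def pt (i : Fin 2) (s t : ℝ) : E2 := s • b2 i + t • b2 (1 - i)

/-- The closed square with centre `x` and half-side `r`. -/
def csq (x : E2) (r : ℝ) : Set E2 := {y | ∀ i, |y i - x i| ≤ r}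

/-- The open square with centre `x` and half-side `r`. -/
def osq (x : E2) (r : ℝ) : Set E2 := {y | ∀ i, |y i - x i| < r}

/-- The integral of `F` over the line on which the `i`-th coordinate is `s`. -/
def lineInt (F : E2 → ℝ) (i : Fin 2) (s : ℝ) : ℝ := ∫ t, F (pt i s t)

@[simp] theorem pt_apply_self (i : Fin 2) (s t : ℝ) : pt i s t i = s := by
  fin_cases i <;> simp [pt, b2]

@[simp] theorem pt_apply_other (i : Fin 2) (s t : ℝ) : pt i s t (1 - i) = t := by
  fin_cases i <;> simp [pt, b2]

theorem forall_fin_two_iff {P : Fin 2 → Prop} (i : Fin 2) : (∀ j, P j) ↔ P i ∧ P (1 - i) := by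
  rw [Fin.forall_fin_two]
  fin_cases i
  · rfl
  · exact and_comm

theorem pt_coord (i : Fin 2) (x : E2) : pt i (x i) (x (1 - i)) = x := by
  ext j
  revert j
  rw [forall_fin_two_iff i]
  simp

theorem continuous_pt (i : Fin 2) : Continuous fun p : ℝ × ℝ => pt i p.1 p.2 := by
  unfold pt; fun_prop

theorem pt_mem_csq {i : Fin 2} {x : E2} {r s t : ℝ} :
    pt i s t ∈ csq x r ↔ |s - x i| ≤ r ∧ |t - x (1 - i)| ≤ r := by
  simp only [csq, Set.mem_ofPred_eq]
  rw [forall_fin_two_iff i]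
  simp

theorem isClosed_csq (x : E2) (r : ℝ) : IsClosed (csq x r) := by
  have : csq x r = ⋂ i, {y | |y i - x i| ≤ r} := by ext; simp [csq]
  rw [this]
  exact isClosed_iInter fun i => isClosed_le (by fun_prop) continuous_const

theorem isOpen_osq (x : E2) (r : ℝ) : IsOpen (osq x r) := by
  have : osq x r = ⋂ i, {y | |y i - x i| < r} := by ext; simp [osq]
  rw [this]
  exact isOpen_iInter_of_finite fun i => isOpen_lt (by fun_prop) continuous_const

theorem osq_subset_csq (x : E2) (r : ℝ) : osq x r ⊆ csq x r := fun _ hy i => (hy i).le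

theorem csq_subset_csq {x y : E2} {r s : ℝ} (h : ∀ i, |y i - x i| + s ≤ r) : csq y s ⊆ csq x r := by
  intro z hz i
  have h1 := abs_sub_le (z i) (y i) (x i)
  linarith [hz i, h i]

theorem csq_mono {x : E2} {r s : ℝ} (h : s ≤ r) : csq x s ⊆ csq x r :=
  fun _ hz i => (hz i).trans h

theorem csq_subset_osq {x : E2} {r s : ℝ} (h : s < r) : csq x s ⊆ osq x r :=
  fun _ hz i => (hz i).trans_lt h

theorem abs_coord_sub_le_dist (x y : E2) (i : Fin 2) : |x i - y i| ≤ dist x y := by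
  rw [dist_eq_norm]
  exact PiLp.norm_apply_le (x - y) i

theorem closedBall_subset_csq (x : E2) (r : ℝ) : closedBall x r ⊆ csq x r :=
  fun y hy i => (abs_coord_sub_le_dist y x i).trans hy

theorem csq_subset_closedBall {x : E2} {r : ℝ} : csq x r ⊆ closedBall x (2 * r) := by
  intro y hy
  have h0 : 0 ≤ r := (abs_nonneg _).trans (hy 0)
  rw [mem_closedBall, EuclideanSpace.dist_eq, Real.sqrt_le_left (by positivity), Fin.sum_univ_two]
  have h (i) : dist (y i) (x i) ^ 2 ≤ r ^ 2 := by
    rw [Real.dist_eq]; exact pow_le_pow_left₀ (abs_nonneg _) (hy i) 2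
  nlinarith [h 0, h 1, sq_nonneg r]

theorem isCompact_csq (x : E2) (r : ℝ) : IsCompact (csq x r) :=
  (isCompact_closedBall x (2 * r)).of_isClosed_subset (isClosed_csq x r) csq_subset_closedBall

theorem measurePreserving_pt (i : Fin 2) :
    MeasurePreserving (fun p : ℝ × ℝ => pt i p.1 p.2) volume volume := by
  have h0 : MeasurePreserving (fun p : ℝ × ℝ => pt 0 p.1 p.2) volume volume := by
    have h1 : MeasurePreserving (fun p : Fin 2 → ℝ => (WithLp.toLp 2 p : E2)) volume volume :=
      PiLp.volume_preserving_toLp (Fin 2)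
    have h := h1.comp (volume_preserving_finTwoArrow ℝ).symm
    refine (congrArg (fun f => MeasurePreserving f volume volume) ?_).mp h
    funext p
    ext j
    revert j
    rw [forall_fin_two_iff 0]
    simp [pt, b2, MeasurableEquiv.finTwoArrow, MeasurableEquiv.piFinTwo]
  fin_cases i
  · exact h0
  · have h := h0.comp (Measure.measurePreserving_swap (μ := (volume : Measure ℝ))
      (ν := (volume : Measure ℝ)))
    refine (congrArg (fun f => MeasurePreserving f volume volume) ?_).mp h
    funext p
    simp [pt, add_comm]

theorem abs_coord_le_of_tsupport {F : E2 → ℝ} {R : ℝ}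
    (hR : ∀ x, F x ≠ 0 → ‖x‖ ≤ R) {i : Fin 2} {s t : ℝ} (h : F (pt i s t) ≠ 0) :
    |s| ≤ R ∧ |t| ≤ R := by
  have h1 := PiLp.norm_apply_le (pt i s t) i
  have h2 := PiLp.norm_apply_le (pt i s t) (1 - i)
  simp only [pt_apply_self, pt_apply_other, Real.norm_eq_abs] at h1 h2
  exact ⟨h1.trans (hR _ h), h2.trans (hR _ h)⟩

theorem exists_norm_le_of_hasCompactSupport {F : E2 → ℝ} (hF : HasCompactSupport F) :
    ∃ R, ∀ x, F x ≠ 0 → ‖x‖ ≤ R := by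
  obtain ⟨R, hR⟩ := hF.isCompact.isBounded.exists_norm_le
  exact ⟨R, fun x hx => hR x (subset_tsupport _ hx)⟩

theorem hasCompactSupport_pt {F : E2 → ℝ} (hF : HasCompactSupport F) (i : Fin 2) (s : ℝ) :
    HasCompactSupport fun t => F (pt i s t) := by
  obtain ⟨R, hR⟩ := exists_norm_le_of_hasCompactSupport hF
  refine HasCompactSupport.intro (isCompact_Icc (a := -R) (b := R)) fun t ht => ?_
  by_contra h
  exact ht (abs_le.1 (abs_coord_le_of_tsupport hR h).2)

theorem continuous_line {F : E2 → ℝ} (hF : Continuous F) (i : Fin 2) (s : ℝ) :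
    Continuous fun t => F (pt i s t) :=
  hF.comp ((continuous_pt i).comp (by fun_prop : Continuous fun t => (s, t)))

theorem integrable_line {F : E2 → ℝ} (hF : Continuous F) (hc : HasCompactSupport F) (i : Fin 2)
    (s : ℝ) : Integrable fun t => F (pt i s t) :=
  (continuous_line hF i s).integrable_of_hasCompactSupport (hasCompactSupport_pt hc i s)

theorem continuous_lineInt {F : E2 → ℝ} (hF : Continuous F) (hc : HasCompactSupport F)
    (i : Fin 2) : Continuous (lineInt F i) := by
  obtain ⟨R, hR⟩ := exists_norm_le_of_hasCompactSupport hc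
  have h : lineInt F i = fun s => ∫ t in Set.Icc (-R) R, F (pt i s t) := by
    ext s
    refine (setIntegral_eq_integral_of_forall_compl_eq_zero fun t ht => ?_).symm
    by_contra h
    exact ht (abs_le.1 (abs_coord_le_of_tsupport hR h).2)
  rw [h]
  exact continuous_parametric_integral_of_continuous (f := fun s t => F (pt i s t))
    (hF.comp (continuous_pt i)) isCompact_Icc

theorem hasCompactSupport_lineInt {F : E2 → ℝ} (hc : HasCompactSupport F)
    (i : Fin 2) : HasCompactSupport (lineInt F i) := by
  obtain ⟨R, hR⟩ := exists_norm_le_of_hasCompactSupport hc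
  refine HasCompactSupport.intro (isCompact_Icc (a := -R) (b := R)) fun s hs => ?_
  unfold lineInt
  rw [integral_eq_zero_of_ae (ae_of_all _ fun t => ?_)]
  by_contra h
  exact hs (abs_le.1 (abs_coord_le_of_tsupport hR h).1)

theorem integral_lineInt {F : E2 → ℝ} (hF : Continuous F) (hc : HasCompactSupport F)
    (i : Fin 2) : ∫ s, lineInt F i s = ∫ x, F x := by
  have hi : Integrable F := hF.integrable_of_hasCompactSupport hc
  have hmp := measurePreserving_pt i
  have h1 : ∫ p : ℝ × ℝ, F (pt i p.1 p.2) = ∫ x, F x := by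
    rw [← hmp.map_eq, integral_map hmp.aemeasurable hF.aestronglyMeasurable]
  rw [← h1]
  have h2 : Integrable (fun p : ℝ × ℝ => F (pt i p.1 p.2)) := hmp.integrable_comp_of_integrable hi
  exact (integral_prod _ h2).symm

theorem lineInt_nonneg {F : E2 → ℝ} (h0 : ∀ x, 0 ≤ F x) (i : Fin 2) (s : ℝ) : 0 ≤ lineInt F i s :=
  integral_nonneg fun _ => h0 _

theorem exists_lineInt_le {F : E2 → ℝ} (hF : Continuous F) (hc : HasCompactSupport F)
    (h0 : ∀ x, 0 ≤ F x) (i : Fin 2) {α β : ℝ} (h : α < β) :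
    ∃ s ∈ Set.Icc α β, (β - α) * lineInt F i s ≤ ∫ x, F x := by
  have hint : Integrable (lineInt F i) :=
    (continuous_lineInt hF hc i).integrable_of_hasCompactSupport (hasCompactSupport_lineInt hc i)
  have hv : volume (Set.Icc α β) = ENNReal.ofReal (β - α) := Real.volume_Icc
  obtain ⟨s, hs, hle⟩ := exists_le_setAverage (μ := volume) (s := Set.Icc α β)
    (by simpa [hv] using h) (by simp [hv]) hint.integrableOn
  refine ⟨s, hs, ?_⟩
  have h2 : ∫ s in Set.Icc α β, lineInt F i s ≤ ∫ s, lineInt F i s :=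
    setIntegral_le_integral hint (ae_of_all _ fun s => lineInt_nonneg h0 i s)
  rw [integral_lineInt hF hc] at h2
  have hpos : 0 < β - α := sub_pos.2 h
  rw [setAverage_eq, smul_eq_mul, Real.volume_real_Icc_of_le h.le, inv_mul_eq_div,
    le_div_iff₀ hpos] at hle
  linarith

theorem exists_mul_le_lineInt {F : E2 → ℝ} (hF : Continuous F) (hc : HasCompactSupport F)
    (h0 : ∀ x, 0 ≤ F x) (i : Fin 2) (s : ℝ) {α β : ℝ} (h : α < β) :
    ∃ t ∈ Set.Icc α β, (β - α) * F (pt i s t) ≤ lineInt F i s := by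
  have hint := integrable_line hF hc i s
  have hv : volume (Set.Icc α β) = ENNReal.ofReal (β - α) := Real.volume_Icc
  obtain ⟨t, ht, hle⟩ := exists_le_setAverage (μ := volume) (s := Set.Icc α β)
    (by simpa [hv] using h) (by simp [hv]) hint.integrableOn
  refine ⟨t, ht, ?_⟩
  have h2 : ∫ t in Set.Icc α β, F (pt i s t) ≤ lineInt F i s :=
    setIntegral_le_integral hint (ae_of_all _ fun t => h0 _)
  have hpos : 0 < β - α := sub_pos.2 h
  rw [setAverage_eq, smul_eq_mul, Real.volume_real_Icc_of_le h.le, inv_mul_eq_div,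
    le_div_iff₀ hpos] at hle
  linarith

theorem hasDerivAt_pt (i : Fin 2) (s t : ℝ) : HasDerivAt (fun t => pt i s t) (b2 (1 - i)) t := by
  simpa [pt] using ((hasDerivAt_id t).smul_const (b2 (1 - i))).const_add (s • b2 i)

theorem potential_le_eDens {k : ℕ} (V : Evec k → ℝ) {ε : ℝ} (hε : 0 < ε)
    (u : E2 → Evec k) (x : E2) : ε⁻¹ * V (u x) ≤ eDens V ε u x := by
  have := gradSq_nonneg u x
  have : 0 ≤ ε / 2 * gradSq u x := by positivity
  unfold eDens; linarith

theorem sqrt_mul_norm_pder_le_eDens {k : ℕ} {V : Evec k → ℝ} (hV : ∀ y, 0 ≤ V y) {ε : ℝ}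
    (hε : 0 < ε) (u : E2 → Evec k) (i : Fin 2) (x : E2) :
    √(2 * V (u x)) * ‖pder u i x‖ ≤ eDens V ε u x := by
  have h1 := sq_norm_pder_le_gradSq u i x
  have h2 : √(2 * V (u x)) ^ 2 = 2 * V (u x) := Real.sq_sqrt (by linarith [hV (u x)])
  have h3 : ε * (√(2 * V (u x)) * ‖pder u i x‖) ≤ ε * eDens V ε u x := by
    have : ε * eDens V ε u x = ε ^ 2 / 2 * gradSq u x + V (u x) := by
      unfold eDens; field_simp
    rw [this]
    have h4 : ε ^ 2 / 2 * ‖pder u i x‖ ^ 2 ≤ ε ^ 2 / 2 * gradSq u x :=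
      mul_le_mul_of_nonneg_left h1 (by positivity)
    nlinarith [sq_nonneg (ε * ‖pder u i x‖ - √(2 * V (u x)))]
  exact le_of_mul_le_mul_left h3 hε

theorem SubEikonal.abs_sub_le_lineInt {k : ℕ} {V H : Evec k → ℝ} (hH : SubEikonal V H)
    (hV : ∀ y, 0 ≤ V y) {ε : ℝ} (hε : 0 < ε) {Ω : Set E2} (hΩ : IsOpen Ω) {u : E2 → Evec k}
    (hu : ContDiffOn ℝ (⊤ : ℕ∞) u Ω) {i : Fin 2} {s a b : ℝ}
    (hab : ∀ t ∈ Set.uIcc a b, pt i s t ∈ Ω) {F : E2 → ℝ} (hF : Continuous F)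
    (hc : HasCompactSupport F) (h0 : ∀ x, 0 ≤ F x)
    (hle : ∀ t ∈ Set.uIcc a b, eDens V ε u (pt i s t) ≤ F (pt i s t)) :
    |H (u (pt i s b)) - H (u (pt i s a))| ≤ lineInt F i s := by
  set f' : ℝ → ℝ := fun t => fderiv ℝ H (u (pt i s t)) (pder u (1 - i) (pt i s t))
  have hHd := hH.1.differentiable (by simp)
  have hder : ∀ t ∈ Set.uIcc a b, HasDerivAt (fun t => H (u (pt i s t))) (f' t) t := fun t ht =>
    (hHd _).hasFDerivAt.comp_hasDerivAt t
      ((differentiableAt_of_contDiffOn hΩ hu (hab t ht)).hasFDerivAt.comp_hasDerivAt t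
        (hasDerivAt_pt i s t))
  have hline : ContinuousOn (fun t => pt i s t) (Set.uIcc a b) := fun t _ =>
    (hasDerivAt_pt i s t).continuousAt.continuousWithinAt
  have hD : ContinuousOn (fun t => fderiv ℝ H (u (pt i s t))) (Set.uIcc a b) :=
    (hH.1.continuous_fderiv (by simp)).comp_continuousOn (hu.continuousOn.comp hline hab)
  have hcont : ContinuousOn f' (Set.uIcc a b) :=
    hD.clm_apply ((contDiffOn_pder hΩ hu (1 - i)).continuousOn.comp hline hab)
  rw [← intervalIntegral.integral_eq_sub_of_hasDerivAt hder hcont.intervalIntegrable]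
  have hb : ∀ t ∈ Set.uIcc a b, |f' t| ≤ F (pt i s t) := fun t ht =>
    ((hH.2 _ _).trans (sqrt_mul_norm_pder_le_eDens hV hε u _ _)).trans (hle t ht)
  calc |(∫ t in a..b, f' t)| ≤ |(∫ t in a..b, F (pt i s t))| := by
        refine intervalIntegral.norm_integral_le_abs_of_norm_le (f := f') ?_
          (integrable_line hF hc i s).intervalIntegrable
        exact (ae_restrict_mem measurableSet_uIoc).mono fun t ht =>
          hb t (Set.uIoc_subset_uIcc ht)
    _ = ∫ t in Set.uIoc a b, F (pt i s t) := by
        rw [intervalIntegral.abs_integral_eq_abs_integral_uIoc]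
        exact abs_of_nonneg (integral_nonneg fun _ => h0 _)
    _ ≤ lineInt F i s :=
        setIntegral_le_integral (integrable_line hF hc i s) (ae_of_all _ fun t => h0 _)

section
variable {k : ℕ} {V : Evec k → ℝ} {ε : ℝ} {Ω : Set E2} {u : E2 → Evec k}

theorem pd_norm_sq (hΩ : IsOpen Ω) (hu : ContDiffOn ℝ (⊤ : ℕ∞) u Ω) {x : E2} (hx : x ∈ Ω)
    (i : Fin 2) : fderiv ℝ (fun y => ‖u y‖ ^ 2) x (b2 i) = 2 * ⟪u x, pder u i x⟫ := by
  rw [(differentiableAt_of_contDiffOn hΩ hu hx).hasFDerivAt.norm_sq.fderiv]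
  simp [pder]

theorem pd_inner_self_pder (hΩ : IsOpen Ω) (hu : ContDiffOn ℝ (⊤ : ℕ∞) u Ω) {x : E2} (hx : x ∈ Ω)
    (i : Fin 2) : fderiv ℝ (fun y => 2 * ⟪u y, pder u i y⟫) x (b2 i)
      = 2 * (⟪u x, fderiv ℝ (pder u i) x (b2 i)⟫ + ‖pder u i x‖ ^ 2) := by
  have h1 := differentiableAt_of_contDiffOn hΩ hu hx
  have h2 := differentiableAt_of_contDiffOn hΩ (contDiffOn_pder hΩ hu i) hx
  rw [fderiv_const_mul (h1.inner ℝ h2), smul_apply, fderiv_inner_apply ℝ h1 h2,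
    smul_eq_mul, ← real_inner_self_eq_norm_sq]
  rfl

theorem IsSolution.inner_gradient_nonpos_of_isLocalMax (hΩ : IsOpen Ω) (hε : 0 < ε)
    (hs : IsSolution V ε Ω u) {x : E2} (hx : x ∈ Ω) (hmax : IsLocalMax (fun y => ‖u y‖ ^ 2) x) :
    ⟪u x, gradient V (u x)⟫ ≤ 0 := by
  have hu := hs.1
  have hcd : ContDiffOn ℝ (⊤ : ℕ∞) (fun y => ‖u y‖ ^ 2) Ω := hu.norm_sq ℝ
  have key (i : Fin 2) : ⟪u x, fderiv ℝ (pder u i) x (b2 i)⟫ + ‖pder u i x‖ ^ 2 ≤ 0 := by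
    have heq : (fun y => fderiv ℝ (fun y => ‖u y‖ ^ 2) y (b2 i)) =ᶠ[𝓝 x]
        fun y => 2 * ⟪u y, pder u i y⟫ :=
      (hΩ.eventually_mem hx).mono fun y hy => pd_norm_sq hΩ hu hy i
    have h := fderiv_fderiv_nonpos_of_isLocalMax (v := b2 i)
      ((hΩ.eventually_mem hx).mono fun y hy => differentiableAt_of_contDiffOn hΩ hcd hy)
      (((hcd.fderiv_of_isOpen (m := (⊤ : ℕ∞)) hΩ (by simp)).clm_apply
        contDiffOn_const).contDiffAt (hΩ.mem_nhds hx) |>.differentiableAt (by simp)) hmax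
    rw [heq.fderiv_eq, pd_inner_self_pder hΩ hu hx] at h
    linarith
  have hsum : ⟪u x, lap u x⟫ ≤ 0 := by
    rw [lap, inner_sum]
    exact Finset.sum_nonpos fun i _ => by nlinarith [key i, sq_nonneg ‖pder u i x‖]
  rw [hs.2 x hx, inner_smul_right] at hsum
  exact nonpos_of_mul_nonpos_right hsum (by positivity)

theorem IsSolution.norm_le_of_frontier (hΩ : IsOpen Ω) (hε : 0 < ε)
    (hs : IsSolution V ε Ω u) {α R : ℝ} (hα : 0 < α) (hR : 0 ≤ R)
    (hgr : ∀ y : Evec k, R < ‖y‖ → α * ‖y‖ ^ 2 ≤ ⟪y, gradient V y⟫) {P : Set E2}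
    (hP : IsCompact P) (hPΩ : P ⊆ Ω) (hfr : ∀ x ∈ frontier P, ‖u x‖ ≤ R) {x : E2} (hx : x ∈ P) :
    ‖u x‖ ≤ R := by
  obtain ⟨z, hz, hmax⟩ := hP.exists_isMaxOn ⟨x, hx⟩
    (((hs.1.continuousOn.mono hPΩ).norm).pow 2 : ContinuousOn (fun y => ‖u y‖ ^ 2) P)
  by_contra! hcon
  have hxz : ‖u x‖ ≤ ‖u z‖ := le_of_sq_le_sq (hmax hx) (norm_nonneg _)
  have hzR : R < ‖u z‖ := hcon.trans_le hxz
  have hzi : z ∈ interior P := by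
    by_contra h
    exact absurd (hfr z ⟨subset_closure hz, h⟩) (not_le.2 hzR)
  have h1 := hs.inner_gradient_nonpos_of_isLocalMax hΩ hε (hPΩ hz)
    (hmax.isLocalMax (mem_interior_iff_mem_nhds.1 hzi))
  have h2 := hgr _ hzR
  have : 0 < ‖u z‖ := hR.trans_lt hzR
  have : 0 < α * ‖u z‖ ^ 2 := by positivity
  linarith

theorem mem_frontier_box {a b : Fin 2 → ℝ} {x : E2}
    (hx : x ∈ frontier {y : E2 | ∀ i, a i ≤ y i ∧ y i ≤ b i}) :
    (∀ i, a i ≤ x i ∧ x i ≤ b i) ∧ ∃ i, x i = a i ∨ x i = b i := by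
  have hcl : IsClosed {y : E2 | ∀ i, a i ≤ y i ∧ y i ≤ b i} := by
    simp only [Set.ofPred_forall, Set.ofPred_and]
    exact isClosed_iInter fun i => (isClosed_le continuous_const (by fun_prop)).inter
      (isClosed_le (by fun_prop) continuous_const)
  have hm : ∀ i, a i ≤ x i ∧ x i ≤ b i := hcl.frontier_subset hx
  refine ⟨hm, ?_⟩
  by_contra! hcon
  refine hx.2 (mem_interior.2 ⟨{y : E2 | ∀ i, a i < y i ∧ y i < b i},
    fun y hy i => ⟨(hy i).1.le, (hy i).2.le⟩, ?_,
    fun i => ⟨(hm i).1.lt_of_ne (hcon i).1.symm, (hm i).2.lt_of_ne (hcon i).2⟩⟩)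
  simp only [Set.ofPred_forall, Set.ofPred_and]
  exact isOpen_iInter_of_finite fun i => (isOpen_lt continuous_const (by fun_prop)).inter
    (isOpen_lt (by fun_prop) continuous_const)

/-- A solution whose energy on a square is at most linear in the side length is bounded on a
smaller square. -/
theorem IsMultiWell.exists_norm_bound (hV : IsMultiWell V) (G : ℝ) :
    ∃ R : ℝ, ∀ (ε : ℝ) (Ω : Set E2) (u : E2 → Evec k) (x₀ : E2) (r : ℝ) (F : E2 → ℝ),
      0 < ε → IsOpen Ω → IsSolution V ε Ω u → 0 < r → 4 * G * ε ≤ r → csq x₀ r ⊆ Ω →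
      Continuous F → HasCompactSupport F → (∀ x, 0 ≤ F x) →
      (∀ x ∈ csq x₀ r, eDens V ε u x ≤ F x) → ∫ x, F x ≤ G * r →
      ∀ x ∈ csq x₀ (7 * r / 8), ‖u x‖ ≤ R := by
  obtain ⟨H, hH, hproper⟩ := hV.exists_subEikonal_proper
  obtain ⟨R₁, hR₁⟩ := hV.coercive 2
  obtain ⟨C₁, hC₁⟩ := (isCompact_closedBall (0 : Evec k) R₁).exists_bound_of_continuousOn
    hH.1.continuous.continuousOn
  obtain ⟨R₂, hR₂⟩ := hproper (C₁ + 8 * G)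
  obtain ⟨α, hα, R₃, hR₃, hgr⟩ := hV.growth
  refine ⟨max R₂ R₃, fun ε Ω u x₀ r F hε hΩ hs hr hεr hsub hF hc h0 hle hint x hx => ?_⟩
  have line : ∀ (i : Fin 2) (α β : ℝ), β - α = r / 8 → x₀ i - r ≤ α → β ≤ x₀ i + r →
      ∃ s ∈ Set.Icc α β, ∀ t, |t - x₀ (1 - i)| ≤ r → ‖u (pt i s t)‖ ≤ R₂ := by
    intro i α β hαβ h1 h2
    obtain ⟨s, hsm, hsl⟩ := exists_lineInt_le hF hc h0 i (show α < β by linarith)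
    have hs1 : |s - x₀ i| ≤ r := abs_le.2 ⟨by linarith [hsm.1], by linarith [hsm.2]⟩
    have hG : lineInt F i s ≤ 8 * G := by
      rw [hαβ] at hsl
      have : r * lineInt F i s ≤ r * (8 * G) := by linarith
      exact le_of_mul_le_mul_left this hr
    have hmem : ∀ t, |t - x₀ (1 - i)| ≤ r → pt i s t ∈ csq x₀ r := fun t ht =>
      pt_mem_csq.2 ⟨hs1, ht⟩
    refine ⟨s, hsm, fun t ht => ?_⟩
    obtain ⟨t₀, ht₀, hl₀⟩ := exists_mul_le_lineInt hF hc h0 i s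
      (show x₀ (1 - i) - r < x₀ (1 - i) + r by linarith)
    have ht₀' : |t₀ - x₀ (1 - i)| ≤ r := abs_le.2 ⟨by linarith [ht₀.1], by linarith [ht₀.2]⟩
    have hV1 : V (u (pt i s t₀)) < 2 := by
      have h3 := (potential_le_eDens V hε u (pt i s t₀)).trans (hle _ (hmem t₀ ht₀'))
      have h4 : 2 * r * (ε⁻¹ * V (u (pt i s t₀))) ≤ 8 * G := by
        have := mul_le_mul_of_nonneg_left h3 (show 0 ≤ 2 * r by positivity)
        linarith
      have h5 : 2 * r * V (u (pt i s t₀)) ≤ 2 * r * 1 := by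
        have h6 : 2 * r * V (u (pt i s t₀)) = ε * (2 * r * (ε⁻¹ * V (u (pt i s t₀)))) := by
          field_simp
        have := mul_le_mul_of_nonneg_left h4 hε.le
        rw [h6]; linarith
      linarith [le_of_mul_le_mul_left h5 (by positivity)]
    have hH0 : H (u (pt i s t₀)) ≤ C₁ := by
      refine (le_abs_self _).trans (hC₁ _ ?_)
      rw [mem_closedBall_zero_iff]
      by_contra! h
      linarith [hR₁ _ h.le]
    have hseg : ∀ t' ∈ Set.uIcc t₀ t, pt i s t' ∈ csq x₀ r := by
      intro t' ht'
      refine hmem t' (abs_le.2 ?_)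
      have := abs_le.1 ht₀'
      have := abs_le.1 ht
      rcases Set.mem_uIcc.1 ht' with h | h <;> constructor <;> linarith [h.1, h.2]
    have hosc := hH.abs_sub_le_lineInt hV.nonneg hε hΩ hs.1 (fun t' ht' => hsub (hseg t' ht'))
      hF hc h0 (fun t' ht' => hle _ (hseg t' ht'))
    exact hR₂ _ (by linarith [le_abs_self (H (u (pt i s t)) - H (u (pt i s t₀)))])
  choose a ha hau using fun i : Fin 2 =>
    line i (x₀ i - r) (x₀ i - 7 * r / 8) (by ring) le_rfl (by linarith)
  choose b hb hbu using fun i : Fin 2 =>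
    line i (x₀ i + 7 * r / 8) (x₀ i + r) (by ring) (by linarith) le_rfl
  set P : Set E2 := {y : E2 | ∀ i, a i ≤ y i ∧ y i ≤ b i} with hPdef
  have hPsq : P ⊆ csq x₀ r := fun y hy i =>
    abs_le.2 ⟨by linarith [(hy i).1, (ha i).1], by linarith [(hy i).2, (hb i).2]⟩
  have hPcl : IsClosed P := by
    simp only [hPdef, Set.ofPred_forall, Set.ofPred_and]
    exact isClosed_iInter fun i => (isClosed_le continuous_const (by fun_prop)).inter
      (isClosed_le (by fun_prop) continuous_const)
  refine hs.norm_le_of_frontier hΩ hε hα (hR₃.le.trans (le_max_right _ _))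
    (fun y hy => hgr y ((le_max_right _ _).trans_lt hy))
    ((isCompact_csq x₀ r).of_isClosed_subset hPcl hPsq) (hPsq.trans hsub) (fun y hy => ?_)
    (P := P) (fun i => ?_)
  · obtain ⟨hy1, i, hi⟩ := mem_frontier_box hy
    refine le_trans ?_ (le_max_left _ _)
    rw [← pt_coord i y]
    rcases hi with hi | hi <;> rw [hi]
    · exact hau i _ (hPsq hy1 _)
    · exact hbu i _ (hPsq hy1 _)
  · have := abs_le.1 (hx i)
    exact ⟨by linarith [(ha i).2, this.1], by linarith [(hb i).1, this.2]⟩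

end

/-- The Laplacian of a scalar function on the plane. -/
def slap (f : E2 → ℝ) (x : E2) : ℝ := ∑ i, pd (pd f i) i x

/-- The reflection across the line on which the `j`-th coordinate equals that of `z`. -/
def reflect (z : E2) (j : Fin 2) (y : E2) : E2 := y - (2 * (y j - z j)) • b2 j

section
variable {Ω : Set E2} {f g : E2 → ℝ}

theorem contDiffOn_pd (hΩ : IsOpen Ω) (hf : ContDiffOn ℝ (⊤ : ℕ∞) f Ω) (i : Fin 2) :
    ContDiffOn ℝ (⊤ : ℕ∞) (pd f i) Ω :=
  (hf.fderiv_of_isOpen hΩ (by simp)).clm_apply contDiffOn_const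

theorem slap_nonpos_of_isLocalMax (hΩ : IsOpen Ω) (hf : ContDiffOn ℝ (⊤ : ℕ∞) f Ω) {x : E2}
    (hx : x ∈ Ω) (hmax : IsLocalMax f x) : slap f x ≤ 0 :=
  Finset.sum_nonpos fun i _ => fderiv_fderiv_nonpos_of_isLocalMax (v := b2 i)
    ((hΩ.eventually_mem hx).mono fun _ hy => differentiableAt_of_contDiffOn hΩ hf hy)
    (differentiableAt_of_contDiffOn hΩ (contDiffOn_pd hΩ hf i) hx) hmax

theorem pd_add (hΩ : IsOpen Ω) (hf : ContDiffOn ℝ (⊤ : ℕ∞) f Ω)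
    (hg : ContDiffOn ℝ (⊤ : ℕ∞) g Ω) {x : E2} (hx : x ∈ Ω) (i : Fin 2) :
    pd (fun y => f y + g y) i x = pd f i x + pd g i x := by
  unfold pd
  rw [fderiv_fun_add (differentiableAt_of_contDiffOn hΩ hf hx)
    (differentiableAt_of_contDiffOn hΩ hg hx), add_apply]

theorem pd_const_mul (hΩ : IsOpen Ω) (hf : ContDiffOn ℝ (⊤ : ℕ∞) f Ω) (c : ℝ) {x : E2}
    (hx : x ∈ Ω) (i : Fin 2) : pd (fun y => c * f y) i x = c * pd f i x := by
  unfold pd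
  rw [fderiv_const_mul (differentiableAt_of_contDiffOn hΩ hf hx), smul_apply, smul_eq_mul]

theorem pd_congr (hΩ : IsOpen Ω) (h : ∀ y ∈ Ω, f y = g y) {x : E2} (hx : x ∈ Ω) (i : Fin 2) :
    pd f i x = pd g i x := by
  have he : f =ᶠ[𝓝 x] g := (hΩ.eventually_mem hx).mono h
  unfold pd
  rw [he.fderiv_eq]

theorem slap_add (hΩ : IsOpen Ω) (hf : ContDiffOn ℝ (⊤ : ℕ∞) f Ω)
    (hg : ContDiffOn ℝ (⊤ : ℕ∞) g Ω) {x : E2} (hx : x ∈ Ω) :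
    slap (fun y => f y + g y) x = slap f x + slap g x := by
  unfold slap
  rw [← Finset.sum_add_distrib]
  refine Finset.sum_congr rfl fun i _ => ?_
  rw [pd_congr hΩ (fun y hy => pd_add hΩ hf hg hy i) hx,
    pd_add hΩ (contDiffOn_pd hΩ hf i) (contDiffOn_pd hΩ hg i) hx]

theorem slap_const_mul (hΩ : IsOpen Ω) (hf : ContDiffOn ℝ (⊤ : ℕ∞) f Ω) (c : ℝ) {x : E2}
    (hx : x ∈ Ω) : slap (fun y => c * f y) x = c * slap f x := by
  unfold slap
  rw [Finset.mul_sum]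
  refine Finset.sum_congr rfl fun i _ => ?_
  rw [pd_congr hΩ (fun y hy => pd_const_mul hΩ hf c hy i) hx,
    pd_const_mul hΩ (contDiffOn_pd hΩ hf i) c hx]

theorem contDiff_reflect (z : E2) (j : Fin 2) : ContDiff ℝ (⊤ : ℕ∞) (reflect z j) := by
  unfold reflect; fun_prop

theorem reflect_apply_self (z : E2) (j : Fin 2) (y : E2) : reflect z j y j = 2 * z j - y j := by
  simp [reflect, b2]; ring

theorem reflect_apply_other (z : E2) (j : Fin 2) (y : E2) :
    reflect z j y (1 - j) = y (1 - j) := by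
  fin_cases j <;> simp [reflect, b2]

theorem reflect_mem_csq {z : E2} {j : Fin 2} {y : E2} {d : ℝ} (hy : y ∈ csq z d) :
    reflect z j y ∈ csq z d := by
  simp only [csq, Set.mem_ofPred_eq] at *
  rw [forall_fin_two_iff j] at *
  rw [reflect_apply_self, reflect_apply_other]
  refine ⟨?_, hy.2⟩
  rw [show 2 * z j - y j - z j = -(y j - z j) by ring, abs_neg]
  exact hy.1

theorem fderiv_reflect (z : E2) (j i : Fin 2) (y : E2) :
    fderiv ℝ (reflect z j) y (b2 i) = (if i = j then -1 else 1 : ℝ) • b2 i := by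
  have h1 : HasFDerivAt (fun y : E2 => y j)
      (EuclideanSpace.proj j : E2 →L[ℝ] ℝ) y := (EuclideanSpace.proj j : E2 →L[ℝ] ℝ).hasFDerivAt
  have h2 : HasFDerivAt (reflect z j) _ y :=
    (hasFDerivAt_id y).fun_sub (((h1.sub_const (z j)).const_mul 2).smul_const (b2 j))
  rw [h2.fderiv]
  by_cases h : i = j
  · subst h
    simp [b2]
    module
  · simp [b2, h, Ne.symm h]

theorem pd_reflect (hΩ : IsOpen Ω) (hf : ContDiffOn ℝ (⊤ : ℕ∞) f Ω) {z : E2} {j : Fin 2} {x : E2}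
    (hx : reflect z j x ∈ Ω) (i : Fin 2) : pd (fun y => f (reflect z j y)) i x
      = (if i = j then -1 else 1) * pd f i (reflect z j x) := by
  have := ((differentiableAt_of_contDiffOn hΩ hf hx).hasFDerivAt.comp x
    ((contDiff_reflect z j).differentiable (by simp) x).hasFDerivAt).fderiv
  unfold pd
  rw [show (fun y => f (reflect z j y)) = f ∘ reflect z j from rfl, this,
    ContinuousLinearMap.comp_apply, fderiv_reflect, map_smul, smul_eq_mul]

theorem slap_reflect (hΩ : IsOpen Ω) (hf : ContDiffOn ℝ (⊤ : ℕ∞) f Ω) {z : E2} {j : Fin 2} {x : E2}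
    (hx : reflect z j x ∈ Ω) : slap (fun y => f (reflect z j y)) x = slap f (reflect z j x) := by
  have hΩ' : IsOpen (reflect z j ⁻¹' Ω) := hΩ.preimage (contDiff_reflect z j).continuous
  refine Finset.sum_congr rfl fun i _ => ?_
  have hp := contDiffOn_pd hΩ hf i
  rw [pd_congr hΩ' (fun y hy => pd_reflect hΩ hf hy i) (show x ∈ reflect z j ⁻¹' Ω from hx),
    pd_const_mul (f := fun y => pd f i (reflect z j y)) hΩ'
      (hp.comp (contDiff_reflect z j).contDiffOn fun _ h => h) _ hx,
    pd_reflect hΩ hp hx, ← mul_assoc]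
  split_ifs <;> simp

theorem pd_coord {g : ℝ → ℝ} (hg : Differentiable ℝ g) (l i : Fin 2) (x : E2) :
    pd (fun y => g (y l)) i x = deriv g (x l) * b2 i l := by
  have h1 : HasFDerivAt (fun y : E2 => y l)
      (EuclideanSpace.proj l : E2 →L[ℝ] ℝ) x := (EuclideanSpace.proj l : E2 →L[ℝ] ℝ).hasFDerivAt
  have h2 := ((hg (x l)).hasDerivAt.comp_hasFDerivAt x h1).fderiv
  unfold pd
  rw [show (fun y : E2 => g (y l)) = g ∘ fun y : E2 => y l from rfl, h2]
  simp

theorem slap_coord {g : ℝ → ℝ} (hg : ContDiff ℝ (⊤ : ℕ∞) g) (l : Fin 2) (x : E2) :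
    slap (fun y => g (y l)) x = deriv (deriv g) (x l) := by
  have hg1 : Differentiable ℝ g := hg.differentiable (by simp)
  have hg2 : Differentiable ℝ (deriv g) :=
    (hg.iterate_deriv 1).differentiable (by simp)
  have (i : Fin 2) : pd (pd (fun y => g (y l)) i) i x
      = deriv (deriv g) (x l) * (b2 i l * b2 i l) := by
    rw [show pd (fun y => g (y l)) i = fun y => (fun s => deriv g s * b2 i l) (y l) from
      funext fun y => pd_coord hg1 l i y, pd_coord (hg2.mul_const _), deriv_mul_const (hg2 _),
      mul_assoc]
  unfold slap
  simp only [this, Fin.sum_univ_two]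
  fin_cases l <;> simp [b2]

theorem hasDerivAt_quadratic (a b c e s : ℝ) :
    HasDerivAt (fun s => a * (s - e) ^ 2 + b * (s - e) + c) (2 * a * (s - e) + b) s := by
  refine ((((((hasDerivAt_id s).sub_const e).pow 2).const_mul a).add
    (((hasDerivAt_id s).sub_const e).const_mul b)).add_const c).congr_deriv ?_
  simp; ring

theorem deriv_deriv_quadratic (a b c e s : ℝ) :
    deriv (deriv fun s => a * (s - e) ^ 2 + b * (s - e) + c) s = 2 * a := by
  have h2 := (((hasDerivAt_id' s).sub_const e).const_mul (2 * a)).add_const b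
  rw [funext fun s => (hasDerivAt_quadratic a b c e s).deriv, h2.deriv, mul_one]

theorem slap_quadratic (a b c e : ℝ) (l : Fin 2) (x : E2) :
    slap (fun y => a * (y l - e) ^ 2 + b * (y l - e) + c) x = 2 * a := by
  rw [slap_coord (g := fun s => a * (s - e) ^ 2 + b * (s - e) + c) (by fun_prop),
    deriv_deriv_quadratic]

/-- An interior gradient bound for the Poisson equation. -/
theorem pd_le_of_abs_slap_lt (hΩ : IsOpen Ω) (hf : ContDiffOn ℝ (⊤ : ℕ∞) f Ω) {z : E2} {d M N : ℝ}
    (hd : 0 < d) (hsub : csq z d ⊆ Ω) (hM : ∀ x ∈ csq z d, |f x| ≤ M)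
    (hN : ∀ x ∈ csq z d, |slap f x| < N) (j : Fin 2) : pd f j z ≤ 2 * M / d + N * d / 2 := by
  have hz : z ∈ csq z d := fun i => by simp [hd.le]
  have hM0 : 0 ≤ M := (abs_nonneg _).trans (hM z hz)
  have hN0 : 0 < N := (abs_nonneg _).trans_lt (hN z hz)
  set Ω' : Set E2 := Ω ∩ reflect z j ⁻¹' Ω
  have hΩ' : IsOpen Ω' := hΩ.inter (hΩ.preimage (contDiff_reflect z j).continuous)
  have hsub' : csq z d ⊆ Ω' := fun x hx => ⟨hsub hx, hsub (reflect_mem_csq hx)⟩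
  set fr : E2 → ℝ := fun y => f (reflect z j y) with hfr
  set B₁ : E2 → ℝ := fun y => -(M / d ^ 2) * (y (1 - j) - z (1 - j)) ^ 2
    + 0 * (y (1 - j) - z (1 - j)) + 0 with hB₁
  set B₂ : E2 → ℝ := fun y => (M / d ^ 2 + N / 2) * (y j - z j) ^ 2
    + -(2 * M / d + N * d / 2) * (y j - z j) + 0 with hB₂
  have cf : ContDiffOn ℝ (⊤ : ℕ∞) f Ω' := hf.mono Set.inter_subset_left
  have cfr : ContDiffOn ℝ (⊤ : ℕ∞) fr Ω' :=
    hf.comp (contDiff_reflect z j).contDiffOn Set.inter_subset_right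
  have cB₁ : ContDiffOn ℝ (⊤ : ℕ∞) B₁ Ω' := by
    refine ContDiff.contDiffOn ?_
    rw [hB₁]; fun_prop
  have cB₂ : ContDiffOn ℝ (⊤ : ℕ∞) B₂ Ω' := by
    refine ContDiff.contDiffOn ?_
    rw [hB₂]; fun_prop
  have cφ := (contDiffOn_const.mul cf : ContDiffOn ℝ (⊤ : ℕ∞) (fun y => 1 / 2 * f y) Ω')
  have cφr := (contDiffOn_const.mul cfr : ContDiffOn ℝ (⊤ : ℕ∞) (fun y => -(1 / 2) * fr y) Ω')
  set W : E2 → ℝ := fun y => (1 / 2 * f y + -(1 / 2) * fr y) + (B₁ y + B₂ y) with hW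
  have cW : ContDiffOn ℝ (⊤ : ℕ∞) W Ω' := (cφ.add cφr).add (cB₁.add cB₂)
  have lW : ∀ x ∈ csq z d, 0 < slap W x := by
    intro x hx
    have hx' := hsub' hx
    rw [hW, slap_add hΩ' (cφ.add cφr) (cB₁.add cB₂) hx', slap_add hΩ' cφ cφr hx',
      slap_add hΩ' cB₁ cB₂ hx', slap_const_mul hΩ' cf _ hx', slap_const_mul hΩ' cfr _ hx',
      hfr, slap_reflect hΩ hf hx'.2, hB₁, slap_quadratic, hB₂, slap_quadratic]
    have h1 := (abs_lt.1 (hN x hx)).1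
    have h2 := (abs_lt.1 (hN _ (reflect_mem_csq (j := j) hx))).2
    linarith
  set P : Set E2 := csq z d ∩ {y | z j ≤ y j} with hP
  have hPc : IsCompact P :=
    (isCompact_csq z d).inter_right (isClosed_le continuous_const (by fun_prop))
  have hzP : z ∈ P := ⟨hz, le_refl (z j)⟩
  obtain ⟨p, hp, hmax⟩ := hPc.exists_isMaxOn ⟨z, hzP⟩
    (cW.continuousOn.mono (Set.inter_subset_left.trans hsub'))
  have hWp : W p ≤ 0 := by
    have hpj := hp.1 j
    have hpo := hp.1 (1 - j)
    have hY : 0 ≤ p j - z j := sub_nonneg.2 hp.2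
    have hYd : p j - z j ≤ d := (le_abs_self _).trans hpj
    have hφ : 1 / 2 * f p + -(1 / 2) * fr p ≤ M := by
      have h1 := (abs_le.1 (hM p hp.1)).2
      have h2 := (abs_le.1 (hM _ (reflect_mem_csq (j := j) hp.1))).1
      simp only [hfr]; linarith
    have hB : B₁ p + B₂ p = -(M / d ^ 2) * ((p (1 - j) - z (1 - j)) ^ 2
        + (p j - z j) * (2 * d - (p j - z j)))
        - N / 2 * ((p j - z j) * (d - (p j - z j))) := by
      simp only [hB₁, hB₂]; field_simp; ring
    have hNY : 0 ≤ N / 2 * ((p j - z j) * (d - (p j - z j))) :=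
      mul_nonneg (by positivity) (mul_nonneg hY (by linarith))
    have hedge : ∀ q : ℝ, d ^ 2 ≤ q → M ≤ M / d ^ 2 * q := fun q hq => by
      rw [div_mul_eq_mul_div, le_div_iff₀ (by positivity)]
      exact mul_le_mul_of_nonneg_left hq hM0
    have hYq : 0 ≤ (p j - z j) * (2 * d - (p j - z j)) := mul_nonneg hY (by linarith)
    by_cases h0 : p j = z j
    · have hrp : reflect z j p = p := by simp [reflect, h0]
      have : 0 ≤ M / d ^ 2 * (p (1 - j) - z (1 - j)) ^ 2 := by positivity
      simp only [hW, hB, hfr, hrp, h0]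
      linarith
    by_cases h1 : p j - z j = d
    · have := hedge ((p (1 - j) - z (1 - j)) ^ 2 + (p j - z j) * (2 * d - (p j - z j)))
        (by rw [h1]; nlinarith [sq_nonneg (p (1 - j) - z (1 - j))])
      simp only [hW, hB]; linarith
    by_cases h2 : |p (1 - j) - z (1 - j)| = d
    · have := hedge ((p (1 - j) - z (1 - j)) ^ 2 + (p j - z j) * (2 * d - (p j - z j)))
        (by
          have h3 := sq_abs (p (1 - j) - z (1 - j))
          rw [h2] at h3
          linarith)
      simp only [hW, hB]; linarith
    exfalso
    have hYpos : z j < p j := lt_of_le_of_ne hp.2 (Ne.symm h0)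
    have hosq : p ∈ osq z d := by
      simp only [osq, Set.mem_ofPred_eq]
      rw [forall_fin_two_iff j]
      refine ⟨?_, hpo.lt_of_ne h2⟩
      rw [abs_of_nonneg hY]
      exact hYd.lt_of_ne h1
    have hnhds : P ∈ 𝓝 p := by
      filter_upwards [(isOpen_osq z d).mem_nhds hosq,
        (isOpen_lt continuous_const (by fun_prop : Continuous fun y : E2 => y j)).mem_nhds hYpos]
        with y hy1 hy2 using ⟨osq_subset_csq _ _ hy1, le_of_lt hy2⟩
    exact absurd (slap_nonpos_of_isLocalMax hΩ' cW (hsub' hp.1) (hmax.isLocalMax hnhds))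
      (not_le.2 (lW p hp.1))
  have hWz : W z = 0 := by simp [hW, hB₁, hB₂, hfr, reflect]
  have hline : HasDerivAt (fun t : ℝ => z + t • b2 j) (b2 j) 0 := by
    simpa using ((hasDerivAt_id (0 : ℝ)).smul_const (b2 j)).const_add z
  have hdW : HasDerivAt (fun t : ℝ => W (z + t • b2 j)) (pd W j z) 0 := by
    have h := (differentiableAt_of_contDiffOn hΩ' cW (hsub' hz)).hasFDerivAt
    have h' : HasFDerivAt W (fderiv ℝ W z) (z + (0 : ℝ) • b2 j) := by simpa using h
    exact h'.comp_hasDerivAt 0 hline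
  have hle : pd W j z ≤ 0 := by
    refine le_of_tendsto (hdW.tendsto_slope_zero_right) ?_
    filter_upwards [Ioc_mem_nhdsGT hd] with t ht
    have hmem : z + t • b2 j ∈ P := by
      refine ⟨?_, ?_⟩
      · simp only [csq, Set.mem_ofPred_eq]
        rw [forall_fin_two_iff j]
        constructor
        · simpa [b2, abs_of_pos ht.1] using ht.2
        · fin_cases j <;> simp [b2, hd.le]
      · simp [b2, ht.1.le]
    have := hmax hmem
    simp only [Set.mem_ofPred_eq] at this
    simp only [zero_add, zero_smul, add_zero, hWz, sub_zero, smul_eq_mul]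
    exact mul_nonpos_of_nonneg_of_nonpos (by have := ht.1; positivity) (this.trans hWp)
  have hz' := hsub' hz
  rw [hW, pd_add hΩ' (cφ.add cφr) (cB₁.add cB₂) hz', pd_add hΩ' cφ cφr hz',
    pd_add hΩ' cB₁ cB₂ hz', pd_const_mul hΩ' cf _ hz', pd_const_mul hΩ' cfr _ hz', hfr,
    pd_reflect hΩ hf hz'.2] at hle
  have hrz : reflect z j z = z := by simp [reflect]
  have hb1 : pd B₁ j z = 0 := by
    rw [hB₁, pd_coord (g := fun s => -(M / d ^ 2) * (s - z (1 - j)) ^ 2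
      + 0 * (s - z (1 - j)) + 0) (by fun_prop)]
    fin_cases j <;> simp [b2]
  have hb2 : pd B₂ j z = -(2 * M / d + N * d / 2) := by
    rw [hB₂, pd_coord (g := fun s => (M / d ^ 2 + N / 2) * (s - z j) ^ 2
      + -(2 * M / d + N * d / 2) * (s - z j) + 0) (by fun_prop)]
    rw [(hasDerivAt_quadratic _ _ _ _ _).deriv]
    simp [b2]
  rw [hb1, hb2, hrz, if_pos rfl] at hle
  linarith

end

section
variable {k : ℕ} {V : Evec k → ℝ} {ε : ℝ} {Ω : Set E2} {u : E2 → Evec k}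

theorem pd_inner_const (hΩ : IsOpen Ω) (hu : ContDiffOn ℝ (⊤ : ℕ∞) u Ω) (w : Evec k) {x : E2}
    (hx : x ∈ Ω) (i : Fin 2) : pd (fun y => ⟪u y, w⟫) i x = ⟪pder u i x, w⟫ := by
  unfold pd
  rw [fderiv_inner_apply ℝ (differentiableAt_of_contDiffOn hΩ hu hx) (differentiableAt_const w)]
  simp [pder]

theorem slap_inner_const (hΩ : IsOpen Ω) (hu : ContDiffOn ℝ (⊤ : ℕ∞) u Ω) (w : Evec k) {x : E2}
    (hx : x ∈ Ω) : slap (fun y => ⟪u y, w⟫) x = ⟪lap u x, w⟫ := by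
  unfold slap lap
  rw [sum_inner]
  refine Finset.sum_congr rfl fun i _ => ?_
  rw [pd_congr hΩ (fun y hy => pd_inner_const hΩ hu w hy i) hx,
    pd_inner_const hΩ (contDiffOn_pder hΩ hu i) w hx]
  rfl

theorem continuous_gradient (hV : ContDiff ℝ (⊤ : ℕ∞) V) : Continuous (gradient V) :=
  (InnerProductSpace.toDual ℝ (Evec k)).symm.continuous.comp (hV.continuous_fderiv (by simp))

theorem exists_pder_bound (hV : ContDiff ℝ (⊤ : ℕ∞) V) (R : ℝ) :
    ∃ C : ℝ, ∀ (ε : ℝ) (Ω : Set E2) (u : E2 → Evec k) (z : E2), 0 < ε → IsOpen Ω →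
      IsSolution V ε Ω u → csq z ε ⊆ Ω → (∀ x ∈ csq z ε, ‖u x‖ ≤ R) →
      ∀ j, ε * ‖pder u j z‖ ≤ C := by
  obtain ⟨C₁, hC₁⟩ := (isCompact_closedBall (0 : Evec k) R).exists_bound_of_continuousOn
    (continuous_gradient hV).continuousOn
  refine ⟨2 * R + (C₁ + 1) / 2, fun ε Ω u z hε hΩ hs hsub hb j => ?_⟩
  have hz : z ∈ csq z ε := fun i => by simp [hε.le]
  have hC₁0 : 0 ≤ C₁ := (norm_nonneg _).trans (hC₁ (u z) (by simpa using hb z hz))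
  set w := pder u j z with hw
  rcases eq_or_ne w 0 with h0 | h0
  · have : 0 ≤ R := (norm_nonneg _).trans (hb z hz)
    rw [h0, norm_zero, mul_zero]; positivity
  have hwpos : 0 < ‖w‖ := norm_pos_iff.2 h0
  have h := pd_le_of_abs_slap_lt (f := fun y => ⟪u y, w⟫) (z := z) (d := ε) (M := R * ‖w‖)
    (N := (C₁ + 1) * ‖w‖ / ε ^ 2) hΩ (hs.1.inner ℝ contDiffOn_const) hε hsub
    (fun x hx => (abs_real_inner_le_norm _ _).trans
      (mul_le_mul_of_nonneg_right (hb x hx) hwpos.le))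
    (fun x hx => ?_) j
  · rw [pd_inner_const hΩ hs.1 w (hsub hz), ← hw, real_inner_self_eq_norm_sq] at h
    have h2 : ‖w‖ * (ε * ‖w‖) ≤ ‖w‖ * (2 * R + (C₁ + 1) / 2) := by
      have h3 := mul_le_mul_of_nonneg_left h hε.le
      calc ‖w‖ * (ε * ‖w‖) = ε * ‖w‖ ^ 2 := by ring
        _ ≤ _ := h3
        _ = _ := by field_simp
    exact le_of_mul_le_mul_left h2 hwpos
  · rw [slap_inner_const hΩ hs.1 w (hsub hx), hs.2 x (hsub hx), real_inner_smul_left, abs_mul,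
      abs_of_pos (by positivity), lt_div_iff₀ (by positivity)]
    have h4 : |⟪gradient V (u x), w⟫| ≤ C₁ * ‖w‖ := (abs_real_inner_le_norm _ _).trans
      (mul_le_mul_of_nonneg_right (hC₁ _ (by simpa using hb x hx)) hwpos.le)
    rw [mul_comm (ε ^ 2)⁻¹, mul_assoc, inv_mul_cancel₀ (by positivity), mul_one]
    linarith

/-- A solution on a square whose energy density is dominated by `F`, with `∫ F ≤ G r`, at a scale
large compared with `ε`. -/
structure SquareData (V : Evec k → ℝ) (G ε : ℝ) (Ω : Set E2) (u : E2 → Evec k) (x₀ : E2) (r : ℝ)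
    (F : E2 → ℝ) : Prop where
  eps_pos : 0 < ε
  isOpen : IsOpen Ω
  sol : IsSolution V ε Ω u
  r_pos : 0 < r
  eps_le : 4 * G * ε ≤ r
  eps_le' : 8 * ε ≤ r
  subset : csq x₀ r ⊆ Ω
  cont : Continuous F
  compact : HasCompactSupport F
  nonneg : ∀ x, 0 ≤ F x
  le : ∀ x ∈ csq x₀ r, eDens V ε u x ≤ F x
  integral_le : ∫ x, F x ≤ G * r

theorem IsMultiWell.exists_gradSq_bound (hV : IsMultiWell V) (G : ℝ) :
    ∃ C ≥ (0 : ℝ), ∀ (ε : ℝ) (Ω : Set E2) (u : E2 → Evec k) (x₀ : E2) (r : ℝ) (F : E2 → ℝ),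
      SquareData V G ε Ω u x₀ r F → ∀ z ∈ csq x₀ (3 * r / 4), ε * gradSq u z ≤ C * ε⁻¹ := by
  obtain ⟨R, hR⟩ := hV.exists_norm_bound G
  obtain ⟨C, hC⟩ := exists_pder_bound hV.smooth R
  refine ⟨2 * C ^ 2, by positivity, fun ε Ω u x₀ r F h z hz => ?_⟩
  have hε := h.eps_pos
  have hsub : csq z ε ⊆ csq x₀ (7 * r / 8) :=
    csq_subset_csq fun i => by linarith [hz i, h.eps_le']
  have hb := hC ε Ω u z hε h.isOpen h.sol
    ((hsub.trans (csq_mono (by linarith [h.r_pos]))).trans h.subset)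
    fun x hx => hR ε Ω u x₀ r F hε h.isOpen h.sol h.r_pos h.eps_le h.subset h.cont h.compact
      h.nonneg h.le h.integral_le x (hsub hx)
  have hsq (j : Fin 2) : (ε * ‖pder u j z‖) ^ 2 ≤ C ^ 2 :=
    pow_le_pow_left₀ (by positivity) (hb j) 2
  have : ε ^ 2 * gradSq u z ≤ 2 * C ^ 2 := by
    rw [gradSq, Fin.sum_univ_two]; linarith [hsq 0, hsq 1]
  rw [← div_eq_mul_inv, le_div_iff₀ hε]
  linarith

set_option maxHeartbeats 400000 in
/-- After localization the energy density is controlled by the potential, up to an error of order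
`√ε`. -/
theorem IsMultiWell.exists_energy_le_potential (hV : IsMultiWell V) (G : ℝ) :
    ∃ K > (0 : ℝ), ∃ A ≥ (0 : ℝ),
      ∀ (ε : ℝ) (Ω : Set E2) (u : E2 → Evec k) (x₀ : E2) (r : ℝ) (F χ : E2 → ℝ),
      SquareData V G ε Ω u x₀ r F → C1Test (osq x₀ (3 * r / 4)) χ → (∀ x, 0 ≤ χ x) →
      ∫ x, χ x * eDens V ε u x ≤ K * (∫ x, χ x * (ε⁻¹ * V (u x)))
        + √ε * A * ∑ j, ∫ x, |pd χ j x| * (1 + eDens V ε u x) := by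
  classical
  obtain ⟨C, hC0, hC⟩ := hV.exists_gradSq_bound G
  obtain ⟨b, hb, hconv, hsep⟩ := hV.exists_well_radius
  obtain ⟨δ, ψ, hψ⟩ := exists_isCutoff hb one_pos
  obtain ⟨m, hm, hmV⟩ := hV.exists_pos_le_of_away (Real.sqrt_pos.2 hψ.pos)
  set Z := hV.finite_zeros.toFinset with hZ
  have hZ' : ∀ σ ∈ Z, V σ = 0 := fun σ hσ => by simpa [hZ] using hσ
  refine ⟨Z.card * C / m + C / (2 * m) + 1, by positivity, Z.card * b, by positivity,
    fun ε Ω u x₀ r F χ h hχ hχ0 => ?_⟩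
  set K := Z.card * C / m + C / (2 * m) + 1 with hK
  have hε := h.eps_pos
  have hΩ := h.isOpen
  have hu := h.sol.1
  have hχΩ : C1Test Ω χ := hχ.mono
    (((osq_subset_csq _ _).trans (csq_mono (by linarith [h.r_pos]))).trans h.subset)
  have hec : ContinuousOn (eDens V ε u) Ω := (contDiffOn_eDens hΩ hV.smooth hu).continuousOn
  have hgc : ContinuousOn (gradSq u) Ω := (contDiffOn_gradSq hΩ hu).continuousOn
  have hvc : ContinuousOn (fun x => V (u x)) Ω := (contDiffOn_potential hV.smooth hu).continuousOn
  have hqc (σ : Evec k) : ContinuousOn (fun x => ‖u x - σ‖ ^ 2) Ω :=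
    (hu.continuousOn.sub continuousOn_const).norm.pow 2
  have hψc (σ : Evec k) : ContinuousOn (fun x => ψ (‖u x - σ‖ ^ 2)) Ω :=
    hψ.contDiff.continuous.comp_continuousOn (hqc σ)
  have hdc (σ : Evec k) : ContinuousOn (fun x => |deriv ψ (‖u x - σ‖ ^ 2)|) Ω :=
    ((hψ.contDiff.continuous_deriv (by simp)).comp_continuousOn (hqc σ)).abs
  set a : Evec k → E2 → ℝ := fun σ x => ψ (‖u x - σ‖ ^ 2) * eDens V ε u x
  set d : Evec k → E2 → ℝ := fun σ x =>
    2 * ‖u x - σ‖ ^ 2 * |deriv ψ (‖u x - σ‖ ^ 2)| * (ε * gradSq u x)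
  have hac (σ : Evec k) : ContinuousOn (a σ) Ω := (hψc σ).mul hec
  have hdc' (σ : Evec k) : ContinuousOn (d σ) Ω :=
    (((continuousOn_const.mul (hqc σ)).mul (hdc σ)).mul (continuousOn_const.mul hgc))
  have ia (σ : Evec k) : Integrable (fun x => χ x * a σ x) :=
    hχΩ.test.integrable_mul hΩ (hac σ) _
  have id' (σ : Evec k) : Integrable (fun x => χ x * d σ x) :=
    hχΩ.test.integrable_mul hΩ (hdc' σ) _
  have ie : Integrable (fun x => χ x * eDens V ε u x) := hχΩ.test.integrable_mul hΩ hec _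
  have iv : Integrable (fun x => χ x * (ε⁻¹ * V (u x))) :=
    hχΩ.test.integrable_mul hΩ (g := fun x => ε⁻¹ * V (u x)) (continuousOn_const.mul hvc) _
  have hpoint : ∀ x, χ x * eDens V ε u x
      ≤ (∑ σ ∈ Z, χ x * a σ x) + (K * (χ x * (ε⁻¹ * V (u x))) - ∑ σ ∈ Z, χ x * d σ x) := by
    intro x
    by_cases hx : x ∈ tsupport χ
    swap
    · simp [image_eq_zero_of_notMem_tsupport hx]
    have hxs := osq_subset_csq _ _ (hχ.2.2 hx)
    have hgr := hC ε Ω u x₀ r F h x hxs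
    have hV0 : 0 ≤ ε⁻¹ * V (u x) := mul_nonneg (by positivity) (hV.nonneg _)
    have hgn : 0 ≤ ε * gradSq u x := mul_nonneg hε.le (gradSq_nonneg u x)
    have hed : eDens V ε u x = ε * gradSq u x / 2 + ε⁻¹ * V (u x) := by unfold eDens; ring
    have he0 := eDens_nonneg hV.nonneg hε u x
    suffices hs : eDens V ε u x + (∑ σ ∈ Z, d σ x) ≤ (∑ σ ∈ Z, a σ x) + K * (ε⁻¹ * V (u x)) by
      rw [← Finset.mul_sum, ← Finset.mul_sum]
      have := mul_le_mul_of_nonneg_left hs (hχ0 x)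
      linarith
    have ha0 : 0 ≤ ∑ σ ∈ Z, a σ x :=
      Finset.sum_nonneg fun σ _ => mul_nonneg (hψ.nonneg _) he0
    by_cases hnear : ∃ σ, V σ = 0 ∧ ‖u x - σ‖ < √δ
    · obtain ⟨σ, hσ, hlt⟩ := hnear
      have hqσ : ‖u x - σ‖ ^ 2 ≤ δ := by
        rw [← Real.sq_sqrt hψ.pos.le]
        exact pow_le_pow_left₀ (norm_nonneg _) hlt.le 2
      have hd0 : ∑ τ ∈ Z, d τ x = 0 := by
        refine Finset.sum_eq_zero fun τ hτ => ?_
        have : deriv ψ (‖u x - τ‖ ^ 2) = 0 := by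
          refine hψ.deriv_eq_zero (by positivity) ?_
          rcases eq_or_ne σ τ with rfl | hne
          · exact Or.inl hqσ
          · right
            have h1 := hsep σ τ hσ (hZ' τ hτ) hne
            have h2 : ‖σ - τ‖ ≤ ‖u x - σ‖ + ‖u x - τ‖ := by
              rw [norm_sub_rev (u x) σ]; exact norm_sub_le_norm_sub_add_norm_sub σ (u x) τ
            have h3 : ‖u x - σ‖ ≤ b := by
              have := hqσ.trans hψ.lt_sq.le
              exact le_of_sq_le_sq this hb.le
            exact pow_le_pow_left₀ hb.le (by linarith) 2
        simp [d, this]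
      have h1 : eDens V ε u x ≤ ∑ σ ∈ Z, a σ x := by
        have : a σ x = eDens V ε u x := by simp [a, hψ.eq_one _ (by positivity) hqσ]
        rw [← this]
        exact Finset.single_le_sum (f := fun σ => a σ x)
          (fun τ _ => mul_nonneg (hψ.nonneg _) he0) (by simpa [hZ] using hσ)
      have h2 : 0 ≤ K * (ε⁻¹ * V (u x)) := mul_nonneg (by positivity) hV0
      linarith
    · push Not at hnear
      have hmx := hmV (u x) hnear
      have hCm : ε * gradSq u x ≤ C / m * (ε⁻¹ * V (u x)) := by
        refine hgr.trans ?_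
        have : C * ε⁻¹ * m ≤ C * ε⁻¹ * V (u x) := mul_le_mul_of_nonneg_left hmx (by positivity)
        rw [div_mul_eq_mul_div, le_div_iff₀ hm]
        linarith
      have hdsum : ∑ σ ∈ Z, d σ x ≤ Z.card * (ε * gradSq u x) := by
        rw [← nsmul_eq_mul]
        refine Finset.sum_le_card_nsmul _ _ _ fun σ _ => ?_
        exact mul_le_of_le_one_left hgn (hψ.slope _ (by positivity))
      have h3 : (Z.card : ℝ) * (ε * gradSq u x) ≤ Z.card * (C / m * (ε⁻¹ * V (u x))) :=
        mul_le_mul_of_nonneg_left hCm (by positivity)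
      have h4 : K * (ε⁻¹ * V (u x)) = Z.card * (C / m * (ε⁻¹ * V (u x)))
          + C / m * (ε⁻¹ * V (u x)) / 2 + ε⁻¹ * V (u x) := by
        rw [hK]; field_simp
      linarith
  have iA : Integrable fun x => ∑ σ ∈ Z, χ x * a σ x := integrable_finsetSum _ fun σ _ => ia σ
  have iD : Integrable fun x => ∑ σ ∈ Z, χ x * d σ x := integrable_finsetSum _ fun σ _ => id' σ
  have iv' := iv.const_mul K
  have iB : Integrable fun x => K * (χ x * (ε⁻¹ * V (u x))) - ∑ σ ∈ Z, χ x * d σ x := iv'.sub iD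
  have hint := integral_mono ie (iA.add iB) hpoint
  simp only [Pi.add_apply] at hint
  rw [integral_add iA iB, integral_sub iv' iD,
    integral_finsetSum _ fun σ _ => ia σ, integral_finsetSum _ fun σ _ => id' σ,
    integral_const_mul] at hint
  have hsum : ∑ σ ∈ Z, ∫ x, χ x * a σ x ≤ ∑ σ ∈ Z, ((∫ x, χ x * d σ x)
      + √ε * b * ∑ j, ∫ x, |pd χ j x| * (1 + eDens V ε u x)) :=
    Finset.sum_le_sum fun σ hσ => integral_cutoff_eDens_le hΩ hV.smooth hV.nonneg hε h.sol hb.le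
      (hconv σ (hZ' σ hσ)) hψ.contDiff hψ.nonneg hψ.le_one hψ.eq_zero hχΩ hχ0
  rw [Finset.sum_add_distrib, Finset.sum_const, nsmul_eq_mul] at hsum
  have : √ε * (Z.card * b) * (∑ j, ∫ x, |pd χ j x| * (1 + eDens V ε u x))
      = Z.card * (√ε * b * ∑ j, ∫ x, |pd χ j x| * (1 + eDens V ε u x)) := by ring
  rw [this]
  linarith

end

theorem exists_primitive_bounded {φ g : ℝ → ℝ} (hφ : Continuous φ) (h0 : ∀ s, 0 ≤ φ s)
    (hle : ∀ s, φ s ≤ g s) (hg : Integrable g) :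
    ∃ f : ℝ → ℝ, ContDiff ℝ 1 f ∧ (∀ s, HasDerivAt f (φ s) s) ∧ ∀ s, |f s| ≤ ∫ s, g s := by
  have hd (s : ℝ) : HasDerivAt (fun s => ∫ t in (0 : ℝ)..s, φ t) (φ s) s :=
    intervalIntegral.integral_hasDerivAt_right (hφ.intervalIntegrable _ _)
      hφ.stronglyMeasurable.stronglyMeasurableAtFilter hφ.continuousAt
  have hi : Integrable φ := hg.mono' hφ.aestronglyMeasurable
    (ae_of_all _ fun s => by rw [Real.norm_of_nonneg (h0 s)]; exact hle s)
  refine ⟨fun s => ∫ t in (0 : ℝ)..s, φ t, ?_, hd, fun s => ?_⟩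
  · rw [contDiff_one_iff_deriv, funext fun s => (hd s).deriv]
    exact ⟨fun s => (hd s).differentiableAt, hφ⟩
  · calc |∫ t in (0 : ℝ)..s, φ t| ≤ |∫ t in (0 : ℝ)..s, ‖φ t‖| := by
          rw [← Real.norm_eq_abs]; exact intervalIntegral.norm_integral_le_abs_integral_norm
      _ = ∫ t in Set.uIoc 0 s, φ t := by
        simp only [Real.norm_of_nonneg (h0 _)]
        rw [intervalIntegral.abs_intervalIntegral_eq, abs_of_nonneg]
        exact integral_nonneg h0
      _ ≤ ∫ t, φ t := setIntegral_le_integral hi (ae_of_all _ h0)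
      _ ≤ ∫ s, g s := integral_mono hi hg hle

section Decay

variable {k : ℕ} {V : Evec k → ℝ} {ε : ℝ} {Ω : Set E2} {u : E2 → Evec k}

/-- Testing the stress tensor with a field depending on a single coordinate. -/
theorem integral_diag_stress_le (hΩ : IsOpen Ω) (hV : ContDiff ℝ (⊤ : ℕ∞) V) (hV0 : ∀ y, 0 ≤ V y)
    (hε : 0 < ε) (hs : IsSolution V ε Ω u) {χ : E2 → ℝ} (hχ : C1Test Ω χ) (i : Fin 2) {f φ : ℝ → ℝ}
    {M : ℝ} (hf : ContDiff ℝ 1 f) (hd : ∀ s, HasDerivAt f (φ s) s) (hM : ∀ s, |f s| ≤ M) :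
    ∫ x, χ x * (φ (x i) * stress V ε u i i x) ≤ M * ∑ j, ∫ x, |pd χ j x| * eDens V ε u x := by
  have hφ : Continuous φ := by
    rw [show φ = deriv f from funext fun s => (hd s).deriv.symm]
    exact hf.continuous_deriv (by simp)
  have hcoord : ContDiff ℝ 1 fun x : E2 => f (x i) := by fun_prop
  have hTc (j : Fin 2) : ContinuousOn (stress V ε u i j) Ω :=
    (contDiffOn_stress hΩ hV hs.1 i j).continuousOn
  have hec : ContinuousOn (eDens V ε u) Ω := (contDiffOn_eDens hΩ hV hs.1).continuousOn
  have key := integral_stress_pd hΩ hV hε hs (hχ.mul_left hcoord) i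
  have hpd (j : Fin 2) (x : E2) : pd (fun x => f (x i) * χ x) j x * stress V ε u i j x
      = pd χ j x * (f (x i) * stress V ε u i j x)
        + χ x * (φ (x i) * b2 j i * stress V ε u i j x) := by
    rw [pd_mul (hcoord.differentiable (by simp) x) (hχ.1.differentiable (by simp) x),
      pd_coord (hf.differentiable (by simp)), (hd _).deriv]
    ring
  have i1 (j : Fin 2) : Integrable fun x => pd χ j x * (f (x i) * stress V ε u i j x) :=
    (hχ.pd_test j).integrable_mul hΩ (g := fun x => f (x i) * stress V ε u i j x)
      (hcoord.continuous.continuousOn.mul (hTc j)) _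
  have i2 (j : Fin 2) : Integrable fun x => χ x * (φ (x i) * b2 j i * stress V ε u i j x) :=
    hχ.test.integrable_mul hΩ (g := fun x => φ (x i) * b2 j i * stress V ε u i j x)
      (((hφ.comp (by fun_prop : Continuous fun x : E2 => x i)).continuousOn.mul
        continuousOn_const).mul (hTc j)) _
  have i3 (j : Fin 2) : Integrable fun x => M * (|pd χ j x| * eDens V ε u x) :=
    ((hχ.pd_test j).abs.integrable_mul hΩ hec _).const_mul M
  simp only [hpd] at key
  simp only [fun j => integral_add (i1 j) (i2 j), Finset.sum_add_distrib] at key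
  have h2 : ∑ j, ∫ x, χ x * (φ (x i) * b2 j i * stress V ε u i j x)
      = ∫ x, χ x * (φ (x i) * stress V ε u i i x) := by
    rw [Finset.sum_eq_single i]
    · simp [b2]
    · intro j _ hj
      simp [b2, hj.symm]
    · simp
  have h1 (j : Fin 2) : -∫ x, pd χ j x * (f (x i) * stress V ε u i j x)
      ≤ M * ∫ x, |pd χ j x| * eDens V ε u x := by
    rw [← integral_neg, ← integral_const_mul]
    refine integral_mono (i1 j).neg (i3 j) fun x => ?_
    refine (neg_le_abs _).trans ?_
    rw [abs_mul, abs_mul, mul_left_comm M]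
    refine mul_le_mul_of_nonneg_left ?_ (abs_nonneg _)
    exact mul_le_mul (hM _) (abs_stress_le hV0 hε u i j x) (abs_nonneg _)
      ((abs_nonneg _).trans (hM 0))
  rw [h2] at key
  have h3 := Finset.sum_le_sum fun j (_ : j ∈ Finset.univ) => h1 j
  rw [Finset.sum_neg_distrib, ← Finset.mul_sum] at h3
  linarith

/-- A solution is trapped near a well along a line carrying little energy. -/
theorem SquareData.trapped_of_lineInt_lt (hV : IsMultiWell V) {G x₀ r F}
    (h : SquareData V G ε Ω u x₀ r F) {b κ δ c m : ℝ} {ψ : ℝ → ℝ} (hψ : IsCutoff b κ δ ψ)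
    (hc : 0 < c) (hH : ∀ σ, V σ = 0 → SubEikonal V fun y => c * (1 - ψ (‖y - σ‖ ^ 2)))
    (hm : ∀ y, (∀ σ, V σ = 0 → √δ ≤ ‖y - σ‖) → m ≤ V y) (hεr : c * ε < m * (2 * r))
    {i : Fin 2} {x : E2} (hx : x ∈ csq x₀ r) (hlt : lineInt F i (x i) < c) :
    ∃ σ, V σ = 0 ∧ ‖u x - σ‖ ^ 2 < b ^ 2 := by
  have hε := h.eps_pos
  have hr := h.r_pos
  have hmem : ∀ t ∈ Set.Icc (x₀ (1 - i) - r) (x₀ (1 - i) + r), pt i (x i) t ∈ csq x₀ r :=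
    fun t ht => pt_mem_csq.2 ⟨hx i, abs_le.2 ⟨by linarith [ht.1], by linarith [ht.2]⟩⟩
  obtain ⟨t, ht, hle⟩ := exists_mul_le_lineInt h.cont h.compact h.nonneg i (x i)
    (show x₀ (1 - i) - r < x₀ (1 - i) + r by linarith)
  have hVt : V (u (pt i (x i) t)) < m := by
    have h1 := (potential_le_eDens V hε u (pt i (x i) t)).trans (h.le _ (hmem t ht))
    have h2 : 2 * r * (ε⁻¹ * V (u (pt i (x i) t))) < c :=
      ((mul_le_mul_of_nonneg_left h1 (by positivity)).trans (by linarith)).trans_lt hlt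
    have h3 : 2 * r * V (u (pt i (x i) t)) < c * ε := by
      have := mul_lt_mul_of_pos_right h2 hε
      calc 2 * r * V (u (pt i (x i) t))
          = 2 * r * (ε⁻¹ * V (u (pt i (x i) t))) * ε := by field_simp
        _ < _ := this
    nlinarith
  have hnear : ∃ σ, V σ = 0 ∧ ‖u (pt i (x i) t) - σ‖ < √δ := by
    by_contra! hcon
    exact (hm _ hcon).not_gt hVt
  obtain ⟨σ, hσ, hd⟩ := hnear
  refine ⟨σ, hσ, ?_⟩
  have hx' : x (1 - i) ∈ Set.Icc (x₀ (1 - i) - r) (x₀ (1 - i) + r) := by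
    have := abs_le.1 (hx (1 - i)); exact ⟨by linarith, by linarith⟩
  have hsub : Set.uIcc t (x (1 - i)) ⊆ Set.Icc (x₀ (1 - i) - r) (x₀ (1 - i) + r) :=
    Set.uIcc_subset_Icc ht hx'
  have hosc := (hH σ hσ).abs_sub_le_lineInt hV.nonneg hε h.isOpen h.sol.1
    (fun τ hτ => h.subset (hmem τ (hsub hτ))) h.cont h.compact h.nonneg
    (fun τ hτ => h.le _ (hmem τ (hsub hτ)))
  have h1 : ψ (‖u (pt i (x i) t) - σ‖ ^ 2) = 1 := by
    refine hψ.eq_one _ (by positivity) ?_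
    rw [← Real.sq_sqrt hψ.pos.le]
    exact pow_le_pow_left₀ (norm_nonneg _) hd.le 2
  simp only [h1, sub_self, mul_zero, sub_zero, pt_coord] at hosc
  by_contra! hcon
  rw [hψ.eq_zero _ hcon, sub_zero, mul_one, abs_of_pos hc] at hosc
  linarith

set_option maxHeartbeats 400000 in
/-- On a square of small energy, the localized energy is controlled by the product of the total
energy with the energy weighted by the gradient of the cutoff. -/
theorem IsMultiWell.exists_energy_decay (hV : IsMultiWell V) :
    ∃ B ≥ (0 : ℝ), ∃ A ≥ (0 : ℝ), ∃ μ > (0 : ℝ),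
      ∀ (ε : ℝ) (Ω : Set E2) (u : E2 → Evec k) (x₀ : E2) (r : ℝ) (F χ : E2 → ℝ),
      SquareData V 1 ε Ω u x₀ r F → ε ≤ μ * r → C1Test (osq x₀ (3 * r / 4)) χ → (∀ x, 0 ≤ χ x) →
      ∫ x, χ x * eDens V ε u x ≤ B * (∫ x, F x) * (∑ j, ∫ x, |pd χ j x| * eDens V ε u x)
        + √ε * A * ∑ j, ∫ x, |pd χ j x| * (1 + eDens V ε u x) := by
  classical
  obtain ⟨K, hK, A₀, hA₀, hKA⟩ := hV.exists_energy_le_potential 1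
  obtain ⟨b, hb, hconv, hsep⟩ := hV.exists_well_radius
  set Z := hV.finite_zeros.toFinset with hZ
  have hZ' : ∀ σ ∈ Z, V σ = 0 := fun σ hσ => by simpa [hZ] using hσ
  set κ := 1 / (8 * K * (Z.card + 1)) with hκ
  obtain ⟨δ, ψ, hψ⟩ := exists_isCutoff hb (show 0 < κ by positivity)
  have hsδ : 0 < √δ := Real.sqrt_pos.2 hψ.pos
  have hsδb : √δ ≤ b := (Real.sqrt_le_sqrt hψ.lt_sq.le).trans_eq (Real.sqrt_sq hb.le)
  obtain ⟨δ', ψ', hψ'⟩ := exists_isCutoff hsδ one_pos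
  obtain ⟨c, hc, hH⟩ := hV.exists_subEikonal_trap hsδ
    (fun σ σ' h h' hne =>
      (mul_le_mul_of_nonneg_left hsδb zero_le_two).trans (hsep σ σ' h h' hne)) hψ'
  obtain ⟨m, hm, hmV⟩ := hV.exists_pos_le_of_away (Real.sqrt_pos.2 hψ'.pos)
  refine ⟨2 * K / c, by positivity, 4 * K * Z.card * b + 2 * A₀, by positivity, m / c,
    by positivity, fun ε Ω u x₀ r F χ h hεr hχ hχ0 => ?_⟩
  have hε := h.eps_pos
  have hr := h.r_pos
  have hΩ := h.isOpen
  have hu := h.sol.1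
  have hεr' : c * ε < m * (2 * r) := by
    have h1 : c * ε ≤ c * (m / c * r) := mul_le_mul_of_nonneg_left hεr hc.le
    have h2 : c * (m / c * r) = m * r := by field_simp
    have h3 : 0 < m * r := by positivity
    linarith
  have hsub : osq x₀ (3 * r / 4) ⊆ csq x₀ r := (osq_subset_csq _ _).trans (csq_mono (by linarith))
  have hχΩ : C1Test Ω χ := hχ.mono (hsub.trans h.subset)
  have hec : ContinuousOn (eDens V ε u) Ω := (contDiffOn_eDens hΩ hV.smooth hu).continuousOn
  have hgc : ContinuousOn (gradSq u) Ω := (contDiffOn_gradSq hΩ hu).continuousOn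
  have hvc : ContinuousOn (fun x => V (u x)) Ω := (contDiffOn_potential hV.smooth hu).continuousOn
  have hqc (σ : Evec k) : ContinuousOn (fun x => ‖u x - σ‖ ^ 2) Ω :=
    (hu.continuousOn.sub continuousOn_const).norm.pow 2
  have hac (σ : Evec k) : ContinuousOn (fun x => ψ (‖u x - σ‖ ^ 2) * eDens V ε u x) Ω :=
    (hψ.contDiff.continuous.comp_continuousOn (hqc σ)).mul hec
  have hdc (σ : Evec k) : ContinuousOn
      (fun x => 2 * ‖u x - σ‖ ^ 2 * |deriv ψ (‖u x - σ‖ ^ 2)| * (ε * gradSq u x)) Ω :=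
    ((continuousOn_const.mul (hqc σ)).mul
      ((hψ.contDiff.continuous_deriv (by simp)).comp_continuousOn (hqc σ)).abs).mul
      (continuousOn_const.mul hgc)
  have ie : Integrable (fun x => χ x * eDens V ε u x) := hχΩ.test.integrable_mul hΩ hec _
  have iv : Integrable (fun x => χ x * (ε⁻¹ * V (u x))) :=
    hχΩ.test.integrable_mul hΩ (g := fun x => ε⁻¹ * V (u x)) (continuousOn_const.mul hvc) _
  have ia (σ : Evec k) : Integrable (fun x => χ x * (ψ (‖u x - σ‖ ^ 2) * eDens V ε u x)) :=
    hχΩ.test.integrable_mul hΩ (hac σ) _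
  set D := ∑ j, ∫ x, |pd χ j x| * eDens V ε u x with hD
  set D₁ := ∑ j, ∫ x, |pd χ j x| * (1 + eDens V ε u x) with hD₁
  set X := ∫ x, χ x * eDens V ε u x with hX
  set P := ∫ x, χ x * (ε⁻¹ * V (u x)) with hP
  set φ : Fin 2 → ℝ → ℝ := fun i s => min 1 (lineInt F i s / c) with hφ
  have hLc (i : Fin 2) := continuous_lineInt h.cont h.compact i
  have hLi (i : Fin 2) : Integrable (lineInt F i) :=
    (hLc i).integrable_of_hasCompactSupport (hasCompactSupport_lineInt h.compact i)
  have hφc (i : Fin 2) : Continuous (φ i) := continuous_const.min ((hLc i).div_const c)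
  have hφ0 (i : Fin 2) (s : ℝ) : 0 ≤ φ i s :=
    le_min zero_le_one (div_nonneg (lineInt_nonneg h.nonneg i s) hc.le)
  have hdiag (i : Fin 2) :
      ∫ x, χ x * (φ i (x i) * stress V ε u i i x) ≤ (∫ x, F x) / c * D := by
    obtain ⟨f, hf, hfd, hfM⟩ := exists_primitive_bounded (hφc i) (hφ0 i)
      (fun s => min_le_right _ _) ((hLi i).div_const c)
    rw [integral_div, integral_lineInt h.cont h.compact i] at hfM
    exact integral_diag_stress_le hΩ hV.smooth hV.nonneg hε h.sol hχΩ i hf hfd hfM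
  have idg (i : Fin 2) : Integrable fun x => χ x * (φ i (x i) * stress V ε u i i x) :=
    hχΩ.test.integrable_mul hΩ (g := fun x => φ i (x i) * stress V ε u i i x)
      (((hφc i).comp (by fun_prop : Continuous fun x : E2 => x i)).continuousOn.mul
        (contDiffOn_stress hΩ hV.smooth hu i i).continuousOn) _
  have hpoint (x : E2) : 2 * (χ x * (ε⁻¹ * V (u x)))
      ≤ 4 * (∑ σ ∈ Z, χ x * (ψ (‖u x - σ‖ ^ 2) * eDens V ε u x))
        + (χ x * (φ 0 (x 0) * stress V ε u 0 0 x) + χ x * (φ 1 (x 1) * stress V ε u 1 1 x)) := by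
    by_cases hx : x ∈ tsupport χ
    swap
    · simp [image_eq_zero_of_notMem_tsupport hx]
    have hxs := hsub (hχ.2.2 hx)
    have he0 := eDens_nonneg hV.nonneg hε u x
    have hs0 : 0 ≤ ∑ σ ∈ Z, ψ (‖u x - σ‖ ^ 2) * eDens V ε u x :=
      Finset.sum_nonneg fun σ _ => mul_nonneg (hψ.nonneg _) he0
    suffices hs : 2 * (ε⁻¹ * V (u x)) ≤ 4 * (∑ σ ∈ Z, ψ (‖u x - σ‖ ^ 2) * eDens V ε u x)
        + (φ 0 (x 0) * stress V ε u 0 0 x + φ 1 (x 1) * stress V ε u 1 1 x) by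
      rw [← Finset.mul_sum]
      have := mul_le_mul_of_nonneg_left hs (hχ0 x)
      linarith
    by_cases hsmall : ∃ i, lineInt F i (x i) < c
    · obtain ⟨i, hi⟩ := hsmall
      obtain ⟨σ, hσ, hlt⟩ := h.trapped_of_lineInt_lt hV hψ' hc hH hmV hεr' hxs hi
      rw [Real.sq_sqrt hψ.pos.le] at hlt
      have h1 : eDens V ε u x ≤ ∑ σ ∈ Z, ψ (‖u x - σ‖ ^ 2) * eDens V ε u x := by
        have h2 : ψ (‖u x - σ‖ ^ 2) * eDens V ε u x = eDens V ε u x := by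
          rw [hψ.eq_one _ (by positivity) hlt.le, one_mul]
        conv_lhs => rw [← h2]
        exact Finset.single_le_sum (f := fun σ => ψ (‖u x - σ‖ ^ 2) * eDens V ε u x)
          (fun τ _ => mul_nonneg (hψ.nonneg _) he0) (by simpa [hZ] using hσ)
      have h3 (i : Fin 2) : -eDens V ε u x ≤ φ i (x i) * stress V ε u i i x := by
        refine (abs_le.1 ?_).1
        rw [abs_mul, abs_of_nonneg (hφ0 i _)]
        exact (mul_le_of_le_one_left (abs_nonneg _) (min_le_left _ _)).trans
          (abs_stress_le hV.nonneg hε u i i x)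
      linarith [h3 0, h3 1, potential_le_eDens V hε u x]
    · push Not at hsmall
      have h1 (i : Fin 2) : φ i (x i) = 1 := min_eq_left ((one_le_div hc).2 (hsmall i))
      rw [h1, h1, one_mul, one_mul, stress_trace]
      linarith
  have hI (σ : Evec k) (hσ : σ ∈ Z) : ∫ x, χ x * (ψ (‖u x - σ‖ ^ 2) * eDens V ε u x)
      ≤ 2 * κ * X + √ε * b * D₁ := by
    refine (integral_cutoff_eDens_le hΩ hV.smooth hV.nonneg hε h.sol hb.le
      (hconv σ (hZ' σ hσ)) hψ.contDiff hψ.nonneg hψ.le_one hψ.eq_zero hχΩ hχ0).trans ?_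
    refine add_le_add_left ?_ _
    rw [hX, ← integral_const_mul]
    refine integral_mono (hχΩ.test.integrable_mul hΩ (hdc σ) _) (ie.const_mul _) fun x => ?_
    have h1 : ε * gradSq u x ≤ 2 * eDens V ε u x := by
      have : 0 ≤ ε⁻¹ * V (u x) := mul_nonneg (by positivity) (hV.nonneg _)
      unfold eDens; linarith
    have h2 : 2 * ‖u x - σ‖ ^ 2 * |deriv ψ (‖u x - σ‖ ^ 2)| * (ε * gradSq u x)
        ≤ κ * (2 * eDens V ε u x) :=
      mul_le_mul (hψ.slope _ (by positivity)) h1 (mul_nonneg hε.le (gradSq_nonneg u x))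
        (by positivity)
    have := mul_le_mul_of_nonneg_left h2 (hχ0 x)
    dsimp only
    linarith
  have iA : Integrable fun x => ∑ σ ∈ Z, χ x * (ψ (‖u x - σ‖ ^ 2) * eDens V ε u x) :=
    integrable_finsetSum _ fun σ _ => ia σ
  have iA' : Integrable fun x => 4 * ∑ σ ∈ Z, χ x * (ψ (‖u x - σ‖ ^ 2) * eDens V ε u x) :=
    iA.const_mul 4
  have iB : Integrable fun x => χ x * (φ 0 (x 0) * stress V ε u 0 0 x)
      + χ x * (φ 1 (x 1) * stress V ε u 1 1 x) := (idg 0).add (idg 1)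
  have hint := integral_mono (iv.const_mul 2) (iA'.add iB) hpoint
  simp only [Pi.add_apply] at hint
  rw [integral_const_mul, integral_add iA' iB, integral_const_mul, integral_add (idg 0) (idg 1),
    integral_finsetSum _ fun σ _ => ia σ] at hint
  have hsum := Finset.sum_le_sum hI
  rw [Finset.sum_const, nsmul_eq_mul] at hsum
  have hX0 : 0 ≤ X := integral_nonneg fun x => mul_nonneg (hχ0 x) (eDens_nonneg hV.nonneg hε u x)
  have hfin := hKA ε Ω u x₀ r F χ h hχ hχ0
  have hP2 : P ≤ 2 * (Z.card * (2 * κ * X + √ε * b * D₁)) + (∫ x, F x) / c * D := by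
    linarith [hdiag 0, hdiag 1]
  have h4 : K * (4 * Z.card * κ) ≤ 1 / 2 := by
    rw [hκ, mul_one_div, mul_div_assoc', div_le_div_iff₀ (by positivity) two_pos]
    nlinarith
  have h5 := mul_le_mul_of_nonneg_left hP2 hK.le
  have h6 := mul_le_mul_of_nonneg_right h4 hX0
  have h7 : 2 * K / c * (∫ x, F x) * D = 2 * (K * ((∫ x, F x) / c * D)) := by ring
  rw [h7]
  linarith

end Decay

theorem exists_testFun_eq_one {K U : Set E2} (hK : IsCompact K) (hU : IsOpen U) (hKU : K ⊆ U) :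
    ∃ θ, TestFun U θ ∧ (∀ x ∈ K, θ x = 1) ∧ ∀ x, 0 ≤ θ x ∧ θ x ≤ 1 := by
  obtain ⟨L, hL, hLc, hKL, hLU⟩ := exists_compact_closed_between hK hU hKU
  obtain ⟨f, hf1, hf0, hfc, hf⟩ := exists_continuous_one_zero_of_isCompact hK
    isOpen_interior.isClosed_compl (Set.disjoint_compl_right_iff_subset.2 hKL)
  refine ⟨f, ⟨f.continuous, hfc, ?_⟩, hf1, hf⟩
  refine (closure_minimal (fun x hx => ?_) hLc).trans hLU
  by_contra h
  exact hx (hf0 fun h' => h (interior_subset h'))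

theorem TestFun.integral_le_measureReal {U : Set E2} {θ : E2 → ℝ} (hθ : TestFun U θ)
    (h1 : ∀ x, 0 ≤ θ x ∧ θ x ≤ 1) {ν : Measure E2} [IsFiniteMeasure ν] (hU : MeasurableSet U) :
    ∫ x, θ x ∂ν ≤ ν.real U := by
  rw [← integral_indicator_one hU]
  refine integral_mono (hθ.integrable ν) ((integrable_const 1).indicator hU) fun x => ?_
  by_cases hx : x ∈ U
  · simpa [hx] using (h1 x).2
  · simp [hx, image_eq_zero_of_notMem_tsupport fun h => hx (hθ.2.2 h)]

theorem measureReal_le_integral {K : Set E2} {θ : E2 → ℝ} {ν : Measure E2} [IsFiniteMeasure ν]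
    (hθ : Integrable θ ν) (hK : MeasurableSet K) (h1 : ∀ x ∈ K, 1 ≤ θ x) (h0 : ∀ x, 0 ≤ θ x) :
    ν.real K ≤ ∫ x, θ x ∂ν := by
  rw [← integral_indicator_one hK]
  refine integral_mono ((integrable_const 1).indicator hK) hθ fun x => ?_
  by_cases hx : x ∈ K
  · simpa [hx] using h1 x hx
  · simpa [hx] using h0 x

/-- The limiting energy measure `ν` and the limiting potential measure `ζ` of a sequence of
solutions. -/
structure IsLimit {k : ℕ} (V : Evec k → ℝ) (Ω : Set E2) (ε : ℕ → ℝ) (u : ℕ → E2 → Evec k)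
    (ν ζ : Measure E2) : Prop where
  isOpen : IsOpen Ω
  eps_pos : ∀ n, 0 < ε n
  eps_tendsto : Tendsto ε atTop (𝓝 0)
  sol : ∀ n, IsSolution V (ε n) Ω (u n)
  finite : IsFiniteMeasure ν
  finite' : IsFiniteMeasure ζ
  compl : ν Ωᶜ = 0
  compl' : ζ Ωᶜ = 0
  tendsto : ∀ f, TestFun Ω f →
    Tendsto (fun n => ∫ x, f x * eDens V (ε n) (u n) x) atTop (𝓝 (∫ x, f x ∂ν))
  tendsto' : ∀ f, TestFun Ω f →
    Tendsto (fun n => ∫ x, f x * ((ε n)⁻¹ * V (u n x))) atTop (𝓝 (∫ x, f x ∂ζ))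

section Limit

variable {k : ℕ} {V : Evec k → ℝ} {Ω : Set E2} {ε : ℕ → ℝ} {u : ℕ → E2 → Evec k}
  {ν ζ : Measure E2}

theorem IsLimit.exists_squareData (hV : IsMultiWell V) (h : IsLimit V Ω ε u ν ζ) {x₀ : E2}
    {r a G μ : ℝ} (hr : 0 < r) (hsub : csq x₀ r ⊆ Ω) (ha : ν.real (csq x₀ r) < a) (haG : a ≤ G * r)
    (hμ : 0 < μ) :
    ∃ F : ℕ → E2 → ℝ, ∀ᶠ n in atTop, SquareData V G (ε n) Ω (u n) x₀ r (F n) ∧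
      ∫ x, F n x ≤ a ∧ ε n ≤ μ * r := by
  have := h.finite
  have hG : 0 ≤ G := by
    by_contra! hG
    nlinarith [measureReal_nonneg (μ := ν) (s := csq x₀ r)]
  have ha' : ν (csq x₀ r) < ENNReal.ofReal a :=
    (ENNReal.lt_ofReal_iff_toReal_lt (by finiteness)).2 ha
  obtain ⟨U, hU, hUo, hUa⟩ := Set.exists_isOpen_lt_of_lt _ _ ha'
  obtain ⟨θ, hθ, hθ1, hθ01⟩ := exists_testFun_eq_one (isCompact_csq x₀ r) (hUo.inter h.isOpen)
    (Set.subset_inter hU hsub)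
  have hθΩ : TestFun Ω θ := hθ.mono Set.inter_subset_right
  have hlt : ∫ x, θ x ∂ν < a := by
    refine ((hθ.mono Set.inter_subset_left).integral_le_measureReal hθ01
      hUo.measurableSet).trans_lt ?_
    exact (ENNReal.lt_ofReal_iff_toReal_lt (by finiteness)).1 hUa
  have hec (n : ℕ) : ContinuousOn (eDens V (ε n) (u n)) Ω :=
    (contDiffOn_eDens h.isOpen hV.smooth (h.sol n).1).continuousOn
  refine ⟨fun n x => θ x * eDens V (ε n) (u n) x, ?_⟩
  have hsmall {c : ℝ} (hc : 0 ≤ c) {s : ℝ} (hs : 0 < s) : ∀ᶠ n in atTop, c * ε n ≤ s := by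
    have h0 : Tendsto (fun n => c * ε n) atTop (𝓝 0) := by
      simpa using h.eps_tendsto.const_mul c
    exact (h0.eventually (gt_mem_nhds hs)).mono fun n hn => le_of_lt hn
  filter_upwards [(h.tendsto θ hθΩ).eventually (gt_mem_nhds hlt),
    hsmall (c := 4 * G) (by positivity) hr, hsmall (c := 8) (by norm_num) hr,
    hsmall (c := 1) (by norm_num) (mul_pos hμ hr)] with n h1 h2 h3 h4
  have hT := hθΩ.mul_continuousOn h.isOpen (hec n)
  refine ⟨⟨h.eps_pos n, h.isOpen, h.sol n, hr, h2, h3, hsub, hT.1, hT.2.1, fun x =>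
    mul_nonneg (hθ01 x).1 (eDens_nonneg hV.nonneg (h.eps_pos n) _ _), fun x hx => ?_,
    h1.le.trans haG⟩, h1.le, by simpa using h4⟩
  rw [hθ1 x hx, one_mul]

theorem IsLimit.tendsto_error (hV : IsMultiWell V) (h : IsLimit V Ω ε u ν ζ) {χ : E2 → ℝ}
    (hχ : C1Test Ω χ) (A : ℝ) :
    Tendsto (fun n => √(ε n) * A * ∑ j, ∫ x, |pd χ j x| * (1 + eDens V (ε n) (u n) x)) atTop
      (𝓝 0) := by
  have h1 : Tendsto (fun n => √(ε n) * A) atTop (𝓝 0) := by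
    have := (Real.continuous_sqrt.tendsto 0).comp h.eps_tendsto
    simpa using this.mul_const A
  have h2 : Tendsto (fun n => ∑ j, ∫ x, |pd χ j x| * (1 + eDens V (ε n) (u n) x)) atTop
      (𝓝 (∑ j, ((∫ x, |pd χ j x|) + ∫ x, |pd χ j x| ∂ν))) := by
    refine tendsto_finsetSum _ fun j _ => ?_
    have hT := (hχ.pd_test j).abs
    have heq (n : ℕ) : ∫ x, |pd χ j x| * (1 + eDens V (ε n) (u n) x)
        = (∫ x, |pd χ j x|) + ∫ x, |pd χ j x| * eDens V (ε n) (u n) x := by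
      rw [← integral_add (hT.integrable _) (hT.integrable_mul h.isOpen
        (contDiffOn_eDens h.isOpen hV.smooth (h.sol n).1).continuousOn _)]
      simp only [mul_add, mul_one]
    simp only [heq]
    exact tendsto_const_nhds.add (h.tendsto _ hT)
  simpa using h1.mul h2

theorem IsMultiWell.exists_integral_le (hV : IsMultiWell V) (G : ℝ) :
    ∃ K > (0 : ℝ), ∀ {Ω : Set E2} {ε : ℕ → ℝ} {u : ℕ → E2 → Evec k} {ν ζ : Measure E2},
      IsLimit V Ω ε u ν ζ → ∀ (x₀ : E2) (r : ℝ) (χ : E2 → ℝ), 0 < r → csq x₀ r ⊆ Ω →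
      ν.real (csq x₀ r) < G * r → C1Test (osq x₀ (3 * r / 4)) χ → (∀ x, 0 ≤ χ x) →
      ∫ x, χ x ∂ν ≤ K * ∫ x, χ x ∂ζ := by
  obtain ⟨K, hK, A, hA, hKA⟩ := hV.exists_energy_le_potential G
  refine ⟨K, hK, fun {Ω ε u ν ζ} h x₀ r χ hr hsub hG hχ hχ0 => ?_⟩
  have hχΩ : C1Test Ω χ := hχ.mono
    (((osq_subset_csq _ _).trans (csq_mono (by linarith))).trans hsub)
  obtain ⟨F, hF⟩ := h.exists_squareData hV hr hsub hG le_rfl one_pos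
  have hlim := ((h.tendsto' χ hχΩ.test).const_mul K).add (h.tendsto_error hV hχΩ A)
  rw [add_zero] at hlim
  refine le_of_tendsto_of_tendsto (h.tendsto χ hχΩ.test) hlim ?_
  filter_upwards [hF] with n hn
  exact hKA _ _ _ _ _ _ _ hn.1 hχ hχ0

theorem IsMultiWell.exists_integral_decay (hV : IsMultiWell V) :
    ∃ B ≥ (0 : ℝ), ∀ {Ω : Set E2} {ε : ℕ → ℝ} {u : ℕ → E2 → Evec k} {ν ζ : Measure E2},
      IsLimit V Ω ε u ν ζ → ∀ (x₀ : E2) (r : ℝ) (χ : E2 → ℝ), 0 < r → csq x₀ r ⊆ Ω →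
      ν.real (csq x₀ r) < r → C1Test (osq x₀ (3 * r / 4)) χ → (∀ x, 0 ≤ χ x) →
      ∫ x, χ x ∂ν ≤ B * ν.real (csq x₀ r) * ∑ j, ∫ x, |pd χ j x| ∂ν := by
  obtain ⟨B, hB, A, hA, μ, hμ, hBA⟩ := hV.exists_energy_decay
  refine ⟨B, hB, fun {Ω ε u ν ζ} h x₀ r χ hr hsub hG hχ hχ0 => ?_⟩
  have hχΩ : C1Test Ω χ := hχ.mono
    (((osq_subset_csq _ _).trans (csq_mono (by linarith))).trans hsub)
  have key : ∀ a ∈ Set.Ioo (ν.real (csq x₀ r)) r,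
      ∫ x, χ x ∂ν ≤ B * a * ∑ j, ∫ x, |pd χ j x| ∂ν := by
    intro a ha
    obtain ⟨F, hF⟩ := h.exists_squareData hV hr hsub ha.1 ((one_mul r).symm ▸ ha.2.le) hμ
    have hD : Tendsto (fun n => ∑ j, ∫ x, |pd χ j x| * eDens V (ε n) (u n) x) atTop
        (𝓝 (∑ j, ∫ x, |pd χ j x| ∂ν)) :=
      tendsto_finsetSum _ fun j _ => h.tendsto _ (hχΩ.pd_test j).abs
    have hlim := (hD.const_mul (B * a)).add (h.tendsto_error hV hχΩ A)
    rw [add_zero] at hlim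
    refine le_of_tendsto_of_tendsto (h.tendsto χ hχΩ.test) hlim ?_
    filter_upwards [hF] with n hn
    refine (hBA _ _ _ _ _ _ _ hn.1 hn.2.2 hχ hχ0).trans ?_
    have h0 : 0 ≤ ∑ j, ∫ x, |pd χ j x| * eDens V (ε n) (u n) x :=
      Finset.sum_nonneg fun j _ => integral_nonneg fun x =>
        mul_nonneg (abs_nonneg _) (eDens_nonneg hV.nonneg (h.eps_pos n) _ _)
    gcongr
    exact hn.2.1
  have hlim : Tendsto (fun a => B * a * ∑ j, ∫ x, |pd χ j x| ∂ν) (𝓝[>] (ν.real (csq x₀ r)))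
      (𝓝 (B * ν.real (csq x₀ r) * ∑ j, ∫ x, |pd χ j x| ∂ν)) :=
    (Continuous.tendsto (by fun_prop) _).mono_left nhdsWithin_le_nhds
  refine ge_of_tendsto hlim ?_
  filter_upwards [Ioo_mem_nhdsGT hG] with a ha using key a ha

end Limit

/-- Smooth cutoffs between two concentric squares. -/
theorem exists_squareCutoff : ∃ C > (0 : ℝ), ∀ (x₀ : E2) (r : ℝ), 0 < r →
    ∃ χ, C1Test (osq x₀ (3 * r / 4)) χ ∧ (∀ x, 0 ≤ χ x) ∧ (∀ x ∈ csq x₀ (r / 2), χ x = 1) ∧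
      ∀ j x, |pd χ j x| ≤ C / r := by
  set h : ℝ → ℝ := fun s => Real.smoothTransition ((25 / 64 - s ^ 2) * (64 / 9)) with hh
  have hc : ContDiff ℝ 1 h := Real.smoothTransition.contDiff.comp (by fun_prop)
  have h0 (s : ℝ) : 0 ≤ h s := Real.smoothTransition.nonneg _
  have hle (s : ℝ) : h s ≤ 1 := Real.smoothTransition.le_one _
  have hz (s : ℝ) (hs : 5 / 8 ≤ |s|) : h s = 0 := by
    refine Real.smoothTransition.zero_of_nonpos ?_
    have : (5 / 8) ^ 2 ≤ s ^ 2 := by rw [← sq_abs s]; gcongr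
    linarith
  have h1 (s : ℝ) (hs : |s| ≤ 1 / 2) : h s = 1 := by
    refine Real.smoothTransition.one_of_one_le ?_
    have : s ^ 2 ≤ (1 / 2) ^ 2 := by rw [← sq_abs s]; gcongr
    linarith
  have hcs : HasCompactSupport h := HasCompactSupport.intro (isCompact_Icc (a := -1) (b := 1))
    fun s hs => hz s (by
      by_contra! hlt
      exact hs (abs_le.1 (by linarith)))
  obtain ⟨C, hC⟩ := (hcs.deriv).exists_bound_of_continuous (hc.continuous_deriv (by simp))
  have hC0 : 0 ≤ C := (norm_nonneg _).trans (hC 0)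
  refine ⟨C + 1, by positivity, fun x₀ r hr => ?_⟩
  set g : Fin 2 → ℝ → ℝ := fun i s => h ((s - x₀ i) / r) with hg
  have hgc (i : Fin 2) : ContDiff ℝ 1 (g i) := hc.comp (by fun_prop)
  have hgd (i : Fin 2) (s : ℝ) : |deriv (g i) s| ≤ C / r := by
    have h2 : HasDerivAt (g i) (deriv h ((s - x₀ i) / r) * (1 / r)) s :=
      ((hc.differentiable (by simp) _).hasDerivAt).comp s
        (((hasDerivAt_id' s).sub_const (x₀ i)).div_const r)
    rw [h2.deriv, abs_mul, abs_of_pos (by positivity : 0 < 1 / r), mul_one_div]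
    gcongr
    exact hC _
  have hgx (i : Fin 2) : ContDiff ℝ 1 fun x : E2 => g i (x i) := (hgc i).comp (by fun_prop)
  have hsupp : ∀ x, g 0 (x 0) * g 1 (x 1) ≠ 0 → x ∈ csq x₀ (5 * r / 8) := by
    intro x hx
    rw [mul_ne_zero_iff] at hx
    have hi (i : Fin 2) (hi : g i (x i) ≠ 0) : |x i - x₀ i| ≤ 5 * r / 8 := by
      by_contra! hlt
      refine hi (hz _ ?_)
      rw [abs_div, abs_of_pos hr, le_div_iff₀ hr]
      linarith
    exact Fin.forall_fin_two.2 ⟨hi 0 hx.1, hi 1 hx.2⟩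
  have hts : tsupport (fun x : E2 => g 0 (x 0) * g 1 (x 1)) ⊆ csq x₀ (5 * r / 8) :=
    closure_minimal hsupp (isClosed_csq _ _)
  refine ⟨fun x => g 0 (x 0) * g 1 (x 1), ⟨(hgx 0).mul (hgx 1),
    (isCompact_csq _ _).of_isClosed_subset (isClosed_tsupport _) hts,
    hts.trans (csq_subset_osq (by linarith))⟩, fun x => mul_nonneg (h0 _) (h0 _),
    fun x hx => ?_, fun j x => ?_⟩
  · have hi (i : Fin 2) : g i (x i) = 1 := by
      refine h1 _ ?_
      rw [abs_div, abs_of_pos hr, div_le_iff₀ hr]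
      linarith [hx i]
    simp only [hi, one_mul]
  · rw [pd_mul ((hgx 0).differentiable (by simp) x) ((hgx 1).differentiable (by simp) x),
      pd_coord ((hgc 0).differentiable (by simp)), pd_coord ((hgc 1).differentiable (by simp))]
    have hb (i l : Fin 2) (hil : l ≠ i) : |g l (x l) * deriv (g i) (x i)| ≤ (C + 1) / r := by
      rw [abs_mul, abs_of_nonneg (h0 _)]
      refine (mul_le_of_le_one_left (abs_nonneg _) (hle _)).trans ((hgd i _).trans ?_)
      gcongr
      linarith
    fin_cases j
    · simpa [b2, mul_comm] using hb 0 1 (by simp)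
    · simpa [b2, mul_comm] using hb 1 0 (by simp)

section Vanishing

variable {k : ℕ} {V : Evec k → ℝ}

theorem IsMultiWell.exists_half_square_le (hV : IsMultiWell V) :
    ∃ η ∈ Set.Ioo (0 : ℝ) 1, ∀ {Ω : Set E2} {ε : ℕ → ℝ} {u : ℕ → E2 → Evec k} {ν ζ : Measure E2},
      IsLimit V Ω ε u ν ζ → ∀ (x₀ : E2) (r : ℝ), 0 < r → csq x₀ r ⊆ Ω →
      ν.real (csq x₀ r) ≤ η * r → ν.real (csq x₀ (r / 2)) ≤ ν.real (csq x₀ r) / 8 := by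
  obtain ⟨B, hB, hdecay⟩ := hV.exists_integral_decay
  obtain ⟨C, hC, hcut⟩ := exists_squareCutoff
  have hpos : 0 < 2 + 16 * B * C := by positivity
  refine ⟨1 / (2 + 16 * B * C), ⟨by positivity, ?_⟩, fun {Ω ε u ν ζ} h x₀ r hr hsub hη => ?_⟩
  · rw [div_lt_one hpos]
    have : 0 ≤ 16 * B * C := by positivity
    linarith
  have := h.finite
  obtain ⟨χ, hχ, hχ0, hχ1, hχd⟩ := hcut x₀ r hr
  set N := ν.real (csq x₀ r) with hN
  have hN0 : 0 ≤ N := measureReal_nonneg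
  rw [one_div, ← div_eq_inv_mul, le_div_iff₀ hpos] at hη
  have hBC : 0 ≤ B * C := by positivity
  have hlt : N < r := by nlinarith
  have hd (j : Fin 2) : ∫ x, |pd χ j x| ∂ν ≤ C / r * N := by
    rw [hN, ← integral_indicator_one (isClosed_csq x₀ r).measurableSet, ← integral_const_mul]
    refine integral_mono ((hχ.pd_test j).abs.integrable ν)
      (((integrable_const 1).indicator (isClosed_csq x₀ r).measurableSet).const_mul _) fun x => ?_
    by_cases hx : x ∈ csq x₀ r
    · simpa [hx] using hχd j x
    · have : pd χ j x = 0 := image_eq_zero_of_notMem_tsupport fun hx' =>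
        hx (csq_mono (by linarith) (osq_subset_csq _ _ ((hχ.pd_test j).2.2 hx')))
      simp [hx, this]
  calc ν.real (csq x₀ (r / 2)) ≤ ∫ x, χ x ∂ν :=
      measureReal_le_integral (hχ.test.integrable ν) (isClosed_csq _ _).measurableSet
        (fun x hx => (hχ1 x hx).ge) hχ0
    _ ≤ B * N * ∑ j, ∫ x, |pd χ j x| ∂ν := hdecay h x₀ r χ hr hsub hlt hχ hχ0
    _ ≤ B * N * (2 * (C / r * N)) := by
      refine mul_le_mul_of_nonneg_left ?_ (by positivity)
      rw [Fin.sum_univ_two]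
      linarith [hd 0, hd 1]
    _ = N * (2 * (B * C) * N / r) := by ring
    _ ≤ N * (1 / 8) := by
      refine mul_le_mul_of_nonneg_left ?_ hN0
      rw [div_le_div_iff₀ hr (by norm_num)]
      linarith
    _ = N / 8 := by ring

theorem exists_quarter {x y : E2} {s : ℝ} (hy : y ∈ csq x s) :
    ∃ p : Bool × Bool, y ∈ csq (x + !₂[if p.1 then s / 2 else -(s / 2),
      if p.2 then s / 2 else -(s / 2)]) (s / 2) := by
  refine ⟨(decide (x 0 ≤ y 0), decide (x 1 ≤ y 1)), Fin.forall_fin_two.2 ⟨?_, ?_⟩⟩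
  · have := abs_le.1 (hy 0)
    by_cases h : x 0 ≤ y 0
    · simp only [h, decide_true, if_true, PiLp.add_apply]
      simp only [Matrix.cons_val_zero]
      exact abs_le.2 ⟨by linarith, by linarith⟩
    · simp only [h, decide_false, PiLp.add_apply]
      simp only [Matrix.cons_val_zero, Bool.false_eq_true, if_false]
      exact abs_le.2 ⟨by linarith, by linarith⟩
  · have := abs_le.1 (hy 1)
    by_cases h : x 1 ≤ y 1
    · simp only [h, decide_true, if_true, PiLp.add_apply]
      simp only [Matrix.cons_val_one, Matrix.cons_val_fin_one]
      exact abs_le.2 ⟨by linarith, by linarith⟩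
    · simp only [h, decide_false, PiLp.add_apply]
      simp only [Matrix.cons_val_one, Matrix.cons_val_fin_one,
        Bool.false_eq_true, if_false]
      exact abs_le.2 ⟨by linarith, by linarith⟩

theorem quarter_subset {x : E2} {s : ℝ} (hs : 0 ≤ s) (p : Bool × Bool) :
    csq (x + !₂[if p.1 then s / 2 else -(s / 2), if p.2 then s / 2 else -(s / 2)]) (s / 2)
      ⊆ csq x s := by
  have h2 : |s / 2| = s / 2 := abs_of_nonneg (by linarith)
  refine csq_subset_csq (Fin.forall_fin_two.2 ⟨?_, ?_⟩)
  · rcases p with ⟨p, q⟩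
    cases p <;> simp [h2]
  · rcases p with ⟨p, q⟩
    cases q <;> simp [h2]

/-- A measure decaying fast enough on dyadic squares vanishes. -/
theorem measureReal_csq_le_of_decay {ν : Measure E2} [IsFiniteMeasure ν] {Ω : Set E2} {η : ℝ}
    (hd : ∀ (x₀ : E2) (r : ℝ), 0 < r → csq x₀ r ⊆ Ω →
      ν.real (csq x₀ r) ≤ η * r → ν.real (csq x₀ (r / 2)) ≤ ν.real (csq x₀ r) / 8) (n : ℕ) :
    ∀ (x : E2) (s η' : ℝ), 0 < s → η' ≤ η →
      (∀ z ∈ csq x s, csq z s ⊆ Ω ∧ ν.real (csq z s) ≤ η' * s) →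
      ν.real (csq x s) ≤ η' * s / 2 ^ n := by
  induction n with
  | zero =>
    intro x s η' hs _ h
    simpa using (h x fun i => by simpa using hs.le).2
  | succ n ih =>
    intro x s η' hs hη h
    have h0 : 0 ≤ η' * s :=
      measureReal_nonneg.trans (h x fun i => by simpa using hs.le).2
    have hη0 : 0 ≤ η' := nonneg_of_mul_nonneg_left h0 hs
    set c : Bool × Bool → E2 := fun p =>
      x + !₂[if p.1 then s / 2 else -(s / 2), if p.2 then s / 2 else -(s / 2)] with hc
    have hcov : csq x s ⊆ ⋃ p, csq (c p) (s / 2) := fun y hy =>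
      Set.mem_iUnion.2 (exists_quarter hy)
    have hq (p : Bool × Bool) : ν.real (csq (c p) (s / 2)) ≤ η' / 4 * (s / 2) / 2 ^ n := by
      refine ih (c p) (s / 2) (η' / 4) (by positivity) (by linarith) fun z hz => ?_
      obtain ⟨h1, h2⟩ := h z (quarter_subset hs.le p hz)
      refine ⟨(csq_mono (by linarith)).trans h1, ?_⟩
      have h3 := hd z s hs h1 (h2.trans (mul_le_mul_of_nonneg_right hη hs.le))
      linarith
    calc ν.real (csq x s) ≤ ν.real (⋃ p, csq (c p) (s / 2)) := measureReal_mono hcov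
      _ ≤ ∑ p, ν.real (csq (c p) (s / 2)) := measureReal_iUnion_fintype_le _
      _ ≤ ∑ _p : Bool × Bool, η' / 4 * (s / 2) / 2 ^ n := Finset.sum_le_sum fun p _ => hq p
      _ = η' * s / 2 ^ (n + 1) := by
        rw [Finset.sum_const, Finset.card_univ]
        simp only [Fintype.card_prod, Fintype.card_bool, nsmul_eq_mul]
        push_cast
        rw [pow_succ]
        ring

/-- The clearing-out property of the limiting energy measure. -/
theorem IsMultiWell.exists_clearing_out (hV : IsMultiWell V) :
    ∃ c > (0 : ℝ), ∀ {Ω : Set E2} {ε : ℕ → ℝ} {u : ℕ → E2 → Evec k} {ν ζ : Measure E2},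
      IsLimit V Ω ε u ν ζ → ∀ (x : E2) (ρ : ℝ), 0 < ρ → closedBall x ρ ⊆ Ω →
      ν.real (closedBall x ρ) < c * ρ → ν (closedBall x (ρ / 4)) = 0 := by
  obtain ⟨η, hη, hd⟩ := hV.exists_half_square_le
  refine ⟨η / 4, div_pos hη.1 four_pos, fun {Ω ε u ν ζ} h x ρ hρ hsub hlt => ?_⟩
  have := h.finite
  have hcs : csq x (ρ / 2) ⊆ closedBall x ρ := by
    simpa [mul_div_cancel₀] using csq_subset_closedBall (x := x) (r := ρ / 2)
  have hz : ∀ z ∈ csq x (ρ / 4), csq z (ρ / 4) ⊆ csq x (ρ / 2) := fun z hz =>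
    csq_subset_csq fun i => by linarith [hz i]
  have key (n : ℕ) := measureReal_csq_le_of_decay (hd h) n x (ρ / 4) η (by positivity) le_rfl
    fun z hz' => ⟨(hz z hz').trans (hcs.trans hsub),
      (measureReal_mono ((hz z hz').trans hcs)).trans (hlt.le.trans (by linarith))⟩
  have hlim : Tendsto (fun n : ℕ => η * (ρ / 4) / 2 ^ n) atTop (𝓝 0) := by
    have := (tendsto_pow_atTop_nhds_zero_of_lt_one (r := (1 / 2 : ℝ)) (by norm_num)
      (by norm_num)).const_mul (η * (ρ / 4))
    simpa [div_eq_mul_inv] using this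
  have h0 : ν.real (csq x (ρ / 4)) = 0 :=
    le_antisymm (ge_of_tendsto' hlim key) measureReal_nonneg
  exact measure_mono_null (closedBall_subset_csq x _) ((measureReal_eq_zero_iff).1 h0)

end Vanishing

/-- A smooth Urysohn lemma in the plane. -/
theorem exists_c1Test_eq_one {K U : Set E2} (hK : IsCompact K) (hU : IsOpen U) (hKU : K ⊆ U) :
    ∃ θ, C1Test U θ ∧ (∀ x ∈ K, θ x = 1) ∧ ∀ x, 0 ≤ θ x ∧ θ x ≤ 1 := by
  obtain ⟨L, hL, hLc, hKL, hLU⟩ := exists_compact_closed_between hK hU hKU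
  obtain ⟨f, hf0, hf1, hf⟩ := exists_contMDiffMap_zero_one_of_isClosed
    (modelWithCornersSelf ℝ E2) (n := 1) isOpen_interior.isClosed_compl hK.isClosed
    (Set.disjoint_compl_left_iff_subset.2 hKL)
  have hts : tsupport f ⊆ L := by
    refine closure_minimal (fun x hx => ?_) hLc
    by_contra h
    exact hx (hf0 fun h' => h (interior_subset h'))
  exact ⟨f, ⟨f.contMDiff.contDiff, hL.of_isClosed_subset (isClosed_tsupport _) hts,
    hts.trans hLU⟩, hf1, hf⟩

/-- Comparison of measures tested against nonnegative test functions. -/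
theorem restrict_le_smul_of_integral_le {U : Set E2} (hU : IsOpen U) {μ₁ μ₂ : Measure E2}
    [IsFiniteMeasureOnCompacts μ₁] [IsFiniteMeasure μ₂] {C : ℝ} (hC : 0 ≤ C)
    (h : ∀ f, C1Test U f → (∀ x, 0 ≤ f x) → ∫ x, f x ∂μ₁ ≤ C * ∫ x, f x ∂μ₂) :
    μ₁.restrict U ≤ ENNReal.ofReal C • μ₂ := by
  have hopen (O : Set E2) (hO : IsOpen O) : μ₁ (O ∩ U) ≤ ENNReal.ofReal C * μ₂ O := by
    rw [(hO.inter hU).measure_eq_iSup_isCompact]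
    refine iSup₂_le fun K hKO => iSup_le fun hK => ?_
    obtain ⟨θ, hθ, hθ1, hθ01⟩ := exists_c1Test_eq_one hK (hO.inter hU) hKO
    calc μ₁ K = ∫⁻ x, K.indicator 1 x ∂μ₁ := (lintegral_indicator_one hK.measurableSet).symm
      _ ≤ ∫⁻ x, ENNReal.ofReal (θ x) ∂μ₁ := by
        refine lintegral_mono fun x => ?_
        by_cases hx : x ∈ K
        · simp [hx, hθ1 x hx]
        · simp [hx]
      _ = ENNReal.ofReal (∫ x, θ x ∂μ₁) :=
        (ofReal_integral_eq_lintegral_ofReal (hθ.test.integrable _)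
          (ae_of_all _ fun x => (hθ01 x).1)).symm
      _ ≤ ENNReal.ofReal (C * μ₂.real O) := by
        refine ENNReal.ofReal_le_ofReal ((h θ (hθ.mono Set.inter_subset_right)
          fun x => (hθ01 x).1).trans ?_)
        gcongr
        exact (hθ.test.mono Set.inter_subset_left).integral_le_measureReal hθ01 hO.measurableSet
      _ = ENNReal.ofReal C * μ₂ O := by
        rw [ENNReal.ofReal_mul hC, ofReal_measureReal]
  refine Measure.le_iff.2 fun A hA => ?_
  rw [Measure.restrict_apply hA, Measure.smul_apply, smul_eq_mul]
  refine ENNReal.le_of_forall_pos_le_add fun δ hδ _ => ?_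
  have hδ' : (0 : ℝ≥0∞) < δ / (ENNReal.ofReal C + 1) := by
    refine ENNReal.div_pos (by simpa using hδ.ne') (by finiteness)
  obtain ⟨O, hAO, hO, hlt⟩ := A.exists_isOpen_lt_add (measure_ne_top μ₂ A) hδ'.ne'
  calc μ₁ (A ∩ U) ≤ μ₁ (O ∩ U) := by gcongr
    _ ≤ ENNReal.ofReal C * μ₂ O := hopen O hO
    _ ≤ ENNReal.ofReal C * (μ₂ A + δ / (ENNReal.ofReal C + 1)) := by gcongr
    _ ≤ ENNReal.ofReal C * μ₂ A + δ := by
      rw [mul_add]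
      gcongr
      calc ENNReal.ofReal C * (δ / (ENNReal.ofReal C + 1))
          ≤ (ENNReal.ofReal C + 1) * (δ / (ENNReal.ofReal C + 1)) := by gcongr; simp
        _ ≤ δ := ENNReal.mul_div_le

/-- A function is determined almost everywhere by its integrals against test functions. -/
theorem ae_eq_of_integral_c1Test {Ω : Set E2} (hΩ : IsOpen Ω) {ν : Measure E2} [IsFiniteMeasure ν]
    (hν : ν Ωᶜ = 0) {f g : E2 → ℝ} (hf : Integrable f ν) (hg : Integrable g ν)
    (h : ∀ χ, C1Test Ω χ → ∫ x, χ x * f x ∂ν = ∫ x, χ x * g x ∂ν) : f =ᵐ[ν] g := by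
  have hi {f : E2 → ℝ} (hf : Integrable f ν) {χ : E2 → ℝ} (hχ : C1Test Ω χ) :
      Integrable (fun x => χ x * f x) ν := by
    obtain ⟨C, hC⟩ := hχ.2.1.exists_bound_of_continuous hχ.1.continuous
    exact hf.bdd_mul hχ.1.continuous.aestronglyMeasurable (ae_of_all _ hC)
  have h0 := hΩ.ae_eq_zero_of_integral_contDiff_smul_eq_zero (f := fun x => f x - g x) (μ := ν)
    ((hf.sub hg).locallyIntegrable.locallyIntegrableOn Ω) fun χ hχ hχc hχΩ => by
    have hχ' : C1Test Ω χ := ⟨hχ.of_le (by norm_cast), hχc, hχΩ⟩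
    have hfi := hi hf hχ'
    have hgi := hi hg hχ'
    simp only [smul_eq_mul, mul_sub]
    rw [integral_sub hfi hgi, h χ hχ', sub_self]
  have hΩ' : ∀ᵐ x ∂ν, x ∈ Ω := 
    (measure_eq_zero_iff_ae_notMem.1 hν).mono fun x hx => by simpa using hx
  filter_upwards [h0, hΩ'] with x hx hxΩ
  linarith [hx hxΩ]

/-- Densities of measures that are dominated by a multiple of a finite measure. -/
theorem exists_bounded_density {μ ν : Measure E2} [IsFiniteMeasure ν] {C : ℝ} (hC : 0 ≤ C)
    (h : μ ≤ ENNReal.ofReal C • ν) :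
    ∃ g : E2 → ℝ, Measurable g ∧ (∀ x, 0 ≤ g x ∧ g x ≤ C) ∧
      μ = ν.withDensity fun x => ENNReal.ofReal (g x) := by
  have : IsFiniteMeasure (ENNReal.ofReal C • ν) := ν.smul_finite ENNReal.ofReal_ne_top
  have : IsFiniteMeasure μ := isFiniteMeasure_of_le _ h
  have := Measure.haveLebesgueDecomposition_of_sigmaFinite μ ν
  have hac : μ ≪ ν := (Measure.absolutelyContinuous_of_le h).trans
    (Measure.AbsolutelyContinuous.rfl.smul_left _)
  have hle : μ.rnDeriv ν ≤ᵐ[ν] fun _ => ENNReal.ofReal C := by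
    refine ae_le_of_forall_setLIntegral_le_of_sigmaFinite (Measure.measurable_rnDeriv _ _)
      fun s _ _ => ?_
    refine (Measure.setLIntegral_rnDeriv_le s).trans ((h s).trans ?_)
    simp
  refine ⟨fun x => min (μ.rnDeriv ν x).toReal C,
    (Measure.measurable_rnDeriv _ _).ennreal_toReal.min measurable_const,
    fun x => ⟨le_min ENNReal.toReal_nonneg hC, min_le_right _ _⟩, ?_⟩
  refine (Measure.withDensity_rnDeriv_eq μ ν hac).symm.trans (withDensity_congr_ae ?_)
  filter_upwards [hle] with x hx
  rw [min_eq_left (ENNReal.toReal_le_of_le_ofReal hC hx),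
    ENNReal.ofReal_toReal (ne_top_of_le_ne_top ENNReal.ofReal_ne_top hx)]

theorem integral_withDensity_ofReal {ν : Measure E2} {g : E2 → ℝ} (hg : Measurable g)
    (hg0 : ∀ x, 0 ≤ g x) (f : E2 → ℝ) :
    ∫ x, f x ∂(ν.withDensity fun x => ENNReal.ofReal (g x)) = ∫ x, f x * g x ∂ν := by
  rw [integral_withDensity_eq_integral_toReal_smul hg.ennreal_ofReal (by simp)]
  simp [hg0, mul_comm]

theorem TestFun.integrable_mul_of_bounded {Ω : Set E2} {f g : E2 → ℝ} (hf : TestFun Ω f)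
    {μ : Measure E2} [IsFiniteMeasureOnCompacts μ] (hg : Measurable g) {C : ℝ}
    (hC : ∀ x, |g x| ≤ C) : Integrable (fun x => f x * g x) μ :=
  (hf.integrable μ).mul_bdd hg.aestronglyMeasurable (ae_of_all _ hC)

open scoped CompactlySupported in
/-- Weak limits along an ultrafilter of a sequence of functions dominated by energy densities. -/
theorem exists_limit_density {Ω : Set E2} (hΩ : IsOpen Ω) {ν : Measure E2} [IsFiniteMeasure ν]
    {e T : ℕ → E2 → ℝ} (he : ∀ n, ContinuousOn (e n) Ω) (hT : ∀ n, ContinuousOn (T n) Ω)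
    (hle : ∀ n x, |T n x| ≤ e n x) (hei : ∀ n, IntegrableOn (e n) Ω) {M : ℝ}
    (heM : ∀ n, ∫ x in Ω, e n x ≤ M)
    (hlim : ∀ f, TestFun Ω f → Tendsto (fun n => ∫ x, f x * e n x) atTop (𝓝 (∫ x, f x ∂ν))) :
    ∃ a : E2 → ℝ, Measurable a ∧ (∀ x, |a x| ≤ 1) ∧ ∀ f, TestFun Ω f →
      Tendsto (fun n => ∫ x, f x * T n x) (hyperfilter ℕ : Filter ℕ) (𝓝 (∫ x, f x * a x ∂ν)) := by
  set w : ℕ → E2 → ℝ := fun n x => T n x + e n x with hw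
  have hw0 (n : ℕ) (x : E2) : 0 ≤ w n x := by linarith [neg_le_of_abs_le (hle n x)]
  have hwe (n : ℕ) (x : E2) : w n x ≤ 2 * e n x := by linarith [le_of_abs_le (hle n x)]
  have hwi (n : ℕ) : IntegrableOn (w n) Ω :=
    ((hei n).mono' ((hT n).aestronglyMeasurable hΩ.measurableSet) (ae_of_all _ (hle n))).add
      (hei n)
  have hfw (f : C_c(E2, ℝ)) (n : ℕ) : IntegrableOn (fun x => f x * w n x) Ω := by
    obtain ⟨C, hC⟩ := f.hasCompactSupport.exists_bound_of_continuous f.continuous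
    exact (hwi n).bdd_mul f.continuous.aestronglyMeasurable (ae_of_all _ hC)
  have hex (f : C_c(E2, ℝ)) : ∃ l, Tendsto (fun n => ∫ x in Ω, f x * w n x)
      (hyperfilter ℕ : Filter ℕ) (𝓝 l) := by
    obtain ⟨C, hC⟩ := f.hasCompactSupport.exists_bound_of_continuous f.continuous
    have hC0 : 0 ≤ C := (norm_nonneg _).trans (hC (0 : E2))
    have hb (n : ℕ) : |∫ x in Ω, f x * w n x| ≤ C * (2 * M) := by
      calc |∫ x in Ω, f x * w n x| ≤ ∫ x in Ω, C * (2 * e n x) := by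
            refine norm_integral_le_of_norm_le (f := fun x => f x * w n x)
              (((hei n).const_mul 2).const_mul C)
              (ae_of_all _ fun x => ?_)
            rw [norm_mul, Real.norm_of_nonneg (hw0 n x)]
            exact mul_le_mul (hC x) (hwe n x) (hw0 n x) hC0
        _ ≤ C * (2 * M) := by
            rw [integral_const_mul, integral_const_mul]
            gcongr
            exact heM n
    obtain ⟨l, -, hl⟩ := (isCompact_Icc (a := -(C * (2 * M))) (b := C * (2 * M))
      ).ultrafilter_le_nhds
      ((hyperfilter ℕ).map fun n => ∫ x in Ω, f x * w n x)
      (le_principal_iff.2 (Filter.mem_map.2 (Eventually.of_forall fun n => abs_le.1 (hb n))))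
    exact ⟨l, hl⟩
  choose L hL using hex
  let Λ₀ : C_c(E2, ℝ) →ₗ[ℝ] ℝ :=
    { toFun := L
      map_add' := fun f g => by
        refine tendsto_nhds_unique (hL (f + g)) (((hL f).add (hL g)).congr fun n => ?_)
        rw [← integral_add (hfw f n) (hfw g n)]
        simp [add_mul]
      map_smul' := fun c f => by
        refine tendsto_nhds_unique (hL (c • f)) (((hL f).const_mul c).congr fun n => ?_)
        rw [← integral_const_mul]
        simp [mul_assoc] }
  let Λ : C_c(E2, ℝ) →ₚ[ℝ] ℝ := PositiveLinearMap.mk₀ Λ₀ fun f hf =>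
    ge_of_tendsto' (hL f) fun n => integral_nonneg fun x => mul_nonneg (hf x) (hw0 n x)
  set μ := RealRMK.rieszMeasure Λ with hμ
  have hΛ {f : E2 → ℝ} (hf : TestFun Ω f) : Tendsto (fun n => ∫ x, f x * w n x)
      (hyperfilter ℕ : Filter ℕ) (𝓝 (∫ x, f x ∂μ)) := by
    have h1 := RealRMK.integral_rieszMeasure Λ ⟨⟨f, hf.1⟩, hf.2.1⟩
    have h2 := hL ⟨⟨f, hf.1⟩, hf.2.1⟩
    change Tendsto (fun n => ∫ x in Ω, f x * w n x) _ _ at h2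
    simp only [hf.setIntegral_mul] at h2
    have h3 : ∫ x, f x ∂μ = L ⟨⟨f, hf.1⟩, hf.2.1⟩ := h1
    rwa [h3]
  have hlim' {f : E2 → ℝ} (hf : TestFun Ω f) := (hlim f hf).mono_left Nat.hyperfilter_le_atTop
  have hle2 : μ.restrict Ω ≤ ENNReal.ofReal 2 • ν := by
    refine restrict_le_smul_of_integral_le hΩ (by norm_num) fun f hf hf0 => ?_
    refine le_of_tendsto_of_tendsto' (hΛ hf.test) ((hlim' hf.test).const_mul 2) fun n => ?_
    rw [← integral_const_mul]
    refine integral_mono (hf.test.integrable_mul hΩ ((hT n).add (he n)) _)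
      ((hf.test.integrable_mul hΩ (he n) _).const_mul 2) fun x => ?_
    have := mul_le_mul_of_nonneg_left (hwe n x) (hf0 x)
    simp only
    linarith
  obtain ⟨g, hgm, hg, hμg⟩ := exists_bounded_density (by norm_num) hle2
  refine ⟨fun x => g x - 1, hgm.sub_const 1, fun x => abs_le.2 ⟨by linarith [hg x],
    by linarith [hg x]⟩, fun f hf => ?_⟩
  have hfg : ∫ x, f x ∂μ = ∫ x, f x * g x ∂ν := by
    rw [← integral_withDensity_ofReal hgm (fun x => (hg x).1), ← hμg]
    simpa using (hf.setIntegral_mul (fun _ => 1) μ).symm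
  have hlimT := (hΛ hf).sub (hlim' hf)
  rw [hfg, ← integral_sub (hf.integrable_mul_of_bounded (C := 2) hgm fun x => by
    rw [abs_of_nonneg (hg x).1]; exact (hg x).2) (hf.integrable ν)] at hlimT
  simp only [mul_sub, mul_one]
  refine hlimT.congr fun n => ?_
  rw [← integral_sub (hf.integrable_mul hΩ (g := w n) ((hT n).add (he n)) _)
    (hf.integrable_mul hΩ (he n) _)]
  simp [hw, mul_add]

/-- A divergence-free symmetric tensor with measurable coefficients with respect to `ν`, with
trace twice the density of `ζ`. -/
structure StressLimit (Ω : Set E2) (ν ζ : Measure E2) (a : Fin 2 → Fin 2 → E2 → ℝ)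
    (z : E2 → ℝ) : Prop where
  isOpen : IsOpen Ω
  finite : IsFiniteMeasure ν
  compl : ν Ωᶜ = 0
  measurable : ∀ i j, Measurable (a i j)
  abs_le_one : ∀ i j x, |a i j x| ≤ 1
  symm : ∀ i j, a i j = a j i
  div : ∀ χ, C1Test Ω χ → ∀ i, ∑ j, ∫ x, pd χ j x * a i j x ∂ν = 0
  measurable_z : Measurable z
  z_nonneg : ∀ x, 0 ≤ z x
  z_le : ∀ x, z x ≤ 1
  withDensity : ζ = ν.withDensity fun x => ENNReal.ofReal (z x)
  trace : ∀ᵐ x ∂ν, a 0 0 x + a 1 1 x = 2 * z x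

theorem IsLimit.exists_stressLimit {k : ℕ} {V : Evec k → ℝ} {Ω : Set E2} {ε : ℕ → ℝ}
    {u : ℕ → E2 → Evec k} {ν ζ : Measure E2} (hV : IsMultiWell V) (h : IsLimit V Ω ε u ν ζ)
    (hi : ∀ n, IntegrableOn (eDens V (ε n) (u n)) Ω) {M : ℝ}
    (hM : ∀ n, energy V (ε n) (u n) Ω ≤ M) : ∃ a z, StressLimit Ω ν ζ a z := by
  have := h.finite
  have := h.finite'
  have hΩ := h.isOpen
  have hsm (n : ℕ) := (h.sol n).1
  have hec (n : ℕ) := (contDiffOn_eDens (ε := ε n) hΩ hV.smooth (hsm n)).continuousOn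
  have hsc (i j : Fin 2) (n : ℕ) :=
    (contDiffOn_stress (ε := ε n) hΩ hV.smooth (hsm n) i j).continuousOn
  choose a ham ha1 ha using fun i j => exists_limit_density hΩ hec (hsc i j)
    (fun n x => abs_stress_le hV.nonneg (h.eps_pos n) (u n) i j x) hi hM h.tendsto
  have hpot (n : ℕ) : ContinuousOn (fun x => (ε n)⁻¹ * V (u n x)) Ω :=
    continuousOn_const.mul (hV.smooth.continuous.comp_continuousOn (hsm n).continuousOn)
  have hζν : ζ ≤ ENNReal.ofReal 1 • ν := by
    have h1 : ζ.restrict Ω = ζ := Measure.restrict_eq_self_of_ae_mem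
      ((measure_eq_zero_iff_ae_notMem.1 h.compl').mono fun x hx => by simpa using hx)
    rw [← h1]
    refine restrict_le_smul_of_integral_le hΩ zero_le_one fun f hf hf0 => ?_
    rw [one_mul]
    refine le_of_tendsto_of_tendsto' (h.tendsto' f hf.test) (h.tendsto f hf.test) fun n =>
      integral_mono (hf.test.integrable_mul hΩ (hpot n) _)
        (hf.test.integrable_mul hΩ (hec n) _) fun x =>
        mul_le_mul_of_nonneg_left (potential_le_eDens V (h.eps_pos n) (u n) x) (hf0 x)
  obtain ⟨z, hzm, hz, hζ⟩ := exists_bounded_density zero_le_one hζν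
  have ha' (i j : Fin 2) {f : E2 → ℝ} (hf : TestFun Ω f) :
      Tendsto (fun n => ∫ x, f x * stress V (ε n) (u n) i j x) (hyperfilter ℕ : Filter ℕ)
        (𝓝 (∫ x, f x * a (min i j) (max i j) x ∂ν)) := by
    rcases le_total i j with hij | hij
    · simpa only [min_eq_left hij, max_eq_right hij] using ha i j f hf
    · simpa only [min_eq_right hij, max_eq_left hij, stress_comm V _ _ i j] using ha j i f hf
  refine ⟨fun i j => a (min i j) (max i j), z, hΩ, h.finite, h.compl, fun i j => ham _ _,
    fun i j => ha1 _ _, fun i j => ?_, fun χ hχ i => ?_, hzm, fun x => (hz x).1,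
    fun x => (hz x).2, hζ, ?_⟩
  · simp only [min_comm i j, max_comm i j]
  · have h1 := tendsto_finsetSum Finset.univ fun j _ => ha' i j (hχ.pd_test j)
    have h2 (n : ℕ) := integral_stress_pd hΩ hV.smooth (h.eps_pos n) (h.sol n) hχ i
    simp only [h2] at h1
    exact tendsto_nhds_unique h1 tendsto_const_nhds
  · have hint {g : E2 → ℝ} (hg : Measurable g) (hg1 : ∀ x, |g x| ≤ 1) : Integrable g ν :=
      Integrable.of_bound hg.aestronglyMeasurable 1 (ae_of_all _ hg1)
    have hz1 (x : E2) : |z x| ≤ 1 := by rw [abs_of_nonneg (hz x).1]; exact (hz x).2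
    refine ae_eq_of_integral_c1Test hΩ h.compl
      ((hint (ham 0 0) (ha1 0 0)).add (hint (ham 1 1) (ha1 1 1)))
      ((hint hzm hz1).const_mul 2) fun χ hχ => ?_
    have h0 := (ha 0 0 χ hχ.test).add (ha 1 1 χ hχ.test)
    have h1 := ((h.tendsto' χ hχ.test).const_mul 2).mono_left Nat.hyperfilter_le_atTop
    have h2 := tendsto_nhds_unique (h0.congr fun n => ?_) h1
    · rw [hζ, integral_withDensity_ofReal hzm fun x => (hz x).1, ← integral_const_mul,
        ← integral_add (hχ.test.integrable_mul_of_bounded (ham 0 0) (ha1 0 0))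
          (hχ.test.integrable_mul_of_bounded (ham 1 1) (ha1 1 1))] at h2
      refine (integral_congr_ae (ae_of_all _ fun x => ?_)).trans
        (h2.trans (integral_congr_ae (ae_of_all _ fun x => ?_)))
      · exact mul_add _ _ _
      · ring
    · rw [← integral_add (hχ.test.integrable_mul hΩ (hsc 0 0 n) _)
        (hχ.test.integrable_mul hΩ (hsc 1 1 n) _), ← integral_const_mul]
      refine integral_congr_ae (ae_of_all _ fun x => ?_)
      simp only [← mul_add, stress_trace]
      ring

section StressLimit

variable {Ω : Set E2} {ν ζ : Measure E2} {a : Fin 2 → Fin 2 → E2 → ℝ} {z : E2 → ℝ}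

theorem StressLimit.integrable_mul (h : StressLimit Ω ν ζ a z) {f : E2 → ℝ} (hf : Integrable f ν)
    (i j : Fin 2) : Integrable (fun x => f x * a i j x) ν :=
  hf.mul_bdd (h.measurable i j).aestronglyMeasurable (ae_of_all _ (h.abs_le_one i j))

/-- The divergence identity for test functions `f (x i) * χ x`. -/
theorem StressLimit.abs_integral_coord_le (h : StressLimit Ω ν ζ a z) {φ : ℝ → ℝ}
    (hφ : Continuous φ) (h0 : ∀ s, 0 ≤ φ s) (hφi : Integrable φ) {χ : E2 → ℝ} (hχ : C1Test Ω χ)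
    (i : Fin 2) :
    |∫ x, φ (x i) * χ x * a i i x ∂ν| ≤ (∫ s, φ s) * ∑ j, ∫ x, |pd χ j x| ∂ν := by
  have := h.finite
  obtain ⟨f, hf, hfd, hfb⟩ := exists_primitive_bounded hφ h0 (fun _ => le_rfl) hφi
  have hfx : ContDiff ℝ 1 fun x : E2 => f (x i) := hf.comp (by fun_prop)
  have hdiv := h.div _ (hχ.mul_left hfx) i
  have hpd (j : Fin 2) (x : E2) : pd (fun y : E2 => f (y i) * χ y) j x * a i j x
      = f (x i) * pd χ j x * a i j x + b2 j i * (φ (x i) * χ x * a i j x) := by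
    rw [pd_mul (hfx.differentiable (by simp) x) (hχ.1.differentiable (by simp) x),
      pd_coord (hf.differentiable (by simp)), (hfd _).deriv]
    ring
  have hcx : Continuous fun x : E2 => f (x i) := hfx.continuous
  have i1 (j : Fin 2) : Integrable (fun x => f (x i) * pd χ j x * a i j x) ν :=
    h.integrable_mul (((hχ.pd_test j).mul_continuousOn h.isOpen (g := fun x => f (x i))
      hcx.continuousOn).integrable ν |>.congr (ae_of_all _ fun x => mul_comm _ _)) i j
  have i2 (j : Fin 2) : Integrable (fun x => φ (x i) * χ x * a i j x) ν :=
    h.integrable_mul ((hχ.test.mul_continuousOn h.isOpen (g := fun x => φ (x i))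
      (by fun_prop)).integrable ν |>.congr (ae_of_all _ fun x => mul_comm _ _)) i j
  have hsum : ∫ x, φ (x i) * χ x * a i i x ∂ν
      = -∑ j, ∫ x, f (x i) * pd χ j x * a i j x ∂ν := by
    simp only [hpd] at hdiv
    rw [Finset.sum_congr rfl fun j _ => integral_add (i1 j) ((i2 j).const_mul _),
      Finset.sum_add_distrib] at hdiv
    simp only [integral_const_mul] at hdiv
    have hb : ∑ j, b2 j i * ∫ x, φ (x i) * χ x * a i j x ∂ν
        = ∫ x, φ (x i) * χ x * a i i x ∂ν := by
      rw [Finset.sum_eq_single i (fun j _ hj => by simp [b2, hj.symm]) (by simp)]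
      simp [b2]
    linarith
  rw [hsum, abs_neg, Finset.mul_sum]
  refine (Finset.abs_sum_le_sum_abs _ _).trans (Finset.sum_le_sum fun j _ => ?_)
  rw [← integral_const_mul]
  refine norm_integral_le_of_norm_le (f := fun x => f (x i) * pd χ j x * a i j x)
      ((hχ.pd_test j).abs.integrable ν |>.const_mul _)
    (ae_of_all _ fun x => ?_)
  rw [norm_mul, norm_mul]
  refine (mul_le_of_le_one_right (by positivity) (h.abs_le_one i j x)).trans ?_
  exact mul_le_mul_of_nonneg_right (hfb _) (abs_nonneg _)

theorem StressLimit.ae_diag_eq_zero (h : StressLimit Ω ν ζ a z) {P : Set ℝ} (hP : IsCompact P)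
    (hP0 : volume P = 0) (i : Fin 2) : ∀ᵐ x ∂ν, x i ∈ P → a i i x = 0 := by
  have := h.finite
  have hmi : Measurable fun x : E2 => x i := by fun_prop
  have hPi : MeasurableSet {x : E2 | x i ∈ P} := hmi hP.measurableSet
  have hint : Integrable ({x : E2 | x i ∈ P}.indicator (a i i)) ν :=
    (Integrable.of_bound (h.measurable i i).aestronglyMeasurable 1
      (ae_of_all _ (h.abs_le_one i i))).indicator hPi
  have key : {x : E2 | x i ∈ P}.indicator (a i i) =ᵐ[ν] fun _ => 0 := by
    refine ae_eq_of_integral_c1Test h.isOpen h.compl hint (integrable_const 0) fun χ hχ => ?_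
    simp only [mul_zero, integral_zero]
    obtain ⟨C, hC⟩ := hχ.2.1.exists_bound_of_continuous hχ.1.continuous
    have hC0 : 0 ≤ C := (norm_nonneg _).trans (hC 0)
    set D := ∑ j, ∫ x, |pd χ j x| ∂ν with hD
    have hD0 : 0 ≤ D := Finset.sum_nonneg fun j _ => integral_nonneg fun x => abs_nonneg _
    have hbound : ∀ δ : ℝ, 0 < δ →
        |∫ x, χ x * {x : E2 | x i ∈ P}.indicator (a i i) x ∂ν| ≤ δ * (D + C) := by
      intro δ hδ
      set m : Measure ℝ := volume + ν.map fun x => x i with hm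
      have : IsFiniteMeasure (ν.map fun x => x i) := Measure.isFiniteMeasure_map ν _
      have : IsLocallyFiniteMeasure m := ⟨fun s => by
        obtain ⟨W, hW, hlt⟩ := (volume : Measure ℝ).finiteAt_nhds s
        exact ⟨W, hW, ENNReal.add_lt_top.2 ⟨hlt, measure_lt_top _ _⟩⟩⟩
      have hmP : m P ≠ ∞ := by
        rw [hm, Measure.add_apply, hP0, zero_add]
        exact measure_ne_top _ _
      obtain ⟨U, hPU, hU, hlt⟩ := P.exists_isOpen_lt_add (μ := m) hmP
        (ENNReal.ofReal_pos.2 hδ).ne'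
      have hdiff : m (U \ P) ≤ ENNReal.ofReal δ := by
        rw [measure_sdiff hPU hP.measurableSet.nullMeasurableSet hmP]
        exact tsub_le_iff_left.2 hlt.le
      have hvU : volume U ≤ ENNReal.ofReal δ := by
        rw [← measure_sdiff_null hP0]
        exact (Measure.le_add_right le_rfl (U \ P)).trans hdiff
      have hνU : ν {x : E2 | x i ∈ U \ P} ≤ ENNReal.ofReal δ := by
        have : ν {x : E2 | x i ∈ U \ P} = (ν.map fun x => x i) (U \ P) :=
          (Measure.map_apply hmi (hU.measurableSet.diff hP.measurableSet)).symm
        rw [this]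
        exact (Measure.le_add_left le_rfl (U \ P)).trans hdiff
      obtain ⟨φ, hφ1, hφ0, hφc, hφ01⟩ := exists_continuous_one_zero_of_isCompact hP
        hU.isClosed_compl (Set.disjoint_compl_right_iff_subset.2 hPU)
      have hφi : Integrable φ := φ.continuous.integrable_of_hasCompactSupport hφc
      have hφδ : ∫ s, φ s ≤ δ := by
        have h1 : ∫ s, φ s ≤ ∫ s, U.indicator 1 s := by
          refine integral_mono hφi ((integrable_indicator_iff hU.measurableSet).2
            (integrableOn_const (ne_top_of_le_ne_top ENNReal.ofReal_ne_top hvU))) fun s => ?_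
          by_cases hs : s ∈ U
          · simpa [hs] using (hφ01 s).2
          · simp [hs, hφ0 hs]
        rw [integral_indicator_one hU.measurableSet] at h1
        exact h1.trans (ENNReal.toReal_le_of_le_ofReal hδ.le hvU)
      have hA := h.abs_integral_coord_le φ.continuous (fun s => (hφ01 s).1) hφi hχ i
      have i1 : Integrable (fun x => φ (x i) * χ x * a i i x) ν :=
        h.integrable_mul ((hχ.test.mul_continuousOn h.isOpen (g := fun x => φ (x i))
          (by fun_prop)).integrable ν |>.congr (ae_of_all _ fun x => mul_comm _ _)) i i
      have i2 : Integrable (fun x => χ x * {x : E2 | x i ∈ P}.indicator (a i i) x) ν :=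
        hint.bdd_mul hχ.1.continuous.aestronglyMeasurable (ae_of_all _ hC)
      have hB : |(∫ x, χ x * {x : E2 | x i ∈ P}.indicator (a i i) x ∂ν)
          - ∫ x, φ (x i) * χ x * a i i x ∂ν| ≤ C * δ := by
        rw [← integral_sub i2 i1]
        have hUP : MeasurableSet {x : E2 | x i ∈ U \ P} :=
          hmi (hU.measurableSet.diff hP.measurableSet)
        have h1 : ∫ x, {x : E2 | x i ∈ U \ P}.indicator (fun _ => C) x ∂ν ≤ C * δ := by
          rw [integral_indicator_const C hUP, smul_eq_mul, mul_comm]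
          exact mul_le_mul_of_nonneg_left (ENNReal.toReal_le_of_le_ofReal hδ.le hνU) hC0
        rw [← Real.norm_eq_abs]
        refine le_trans (norm_integral_le_of_norm_le ((integrable_const C).indicator hUP)
          (ae_of_all _ fun x => ?_)) h1
        by_cases hxP : x i ∈ P
        · simp [hxP, hφ1 hxP]
        · by_cases hxU : x i ∈ U
          · have h2 : |φ (x i)| ≤ 1 := by rw [abs_of_nonneg (hφ01 _).1]; exact (hφ01 _).2
            have h3 : |φ (x i)| * |χ x| * |a i i x| ≤ 1 * C * 1 := by
              gcongr
              exacts [hC x, h.abs_le_one i i x]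
            simpa [hxP, hxU, abs_mul] using h3
          · simp [hxP, hxU, hφ0 hxU]
      have hE : (∫ s, φ s) * D ≤ δ * D := by gcongr
      have := abs_sub_abs_le_abs_sub (∫ x, χ x * {x : E2 | x i ∈ P}.indicator (a i i) x ∂ν)
        (∫ x, φ (x i) * χ x * a i i x ∂ν)
      linarith
    have hlim : Tendsto (fun δ : ℝ => δ * (D + C)) (𝓝[>] 0) (𝓝 0) := by
      have : Tendsto (fun δ : ℝ => δ * (D + C)) (𝓝 0) (𝓝 (0 * (D + C))) :=
        Continuous.tendsto (by fun_prop) 0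
      rw [zero_mul] at this
      exact this.mono_left nhdsWithin_le_nhds
    have := ge_of_tendsto hlim (eventually_mem_nhdsWithin.mono fun δ hδ => hbound δ hδ)
    exact abs_eq_zero.1 (le_antisymm this (abs_nonneg _))
  filter_upwards [key] with x hx hxP
  simpa [hxP] using hx

theorem StressLimit.ac_hausdorff (h : StressLimit Ω ν ζ a z) (hz : ∀ᵐ x ∂ν, 0 < z x) :
    ν ≪ μH[1] := by
  have := h.finite
  refine Measure.AbsolutelyContinuous.mk fun A hA hA0 => ?_
  rw [hA.measure_eq_iSup_isCompact]
  simp only [ENNReal.iSup_eq_zero]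
  intro K hKA hK
  have hproj (i : Fin 2) : ∀ᵐ x ∂ν, x ∈ K → a i i x = 0 := by
    have hL : LipschitzWith 1 fun x : E2 => x i :=
      LipschitzWith.of_dist_le_mul fun x y => by
        simpa [Real.dist_eq] using abs_coord_sub_le_dist x y i
    have h0 : volume ((fun x : E2 => x i) '' K) = 0 := by
      rw [← hausdorffMeasure_real]
      refine le_antisymm ((hL.hausdorffMeasure_image_le zero_le_one K).trans ?_) bot_le
      simp [measure_mono_null hKA hA0]
    filter_upwards [h.ae_diag_eq_zero (hK.image hL.continuous) h0 i] with x hx hxK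
    exact hx ⟨x, hxK, rfl⟩
  rw [measure_eq_zero_iff_ae_notMem]
  filter_upwards [hproj 0, hproj 1, hz, h.trace] with x h0 h1 h2 h3 hxK
  rw [h0 hxK, h1 hxK] at h3
  linarith

end StressLimit

/-- A radial profile in the variable `q = |y|²`, equal to `q ^ (-α)` for `q ≥ 1`. -/
def radG (α : ℝ) (n : ℕ) (q : ℝ) : ℝ :=
  (1 + α * (1 - (min q 1) ^ (n + 1)) / (n + 1)) * (max q 1) ^ (-α)

/-- The derivative of `radG α n` is `-α * radW α n`. -/
def radW (α : ℝ) (n : ℕ) (q : ℝ) : ℝ := (min q 1) ^ n * (max q 1) ^ (-α - 1)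

/-- The difference of two rescaled copies of `radG α n`; it vanishes for `q ≥ ρ`. -/
def radDiff (α : ℝ) (n : ℕ) (σ ρ q : ℝ) : ℝ :=
  σ ^ (-α) * radG α n (q / σ) - ρ ^ (-α) * radG α n (q / ρ)

/-- The rescaled derivative of `radG α n`. -/
def radDer (α : ℝ) (n : ℕ) (τ q : ℝ) : ℝ := τ ^ (-α) * radW α n (q / τ) / τ

section Radial

variable {α : ℝ} {n : ℕ} {q σ ρ τ : ℝ}

theorem radG_of_le (hq : q ≤ 1) : radG α n q = 1 + α * (1 - q ^ (n + 1)) / (n + 1) := by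
  simp [radG, hq]

theorem radG_of_ge (hq : 1 ≤ q) : radG α n q = q ^ (-α) := by
  simp [radG, hq]

theorem radW_of_le (hq : q ≤ 1) : radW α n q = q ^ n := by
  simp [radW, hq]

theorem radW_of_ge (hq : 1 ≤ q) : radW α n q = q ^ (-α - 1) := by
  simp [radW, hq]

theorem continuous_radW : Continuous (radW α n) := by
  refine ((continuous_id.min continuous_const).pow n).mul
    ((continuous_id.max continuous_const).rpow_const fun q => Or.inl ?_)
  exact (zero_lt_one.trans_le (le_max_right q 1)).ne'

theorem hasDerivAt_radG (α : ℝ) (n : ℕ) (q : ℝ) :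
    HasDerivAt (radG α n) (-α * radW α n q) q := by
  have h1 : HasDerivWithinAt (radG α n) (-α * radW α n q) (Set.Iic 1) q := by
    rcases le_or_gt q 1 with hq | hq
    · have hd : HasDerivAt (fun q : ℝ => 1 + α * (1 - q ^ (n + 1)) / (n + 1))
          (-α * radW α n q) q := by
        refine ((((hasDerivAt_pow (n + 1) q).const_sub 1).const_mul α).div_const
          ((n : ℝ) + 1)).const_add 1 |>.congr_deriv ?_
        rw [radW_of_le hq]
        push_cast
        field_simp
      exact hd.hasDerivWithinAt.congr (fun y hy => radG_of_le hy) (radG_of_le hq)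
    · exact HasFDerivWithinAt.of_notMem_closure (by simpa using hq)
  have h2 : HasDerivWithinAt (radG α n) (-α * radW α n q) (Set.Ici 1) q := by
    rcases le_or_gt 1 q with hq | hq
    · have hd : HasDerivAt (fun q : ℝ => q ^ (-α)) (-α * radW α n q) q := by
        rw [radW_of_ge hq]
        exact Real.hasDerivAt_rpow_const (Or.inl (by positivity))
      exact hd.hasDerivWithinAt.congr (fun y hy => radG_of_ge hy) (radG_of_ge hq)
    · exact HasFDerivWithinAt.of_notMem_closure (by simpa using hq)
  have := h1.union h2
  rwa [Set.Iic_union_Ici, hasDerivWithinAt_univ] at this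

theorem hasDerivAt_radDiff (α : ℝ) (n : ℕ) (σ ρ q : ℝ) :
    HasDerivAt (radDiff α n σ ρ) (-α * (radDer α n σ q - radDer α n ρ q)) q := by
  have h (τ : ℝ) : HasDerivAt (fun q => τ ^ (-α) * radG α n (q / τ)) (-α * radDer α n τ q) q := by
    refine ((hasDerivAt_radG α n (q / τ)).comp q ((hasDerivAt_id' q).div_const τ)).const_mul
      (τ ^ (-α)) |>.congr_deriv ?_
    rw [radDer]
    ring
  exact ((h σ).sub (h ρ)).congr_deriv (by ring)

theorem contDiff_radDiff : ContDiff ℝ 1 (radDiff α n σ ρ) := by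
  rw [contDiff_one_iff_deriv]
  refine ⟨fun q => (hasDerivAt_radDiff α n σ ρ q).differentiableAt, ?_⟩
  rw [funext fun q => (hasDerivAt_radDiff α n σ ρ q).deriv]
  have h (τ : ℝ) : Continuous (radDer α n τ) :=
    (continuous_const.mul (continuous_radW.comp (continuous_id.div_const τ))).div_const τ
  exact continuous_const.mul ((h σ).sub (h ρ))

theorem radDiff_eq_zero (hσ : 0 < σ) (hσρ : σ ≤ ρ) (hq : ρ ≤ q) : radDiff α n σ ρ q = 0 := by
  have hρ := hσ.trans_le hσρ
  have h {τ : ℝ} (hτ : 0 < τ) (hq : τ ≤ q) : τ ^ (-α) * radG α n (q / τ) = q ^ (-α) := by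
    rw [radG_of_ge ((one_le_div hτ).2 hq), Real.div_rpow (hτ.le.trans hq) hτ.le,
      mul_div_cancel₀ _ (Real.rpow_pos_of_pos hτ _).ne']
  rw [radDiff, h hσ (hσρ.trans hq), h hρ hq, sub_self]

theorem radG_add (hq : 0 ≤ q) :
    α * radG α n q - α * (q * radW α n q)
      = α * (1 + α / (n + 1)) * max 0 (1 - q ^ (n + 1)) := by
  rcases le_total q 1 with h | h
  · rw [radG_of_le h, radW_of_le h, max_eq_right (sub_nonneg.2 (pow_le_one₀ hq h))]
    field_simp
    ring
  · rw [radG_of_ge h, radW_of_ge h, max_eq_left (sub_nonpos.2 (one_le_pow₀ h)),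
      Real.rpow_sub_one (by positivity)]
    field_simp
    ring

theorem radDiff_add (hσ : 0 < σ) (hρ : 0 < ρ) (hq : 0 ≤ q) :
    α * radDiff α n σ ρ q + q * (-α * (radDer α n σ q - radDer α n ρ q))
      = α * (1 + α / (n + 1)) * (σ ^ (-α) * max 0 (1 - (q / σ) ^ (n + 1))
        - ρ ^ (-α) * max 0 (1 - (q / ρ) ^ (n + 1))) := by
  have h {τ : ℝ} (hτ : 0 < τ) : α * (τ ^ (-α) * radG α n (q / τ)) + q * (-α * radDer α n τ q)
      = α * (1 + α / (n + 1)) * (τ ^ (-α) * max 0 (1 - (q / τ) ^ (n + 1))) := by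
    have := radG_add (α := α) (n := n) (div_nonneg hq hτ.le)
    rw [radDer]
    linear_combination τ ^ (-α) * this
  rw [radDiff]
  linear_combination h hσ - h hρ

theorem radDer_anti (hα : 0 ≤ α) (hσ : 0 < σ) (hσρ : σ ≤ ρ) (hq : 0 ≤ q) :
    radDer α n ρ q ≤ radDer α n σ q := by
  have hρ := hσ.trans_le hσρ
  have hle {τ : ℝ} (hτ : 0 < τ) (h : q ≤ τ) : radDer α n τ q = q ^ n * τ ^ (-α - (n + 1 : ℕ)) := by
    rw [radDer, radW_of_le ((div_le_one hτ).2 h), Real.rpow_sub_natCast hτ.ne', div_pow]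
    field_simp
    ring
  have hge {τ : ℝ} (hτ : 0 < τ) (h : τ ≤ q) : radDer α n τ q = q ^ (-α - 1) := by
    have hq' := hτ.trans_le h
    rw [radDer, radW_of_ge ((one_le_div hτ).2 h), Real.div_rpow hq hτ.le, Real.rpow_sub_one hτ.ne']
    have := (Real.rpow_pos_of_pos hτ (-α)).ne'
    field_simp
  have hexp : -α - (n + 1 : ℕ) ≤ 0 := by
    have : (0 : ℝ) ≤ (n + 1 : ℕ) := Nat.cast_nonneg _
    linarith
  rcases le_total q σ with h1 | h1
  · rw [hle hσ h1, hle hρ (h1.trans hσρ)]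
    exact mul_le_mul_of_nonneg_left (Real.rpow_le_rpow_of_nonpos hσ hσρ hexp) (by positivity)
  · rcases le_total q ρ with h2 | h2
    · have hq' := hσ.trans_le h1
      have hself : q ^ (-α - 1) = q ^ n * q ^ (-α - (n + 1 : ℕ)) := by
        rw [← Real.rpow_natCast q n, ← Real.rpow_add hq']
        congr 1
        push_cast
        ring
      rw [hge hσ h1, hle hρ h2, hself]
      exact mul_le_mul_of_nonneg_left (Real.rpow_le_rpow_of_nonpos hq' h2 hexp) (by positivity)
    · rw [hge hσ h1, hge hρ h2]

theorem abs_radDiff_le (hσ : 0 < σ) (hσρ : σ ≤ ρ) (hq : 0 ≤ q) :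
    |radDiff 1 0 σ ρ q| ≤ 2 / σ := by
  have hG {q : ℝ} (hq : 0 ≤ q) : 0 ≤ radG 1 0 q ∧ radG 1 0 q ≤ 2 := by
    rcases le_total q 1 with h | h
    · rw [radG_of_le h]
      norm_num
      constructor <;> linarith
    · rw [radG_of_ge h]
      exact ⟨by positivity, (Real.rpow_le_one_of_one_le_of_nonpos h (by norm_num)).trans
        (by norm_num)⟩
  have hρ := hσ.trans_le hσρ
  have hb {τ : ℝ} (hτ : σ ≤ τ) : 0 ≤ τ ^ (-1 : ℝ) * radG 1 0 (q / τ) ∧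
      τ ^ (-1 : ℝ) * radG 1 0 (q / τ) ≤ 2 / σ := by
    have hτ0 := hσ.trans_le hτ
    have h1 := hG (div_nonneg hq hτ0.le)
    refine ⟨mul_nonneg (by positivity) h1.1, ?_⟩
    rw [Real.rpow_neg_one, ← one_div, div_mul_eq_mul_div, one_mul]
    exact div_le_div₀ (by norm_num) h1.2 hσ hτ
  exact abs_sub_le_of_nonneg_of_le (hb le_rfl).1 (hb le_rfl).2 (hb hσρ).1 (hb hσρ).2

theorem abs_radDer_sub_le (hσ : 0 < σ) (hσρ : σ ≤ ρ) (hq : 0 ≤ q) :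
    q * |radDer 1 0 σ q - radDer 1 0 ρ q| ≤ 1 / σ := by
  have hW {q : ℝ} (hq : 0 ≤ q) : 0 ≤ q * radW 1 0 q ∧ q * radW 1 0 q ≤ 1 := by
    rcases le_total q 1 with h | h
    · rw [radW_of_le h]
      simpa using ⟨hq, h⟩
    · have hq' : 0 < q := by positivity
      rw [radW_of_ge h, Real.rpow_sub_one hq'.ne', mul_div_cancel₀ _ hq'.ne']
      exact ⟨by positivity, Real.rpow_le_one_of_one_le_of_nonpos h (by norm_num)⟩
  have hρ := hσ.trans_le hσρ
  have hb {τ : ℝ} (hτ : σ ≤ τ) : 0 ≤ q * radDer 1 0 τ q ∧ q * radDer 1 0 τ q ≤ 1 / σ := by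
    have hτ0 := hσ.trans_le hτ
    have h1 := hW (div_nonneg hq hτ0.le)
    have h2 : q * radDer 1 0 τ q = q / τ * radW 1 0 (q / τ) / τ := by
      rw [radDer, Real.rpow_neg_one]
      ring
    rw [h2]
    exact ⟨div_nonneg h1.1 hτ0.le, div_le_div₀ zero_le_one h1.2 hσ hτ⟩
  rw [← abs_of_nonneg hq, ← abs_mul, abs_of_nonneg hq, mul_sub]
  exact abs_sub_le_of_nonneg_of_le (hb le_rfl).1 (hb le_rfl).2 (hb hσρ).1 (hb hσρ).2

end Radial

section Radial

variable {Ω : Set E2} {ν ζ : Measure E2} {a : Fin 2 → Fin 2 → E2 → ℝ} {z : E2 → ℝ}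

theorem pd_norm_sub_sq (x y : E2) (j : Fin 2) :
    pd (fun y : E2 => ‖y - x‖ ^ 2) j y = 2 * (y j - x j) := by
  have h : HasFDerivAt (fun y : E2 => ‖y - x‖ ^ 2) _ y := ((hasFDerivAt_id y).sub_const x).norm_sq
  rw [pd, h.fderiv]
  simp [b2, EuclideanSpace.inner_single_right]

theorem pd_comp {g : ℝ → ℝ} {g' : ℝ} {f : E2 → ℝ} {y : E2} (hg : HasDerivAt g g' (f y))
    (hf : DifferentiableAt ℝ f y) (j : Fin 2) : pd (fun y => g (f y)) j y = g' * pd f j y := by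
  have h : HasFDerivAt (fun y => g (f y)) _ y := hg.comp_hasFDerivAt y hf.hasFDerivAt
  rw [pd, h.fderiv]
  simp [pd]

/-- The divergence identity for the radial fields `g(|y - x|²) (y - x)`. -/
theorem StressLimit.integral_radial (h : StressLimit Ω ν ζ a z) {g g' : ℝ → ℝ}
    (hg : ContDiff ℝ 1 g) (hg' : ∀ q, HasDerivAt g (g' q) q) {x : E2} {r : ℝ} (hr : 0 < r)
    (hsub : closedBall x r ⊆ Ω) (h0 : ∀ q, r ^ 2 ≤ q → g q = 0) (i l : Fin 2) :
    Integrable (fun y => g (‖y - x‖ ^ 2) * a i l y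
      + 2 * g' (‖y - x‖ ^ 2) * (y l - x l) * ∑ j, (y j - x j) * a i j y) ν ∧
    ∫ y, (g (‖y - x‖ ^ 2) * a i l y
      + 2 * g' (‖y - x‖ ^ 2) * (y l - x l) * ∑ j, (y j - x j) * a i j y) ∂ν = 0 := by
  have := h.finite
  have hq : ContDiff ℝ 1 fun y : E2 => ‖y - x‖ ^ 2 := (contDiff_id.sub contDiff_const).norm_sq ℝ
  have hl : ContDiff ℝ 1 fun y : E2 => y l - x l := by fun_prop
  have hgq : ContDiff ℝ 1 fun y : E2 => g (‖y - x‖ ^ 2) := hg.comp hq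
  set χ : E2 → ℝ := fun y => g (‖y - x‖ ^ 2) * (y l - x l) with hχdef
  have hts : tsupport χ ⊆ closedBall x r := by
    refine closure_minimal (fun y hy => ?_) isClosed_closedBall
    by_contra hyr
    rw [mem_closedBall, dist_eq_norm, not_le] at hyr
    refine hy ?_
    simp only [hχdef]
    rw [h0 _ (by gcongr), zero_mul]
  have hχ : C1Test Ω χ := ⟨hgq.mul hl, HasCompactSupport.of_support_subset_isCompact
    (isCompact_closedBall x r) ((subset_tsupport χ).trans hts), hts.trans hsub⟩
  have hi (j : Fin 2) : Integrable (fun y => pd χ j y * a i j y) ν :=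
    h.integrable_mul ((hχ.pd_test j).integrable ν) i j
  have hsum : (fun y => ∑ j, pd χ j y * a i j y) = fun y => g (‖y - x‖ ^ 2) * a i l y
      + 2 * g' (‖y - x‖ ^ 2) * (y l - x l) * ∑ j, (y j - x j) * a i j y := by
    funext y
    have hpd (j : Fin 2) : pd χ j y = g (‖y - x‖ ^ 2) * b2 j l
        + g' (‖y - x‖ ^ 2) * (2 * (y j - x j)) * (y l - x l) := by
      rw [hχdef, pd_mul (hgq.differentiable (by simp) y) (hl.differentiable (by simp) y),
        pd_coord (g := fun s => s - x l) (by fun_prop), pd_comp (hg' _)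
        (hq.differentiable (by simp) y), pd_norm_sub_sq]
      simp
    have hb : ∑ j, b2 j l * a i j y = a i l y := by
      rw [Finset.sum_eq_single l (fun j _ hj => by simp [b2, hj.symm]) (by simp)]
      simp [b2]
    rw [← hb, Finset.mul_sum, Finset.mul_sum, ← Finset.sum_add_distrib]
    exact Finset.sum_congr rfl fun j _ => by rw [hpd]; ring
  rw [← hsum]
  refine ⟨integrable_finsetSum _ fun j _ => hi j, ?_⟩
  rw [integral_finsetSum _ fun j _ => hi j]
  exact h.div χ hχ i

end Radial

theorem radDer_sub_eq_zero {n : ℕ} {α σ ρ q : ℝ} (hα : α ≠ 0) (hσ : 0 < σ) (hσρ : σ ≤ ρ)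
    (hq : ρ < q) : radDer α n σ q - radDer α n ρ q = 0 := by
  have h0 : HasDerivAt (radDiff α n σ ρ) 0 q := (hasDerivAt_const q (0 : ℝ)).congr_of_eventuallyEq
    (by filter_upwards [lt_mem_nhds hq] with y hy using radDiff_eq_zero hσ hσρ hy.le)
  simpa [hα] using (hasDerivAt_radDiff α n σ ρ q).unique h0

/-- The truncated paraboloid `(1 - (|y - x| / s) ^ (2 (n + 1)))₊`. -/
def bump (n : ℕ) (s : ℝ) (x y : E2) : ℝ := max 0 (1 - (‖y - x‖ ^ 2 / s ^ 2) ^ (n + 1))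

section Bump

variable {n : ℕ} {s t : ℝ} {x y : E2}

theorem continuous_bump : Continuous (bump n s x) := by
  unfold bump
  fun_prop

theorem bump_nonneg : 0 ≤ bump n s x y := le_max_left _ _

theorem bump_le_one : bump n s x y ≤ 1 := by
  have : 0 ≤ (‖y - x‖ ^ 2 / s ^ 2) ^ (n + 1) := by positivity
  exact max_le zero_le_one (by linarith)

theorem bump_eq_zero (hs : 0 < s) (hy : y ∉ closedBall x s) : bump n s x y = 0 := by
  rw [mem_closedBall, dist_eq_norm, not_le] at hy
  refine max_eq_left (sub_nonpos.2 (one_le_pow₀ ?_))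
  rw [one_le_div (by positivity)]
  gcongr

theorem le_bump (hy : y ∈ closedBall x t) : 1 - ((t / s) ^ 2) ^ (n + 1) ≤ bump n s x y := by
  rw [mem_closedBall, dist_eq_norm] at hy
  refine le_max_of_le_right ?_
  rw [div_pow]
  gcongr

theorem integrable_bump (μ : Measure E2) [IsFiniteMeasure μ] : Integrable (bump n s x) μ :=
  Integrable.of_bound continuous_bump.aestronglyMeasurable 1 (ae_of_all _ fun y => by
    rw [Real.norm_of_nonneg bump_nonneg]
    exact bump_le_one)

theorem integral_bump_le (μ : Measure E2) [IsFiniteMeasure μ] (hs : 0 < s) :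
    ∫ y, bump n s x y ∂μ ≤ μ.real (closedBall x s) := by
  rw [← integral_indicator_one isClosed_closedBall.measurableSet]
  refine integral_mono (integrable_bump μ) ((integrable_const 1).indicator
    isClosed_closedBall.measurableSet) fun y => ?_
  by_cases hy : y ∈ closedBall x s
  · simp only [Set.indicator_of_mem hy, Pi.one_apply, bump_le_one]
  · simp only [Set.indicator_of_notMem hy, bump_eq_zero hs hy, le_refl]

theorem le_integral_bump (μ : Measure E2) [IsFiniteMeasure μ] :
    (1 - ((t / s) ^ 2) ^ (n + 1)) * μ.real (closedBall x t) ≤ ∫ y, bump n s x y ∂μ := by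
  rw [mul_comm, ← smul_eq_mul, ← integral_indicator_const _ isClosed_closedBall.measurableSet]
  refine integral_mono ((integrable_const _).indicator isClosed_closedBall.measurableSet)
    (integrable_bump μ) fun y => ?_
  by_cases hy : y ∈ closedBall x t
  · simpa only [Set.indicator_of_mem hy] using le_bump hy
  · simpa only [Set.indicator_of_notMem hy] using bump_nonneg

end Bump

section Monotone

variable {Ω : Set E2} {ν ζ : Measure E2} {a : Fin 2 → Fin 2 → E2 → ℝ} {z : E2 → ℝ}

theorem abs_coord_mul_le (y : E2) (i j : Fin 2) : |y i * y j| ≤ ‖y‖ ^ 2 := by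
  rw [abs_mul, sq]
  gcongr <;> exact PiLp.norm_apply_le y _

theorem quadForm_le {a b c p q : ℝ} (htr : 0 ≤ a + c) (hdet : a * c = b ^ 2) :
    a * p ^ 2 + 2 * b * (p * q) + c * q ^ 2 ≤ (a + c) * (p ^ 2 + q ^ 2) := by
  have ha : 0 ≤ a := by nlinarith [sq_nonneg b]
  have hc : 0 ≤ c := by nlinarith [sq_nonneg b]
  have h : |2 * b * (p * q)| ≤ a * q ^ 2 + c * p ^ 2 := by
    refine abs_le_of_sq_le_sq ?_ (by positivity)
    have : (2 * b * (p * q)) ^ 2 = 4 * (a * c) * (p * q) ^ 2 := by rw [hdet]; ring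
    rw [this]
    nlinarith [sq_nonneg (a * q ^ 2 - c * p ^ 2)]
  nlinarith [le_abs_self (2 * b * (p * q))]

theorem norm_sq_eq_coord (y : E2) : ‖y‖ ^ 2 = y 0 ^ 2 + y 1 ^ 2 := by
  simp [EuclideanSpace.norm_sq_eq, Fin.sum_univ_two]

theorem StressLimit.integral_bump_le (h : StressLimit Ω ν ζ a z)
    (hdet : ∀ᵐ x ∂ν, a 0 0 x * a 1 1 x = a 0 1 x ^ 2) {x : E2} {s r : ℝ} (hs : 0 < s) (hsr : s ≤ r)
    (hsub : closedBall x r ⊆ Ω) (n : ℕ) :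
    s⁻¹ * ∫ y, bump n s x y ∂ζ ≤ r⁻¹ * ∫ y, bump n r x y ∂ζ := by
  have := h.finite
  have hr := hs.trans_le hsr
  have hσ : 0 < s ^ 2 := by positivity
  have hρ : 0 < r ^ 2 := by positivity
  have hσρ : s ^ 2 ≤ r ^ 2 := by gcongr
  have hI (i : Fin 2) := h.integral_radial contDiff_radDiff (hasDerivAt_radDiff (1 / 2) n _ _) hr
    hsub (fun q => radDiff_eq_zero hσ hσρ) i i
  have hpow {t : ℝ} (ht : 0 < t) : (t ^ 2) ^ (-(1 / 2) : ℝ) = t⁻¹ := by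
    rw [← Real.rpow_natCast, ← Real.rpow_mul ht.le, ← Real.rpow_neg_one]
    norm_num
  have hz {t : ℝ} : Integrable (fun y => bump n t x y * z y) ν :=
    (integrable_bump ν).mul_bdd h.measurable_z.aestronglyMeasurable (ae_of_all _ fun y => by
      rw [Real.norm_of_nonneg (h.z_nonneg y)]; exact h.z_le y)
  set c : ℝ := 2 * (1 + 1 / 2 / (n + 1)) with hc
  have hc0 : 0 < c := by positivity
  have key : ∫ y, c * (s⁻¹ * (bump n s x y * z y) - r⁻¹ * (bump n r x y * z y)) ∂ν ≤ 0 := by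
    have h0 := integral_add (hI 0).1 (hI 1).1
    rw [(hI 0).2, (hI 1).2, add_zero] at h0
    rw [← h0]
    refine integral_mono_ae (((hz.const_mul _).sub (hz.const_mul _)).const_mul _)
      ((hI 0).1.add (hI 1).1) ?_
    filter_upwards [h.trace, hdet] with y htr hd
    have h1 := radDiff_add (α := 1 / 2) (n := n) hσ hρ (sq_nonneg ‖y - x‖)
    have h2 := radDer_anti (α := 1 / 2) (n := n) (by norm_num) hσ hσρ (sq_nonneg ‖y - x‖)
    have h3 := quadForm_le (p := y 0 - x 0) (q := y 1 - x 1)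
      (by rw [htr]; linarith [h.z_nonneg y]) hd
    have h4 : ‖y - x‖ ^ 2 = (y 0 - x 0) ^ 2 + (y 1 - x 1) ^ 2 := by simp [norm_sq_eq_coord]
    have h5 : a 1 0 y = a 0 1 y := by rw [h.symm]
    rw [hpow hs, hpow hr] at h1
    simp only [Fin.sum_univ_two, h5, bump]
    rw [← h4, htr] at h3
    have h6 := mul_le_mul_of_nonneg_left h3 (sub_nonneg.2 h2)
    linear_combination h6 - 4 * z y * h1
      - radDiff (1 / 2) n (s ^ 2) (r ^ 2) (‖y - x‖ ^ 2) * htr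
  rw [integral_const_mul, integral_sub (hz.const_mul _) (hz.const_mul _), integral_const_mul,
    integral_const_mul] at key
  have hζ (t : ℝ) : ∫ y, bump n t x y ∂ζ = ∫ y, bump n t x y * z y ∂ν := by
    rw [h.withDensity]
    exact integral_withDensity_ofReal h.measurable_z h.z_nonneg _
  rw [hζ, hζ]
  exact sub_nonpos.1 (nonpos_of_mul_nonpos_right key hc0)

theorem StressLimit.finite_zeta (h : StressLimit Ω ν ζ a z) : IsFiniteMeasure ζ := by
  have := h.finite
  rw [h.withDensity]
  exact isFiniteMeasure_withDensity_ofReal ((Integrable.of_bound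
    h.measurable_z.aestronglyMeasurable 1 (ae_of_all _ fun y => by
      rw [Real.norm_of_nonneg (h.z_nonneg y)]; exact h.z_le y)).2)

/-- The monotonicity formula for the limiting potential. -/
theorem StressLimit.measureReal_closedBall_le (h : StressLimit Ω ν ζ a z)
    (hdet : ∀ᵐ x ∂ν, a 0 0 x * a 1 1 x = a 0 1 x ^ 2) {x : E2} {s r : ℝ} (hs : 0 < s) (hsr : s < r)
    (hsub : closedBall x r ⊆ Ω) :
    ζ.real (closedBall x s) ≤ s / r * ζ.real (closedBall x r) := by
  have := h.finite_zeta
  have hr := hs.trans hsr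
  have key {t : ℝ} (hst : s < t) (htr : t ≤ r) :
      ζ.real (closedBall x s) ≤ t / r * ζ.real (closedBall x r) := by
    have ht := hs.trans hst
    have h1 (n : ℕ) : (1 - ((s / t) ^ 2) ^ (n + 1)) * ζ.real (closedBall x s)
        ≤ t / r * ζ.real (closedBall x r) := by
      have h2 := h.integral_bump_le hdet ht htr hsub n
      rw [inv_mul_le_iff₀ ht, ← mul_assoc, ← div_eq_mul_inv] at h2
      exact (le_integral_bump ζ).trans (h2.trans
        (mul_le_mul_of_nonneg_left (_root_.integral_bump_le ζ hr) (by positivity)))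
    have hlim : Tendsto (fun n : ℕ => (1 - ((s / t) ^ 2) ^ (n + 1)) * ζ.real (closedBall x s))
        atTop (𝓝 ((1 - 0) * ζ.real (closedBall x s))) := by
      refine (((tendsto_pow_atTop_nhds_zero_of_lt_one (by positivity) ?_).comp
        (tendsto_add_atTop_nat 1)).const_sub 1).mul_const _
      exact pow_lt_one₀ (by positivity) ((div_lt_one ht).2 hst) two_ne_zero
    rw [sub_zero, one_mul] at hlim
    exact le_of_tendsto' hlim h1
  have hlim : Tendsto (fun t : ℝ => t / r * ζ.real (closedBall x r)) (𝓝[>] s)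
      (𝓝 (s / r * ζ.real (closedBall x r))) :=
    (Continuous.tendsto (by fun_prop) s).mono_left nhdsWithin_le_nhds
  refine ge_of_tendsto hlim ?_
  filter_upwards [Ioc_mem_nhdsGT hsr] with t ht using key ht.1 ht.2

end Monotone

section Det

variable {Ω : Set E2} {ν ζ : Measure E2} {a : Fin 2 → Fin 2 → E2 → ℝ} {z : E2 → ℝ}

/-- A measure with positive lower one-dimensional density at a point is doubling there along
arbitrarily small radii. -/
theorem frequently_le_measureReal_closedBall {ν : Measure E2} [IsFiniteMeasure ν] {x : E2} {c : ℝ}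
    (hc : 0 < c) (hlow : ∀ᶠ ρ in 𝓝[>] (0 : ℝ), c * ρ ≤ ν.real (closedBall x ρ)) :
    ∃ᶠ r in 𝓝[>] (0 : ℝ), ν.real (closedBall x r) ≤ 64 * ν.real (closedBall x (r / 32)) := by
  intro hnot
  obtain ⟨r, hr, hsub⟩ := (mem_nhdsGT_iff_exists_Ioc_subset).1 (hlow.and hnot)
  rw [Set.mem_Ioi] at hr
  have hmem (j : ℕ) : r / 32 ^ j ∈ Set.Ioc 0 r :=
    ⟨by positivity, div_le_self hr.le (one_le_pow₀ (by norm_num))⟩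
  have hit (j : ℕ) : 64 ^ j * ν.real (closedBall x (r / 32 ^ j)) ≤ ν.real (closedBall x r) := by
    induction j with
    | zero => simp
    | succ j ih =>
      have := (hsub (hmem j)).2
      rw [not_le, div_div, ← pow_succ] at this
      have h64 : (0 : ℝ) < 64 ^ j := by positivity
      rw [pow_succ]
      nlinarith
  obtain ⟨j, hj⟩ := pow_unbounded_of_one_lt (ν.real (closedBall x r) / (c * r)) one_lt_two
  rw [div_lt_iff₀ (by positivity)] at hj
  have h1 := (mul_le_mul_of_nonneg_left (hsub (hmem j)).1 (by positivity)).trans (hit j)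
  have h2 : (64 : ℝ) ^ j * (c * (r / 32 ^ j)) = 2 ^ j * (c * r) := by
    rw [show (64 : ℝ) = 2 * 32 by norm_num, mul_pow]
    field_simp
  linarith

theorem abs_radial_le {σ G W Q p q b c d : ℝ} (hG : |G| ≤ 2 / σ)
    (hW : Q * |W| ≤ 1 / σ) (hp : |p * q| ≤ Q) (hp' : |p * p| ≤ Q) :
    |G * b - 2 * W * p * (p * c + q * d)| ≤ 2 / σ * (|b| + |c| + |d|) := by
  have h1 {e t : ℝ} (he : |e| ≤ Q) : |W * e * t| ≤ 1 / σ * |t| := by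
    rw [abs_mul, abs_mul]
    refine mul_le_mul_of_nonneg_right (le_trans ?_ hW) (abs_nonneg t)
    rw [mul_comm]
    gcongr
  have h2 : |G * b| ≤ 2 / σ * |b| := by
    rw [abs_mul]
    gcongr
  have h3 : G * b - 2 * W * p * (p * c + q * d)
      = G * b - (2 * (W * (p * p) * c) + 2 * (W * (p * q) * d)) := by ring
  rw [h3]
  refine (abs_sub _ _).trans ?_
  refine (add_le_add h2 ((abs_add_le _ _))).trans ?_
  rw [abs_mul, abs_mul 2, abs_two]
  linear_combination 2 * h1 (t := c) hp' + 2 * h1 (t := d) hp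

theorem StressLimit.abs_det_mul_le (h : StressLimit Ω ν ζ a z) {A : Fin 2 → Fin 2 → ℝ}
    (hA : ∀ i j, |A i j| ≤ 1) (hAs : A 1 0 = A 0 1) {x : E2} {r : ℝ} (hr : 0 < r)
    (hsub : closedBall x r ⊆ Ω) :
    4 * |A 0 0 * A 1 1 - A 0 1 ^ 2| * ∫ y, bump 0 (r / 16) x y ∂ν
      ≤ 4 * |A 0 0 * A 1 1 - A 0 1 ^ 2| * (ν.real (closedBall x r) / 256)
        + 6 * ∫ y in closedBall x r, ∑ i, ∑ j, |a i j y - A i j| ∂ν := by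
  have := h.finite
  have hs : 0 < r / 16 := by positivity
  have hσ : 0 < (r / 16) ^ 2 := by positivity
  have hρ : 0 < r ^ 2 := by positivity
  have hσρ : (r / 16) ^ 2 ≤ r ^ 2 := by
    gcongr
    exact div_le_self hr.le (by norm_num)
  set σ := (r / 16) ^ 2 with hσdef
  set G : E2 → ℝ := fun y => radDiff 1 0 σ (r ^ 2) (‖y - x‖ ^ 2) with hG
  set W : E2 → ℝ := fun y => radDer 1 0 σ (‖y - x‖ ^ 2) - radDer 1 0 (r ^ 2) (‖y - x‖ ^ 2) with hW
  have hI (i l : Fin 2) := h.integral_radial contDiff_radDiff (hasDerivAt_radDiff 1 0 σ (r ^ 2)) hr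
    hsub (fun q => radDiff_eq_zero hσ hσρ) i l
  set F : Fin 2 → Fin 2 → E2 → ℝ := fun i l y => G y * a i l y
      + 2 * (-1 * W y) * (y l - x l) * ∑ j, (y j - x j) * a i j y with hF
  have hFi (i l : Fin 2) : Integrable (F i l) ν := (hI i l).1
  have hF0 (i l : Fin 2) : ∫ y, F i l y ∂ν = 0 := (hI i l).2
  set D := A 0 0 * A 1 1 - A 0 1 ^ 2 with hD
  set X : E2 → ℝ := fun y => 4 * D * (σ⁻¹ * bump 0 (r / 16) x y - (r ^ 2)⁻¹ * bump 0 r x y) with hX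
  set T : E2 → ℝ := fun y => A 1 1 * F 0 0 y + A 0 0 * F 1 1 y
    - (A 0 1 * F 0 1 y + A 0 1 * F 1 0 y) with hT
  set S : E2 → ℝ := fun y => ∑ i, ∑ j, |a i j y - A i j| with hS
  have i1 := ((hFi 0 0).const_mul (A 1 1)).add ((hFi 1 1).const_mul (A 0 0))
  have i2 := ((hFi 0 1).const_mul (A 0 1)).add ((hFi 1 0).const_mul (A 0 1))
  have iT : Integrable T ν := i1.sub i2
  have hT0 : ∫ y, T y ∂ν = 0 := by
    have e := integral_sub i1 i2
    rw [integral_add' ((hFi 0 0).const_mul _) ((hFi 1 1).const_mul _),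
      integral_add' ((hFi 0 1).const_mul _) ((hFi 1 0).const_mul _)] at e
    simp only [integral_const_mul, hF0, mul_zero, add_zero, sub_zero] at e
    exact e
  have iX : Integrable X ν :=
    (((integrable_bump ν).const_mul _).sub ((integrable_bump ν).const_mul _)).const_mul _
  have iS : Integrable S ν := integrable_finsetSum _ fun i _ => integrable_finsetSum _ fun j _ =>
    ((Integrable.of_bound (h.measurable i j).aestronglyMeasurable 1
      (ae_of_all _ (h.abs_le_one i j))).sub (integrable_const _)).abs
  have hpt (y : E2) : |X y - T y| ≤ (closedBall x r).indicator (fun y => 6 / σ * S y) y := by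
    have hq := sq_nonneg ‖y - x‖
    have hsq : ‖y - x‖ ^ 2 = (y 0 - x 0) ^ 2 + (y 1 - x 1) ^ 2 := by simp [norm_sq_eq_coord]
    have e1 := radDiff_add (α := 1) (n := 0) hσ hρ hq
    have e2 : X y - T y = -(A 1 1 * (G y * (a 0 0 y - A 0 0) - 2 * W y * (y 0 - x 0) *
          ((y 0 - x 0) * (a 0 0 y - A 0 0) + (y 1 - x 1) * (a 0 1 y - A 0 1)))
        + A 0 0 * (G y * (a 1 1 y - A 1 1) - 2 * W y * (y 1 - x 1) *
          ((y 1 - x 1) * (a 1 1 y - A 1 1) + (y 0 - x 0) * (a 1 0 y - A 1 0)))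
        - (A 0 1 * (G y * (a 0 1 y - A 0 1) - 2 * W y * (y 1 - x 1) *
          ((y 1 - x 1) * (a 0 1 y - A 0 1) + (y 0 - x 0) * (a 0 0 y - A 0 0)))
        + A 0 1 * (G y * (a 1 0 y - A 1 0) - 2 * W y * (y 0 - x 0) *
          ((y 0 - x 0) * (a 1 0 y - A 1 0) + (y 1 - x 1) * (a 1 1 y - A 1 1))))) := by
      simp only [hX, hT, hF, Fin.sum_univ_two, hAs, bump]
      rw [Real.rpow_neg_one, Real.rpow_neg_one] at e1
      rw [show radDer 1 0 σ (‖y - x‖ ^ 2) - radDer 1 0 (r ^ 2) (‖y - x‖ ^ 2) = W y from rfl,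
        show radDiff 1 0 σ (r ^ 2) (‖y - x‖ ^ 2) = G y from rfl] at e1
      rw [← hσdef]
      norm_num at e1 ⊢
      linear_combination -2 * D * e1 - 2 * D * W y * hsq
    by_cases hy : y ∈ closedBall x r
    · rw [Set.indicator_of_mem hy, e2, abs_neg]
      have hg : |G y| ≤ 2 / σ := abs_radDiff_le hσ hσρ hq
      have hw : ‖y - x‖ ^ 2 * |W y| ≤ 1 / σ := abs_radDer_sub_le hσ hσρ hq
      have hc (i j : Fin 2) := abs_coord_mul_le (y - x) i j
      simp only [PiLp.sub_apply] at hc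
      have hm {α β γ : ℝ} (hα : |α| ≤ 1) (hβ : |β| ≤ γ) : |α * β| ≤ γ := by
        rw [abs_mul]
        exact (mul_le_of_le_one_left (abs_nonneg _) hα).trans hβ
      refine (abs_sub _ _).trans ((add_le_add (abs_add_le _ _) (abs_add_le _ _)).trans ?_)
      refine (add_le_add (add_le_add
        (hm (hA 1 1) (abs_radial_le hg hw (hc 0 1) (hc 0 0)))
        (hm (hA 0 0) (abs_radial_le hg hw (hc 1 0) (hc 1 1)))) (add_le_add
        (hm (hA 0 1) (abs_radial_le hg hw (hc 1 0) (hc 1 1)))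
        (hm (hA 0 1) (abs_radial_le hg hw (hc 0 1) (hc 0 0))))).trans (le_of_eq ?_)
      simp only [hS, Fin.sum_univ_two]
      ring
    · rw [Set.indicator_of_notMem hy, e2]
      rw [mem_closedBall, dist_eq_norm, not_le] at hy
      have hlt : r ^ 2 < ‖y - x‖ ^ 2 := by gcongr
      have g0 : G y = 0 := radDiff_eq_zero hσ hσρ hlt.le
      have w0 : W y = 0 := radDer_sub_eq_zero one_ne_zero hσ hσρ hlt
      simp [g0, w0]
  have hb : |∫ y, X y ∂ν| ≤ 6 / σ * ∫ y in closedBall x r, S y ∂ν := by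
    rw [← sub_zero (∫ y, X y ∂ν), ← hT0, ← integral_sub iX iT, ← integral_const_mul,
      ← integral_indicator isClosed_closedBall.measurableSet]
    exact norm_integral_le_of_norm_le (f := fun y => X y - T y)
      ((iS.const_mul _).indicator isClosed_closedBall.measurableSet) (ae_of_all _ hpt)
  have hXi : ∫ y, X y ∂ν
      = 4 * D * (σ⁻¹ * ∫ y, bump 0 (r / 16) x y ∂ν - (r ^ 2)⁻¹ * ∫ y, bump 0 r x y ∂ν) := by
    rw [hX, integral_const_mul, integral_sub ((integrable_bump ν).const_mul _)
      ((integrable_bump ν).const_mul _), integral_const_mul, integral_const_mul]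
  have hN := _root_.integral_bump_le (n := 0) (x := x) ν hr
  rw [hXi, abs_mul, abs_mul, abs_of_pos (by norm_num : (0 : ℝ) < 4)] at hb
  have h1 := (mul_le_mul_of_nonneg_left (le_abs_self _) (by positivity)).trans hb
  have h2 := mul_le_mul_of_nonneg_left h1 hσ.le
  have h3 := mul_le_mul_of_nonneg_left hN (by positivity : 0 ≤ 4 * |D| / 256)
  have h4 : σ * (r ^ 2)⁻¹ = 1 / 256 := by
    rw [hσdef]
    field_simp
    norm_num
  have h5 : σ * σ⁻¹ = 1 := mul_inv_cancel₀ hσ.ne'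
  have h6 : σ * (6 / σ * ∫ y in closedBall x r, S y ∂ν) = 6 * ∫ y in closedBall x r, S y ∂ν := by
    field_simp
  rw [h6] at h2
  linear_combination h2 + h3 - 4 * |D| * (∫ y, bump 0 (r / 16) x y ∂ν) * h5
    + 4 * |D| * (∫ y, bump 0 r x y ∂ν) * h4

/-- The limiting stress is degenerate. -/
theorem StressLimit.ae_det_eq_zero (h : StressLimit Ω ν ζ a z) {c : ℝ} (hc : 0 < c)
    (hlow : ∀ᵐ x ∂ν, ∀ᶠ ρ in 𝓝[>] (0 : ℝ), c * ρ ≤ ν.real (closedBall x ρ)) :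
    ∀ᵐ x ∂ν, a 0 0 x * a 1 1 x = a 0 1 x ^ 2 := by
  have := h.finite
  have hint (i j : Fin 2) : Integrable (a i j) ν :=
    Integrable.of_bound (h.measurable i j).aestronglyMeasurable 1 (ae_of_all _ (h.abs_le_one i j))
  have hleb : ∀ᵐ x ∂ν, ∀ i j, Tendsto (fun r => ⨍ y in closedBall x r, |a i j y - a i j x| ∂ν)
      (𝓝[>] 0) (𝓝 0) := by
    simp only [ae_all_iff]
    intro i j
    filter_upwards [(Besicovitch.vitaliFamily ν).ae_tendsto_average_norm_sub
      (hint i j).locallyIntegrable] with x hx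
    exact hx.comp (Besicovitch.tendsto_filterAt ν x)
  have hΩ : ∀ᵐ x ∂ν, x ∈ Ω :=
    (measure_eq_zero_iff_ae_notMem.1 h.compl).mono fun x hx => by simpa using hx
  filter_upwards [hleb, hlow, hΩ] with x hx hl hxΩ
  set D := |a 0 0 x * a 1 1 x - a 0 1 x ^ 2| with hD
  have hball : ∀ᶠ r in 𝓝[>] (0 : ℝ), closedBall x r ⊆ Ω := by
    obtain ⟨δ, hδ, hs⟩ := nhds_basis_closedBall.mem_iff.1 (h.isOpen.mem_nhds hxΩ)
    filter_upwards [Ioc_mem_nhdsGT hδ] with r hr using (closedBall_subset_closedBall hr.2).trans hs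
  have hlim : Tendsto (fun r => 192 * ∑ i, ∑ j, ⨍ y in closedBall x r, |a i j y - a i j x| ∂ν)
      (𝓝[>] 0) (𝓝 0) := by
    have := (tendsto_finsetSum (Finset.univ : Finset (Fin 2)) fun i _ =>
      tendsto_finsetSum (Finset.univ : Finset (Fin 2)) fun j _ => hx i j).const_mul 192
    simpa using this
  have hfreq : ∃ᶠ r in 𝓝[>] (0 : ℝ),
      D ≤ 192 * ∑ i, ∑ j, ⨍ y in closedBall x r, |a i j y - a i j x| ∂ν := by
    refine ((frequently_le_measureReal_closedBall hc hl).and_eventually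
      (hball.and (hl.and eventually_mem_nhdsWithin))).mono fun r ⟨h64, hsub, hlr, hr⟩ => ?_
    rw [Set.mem_Ioi] at hr
    have hν : 0 < ν.real (closedBall x r) := (by positivity : 0 < c * r).trans_le hlr
    have h1 := h.abs_det_mul_le (A := fun i j => a i j x) (fun i j => h.abs_le_one i j x)
      (by simp only [h.symm 1 0]) hr hsub
    have h2 := le_integral_bump (n := 0) (s := r / 16) (t := r / 32) (x := x) ν
    have h3 : r / 32 / (r / 16) = 1 / 2 := by field_simp; norm_num
    rw [h3] at h2
    have hi (i j : Fin 2) : Integrable (fun y => |a i j y - a i j x|)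
        (ν.restrict (closedBall x r)) := ((hint i j).restrict.sub (integrable_const _)).abs
    rw [integral_finsetSum _ fun i _ => integrable_finsetSum _ fun j _ => hi i j] at h1
    simp only [integral_finsetSum _ fun j _ => hi _ j] at h1
    simp only [setAverage_eq, smul_eq_mul, ← Finset.mul_sum]
    rw [← hD] at h1
    rw [mul_left_comm, ← div_eq_inv_mul, le_div_iff₀ hν]
    have hD0 : 0 ≤ D := abs_nonneg _
    have h4 := mul_le_mul_of_nonneg_left h2 hD0
    have h5 := mul_le_mul_of_nonneg_left h64 hD0
    norm_num at h4
    linarith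
  have hD0 : D ≤ 0 := by
    by_contra! hpos
    exact hfreq ((hlim.eventually_lt_const hpos).mono fun r hr => not_le.2 hr)
  exact sub_eq_zero.1 (abs_eq_zero.1 (le_antisymm hD0 (abs_nonneg _)))

end Det

/-- A set of points where the lower one-dimensional density of `ν` is at least `c` has Hausdorff
measure controlled by `ν`. -/
theorem hausdorffMeasure_le_of_density {ν : Measure E2} [IsFiniteMeasure ν] {c : ℝ} (hc : 0 < c)
    {A : Set E2} (hA : ∀ x ∈ A, ∀ᶠ ρ in 𝓝[>] (0 : ℝ), c * ρ ≤ ν.real (closedBall x ρ)) :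
    μH[1] A ≤ ENNReal.ofReal (10 / c) * ν A := by
  have hopen (U : Set E2) (hU : IsOpen U) (hAU : A ⊆ U) :
      μH[1] A ≤ ENNReal.ofReal (10 / c) * ν U := by
    have hr (n : ℕ) (x : E2) : ∃ r : ℝ, x ∈ A → 0 < r ∧ r ≤ 1 / (n + 1) ∧ closedBall x r ⊆ U ∧
        c * r ≤ ν.real (closedBall x r) := by
      by_cases hx : x ∈ A
      · obtain ⟨δ, hδ, hs⟩ := nhds_basis_closedBall.mem_iff.1 (hU.mem_nhds (hAU hx))
        have h1 : (0 : ℝ) < min δ (1 / (n + 1)) := lt_min hδ (by positivity)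
        obtain ⟨r, hr, hm⟩ := ((hA x hx).and (Ioc_mem_nhdsGT h1)).exists
        exact ⟨r, fun _ => ⟨hm.1, hm.2.trans (min_le_right _ _),
          (closedBall_subset_closedBall (hm.2.trans (min_le_left _ _))).trans hs, hr⟩⟩
      · exact ⟨0, fun h => (hx h).elim⟩
    choose r hr using hr
    have hV (n : ℕ) := Vitali.exists_disjoint_subfamily_covering_enlargement_closedBall A id (r n)
      (1 / (n + 1)) (fun x hx => (hr n x hx).2.1) 5 (by norm_num)
    choose u huA hdisj hcov using hV
    have hcount (n : ℕ) : (u n).Countable := (hdisj n).countable_of_nonempty_interior fun x hx => by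
      rw [id, interior_closedBall _ (hr n x (huA n hx)).1.ne']
      exact nonempty_ball.2 (hr n x (huA n hx)).1
    have (n : ℕ) : Countable (u n) := (hcount n).to_subtype
    have hediam (n : ℕ) (i : u n) :
        ediam (closedBall (i : E2) (5 * r n i)) ≤ ENNReal.ofReal (10 * r n i) := by
      have := (hr n i (huA n i.2)).1
      refine ediam_le_of_forall_dist_le fun y hy w hw => ?_
      exact (dist_triangle_right y w i).trans
        ((add_le_add (mem_closedBall.1 hy) (mem_closedBall.1 hw)).trans (by linarith))
    have hlim : Tendsto (fun n : ℕ => ENNReal.ofReal (10 * (1 / ((n : ℝ) + 1)))) atTop (𝓝 0) := by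
      have := ENNReal.tendsto_ofReal (tendsto_one_div_add_atTop_nhds_zero_nat.const_mul (10 : ℝ))
      simpa using this
    refine (Measure.hausdorffMeasure_le_liminf_tsum 1 A _ hlim
      (fun n (i : u n) => closedBall (i : E2) (5 * r n i)) (Eventually.of_forall fun n i => ?_)
      (Eventually.of_forall fun n x hx => ?_)).trans ?_
    · refine (hediam n i).trans (ENNReal.ofReal_le_ofReal ?_)
      exact mul_le_mul_of_nonneg_left (hr n i (huA n i.2)).2.1 (by norm_num)
    · obtain ⟨b, hb, hsub⟩ := hcov n x hx
      exact Set.mem_iUnion.2 ⟨⟨b, hb⟩, hsub (mem_closedBall_self (hr n x hx).1.le)⟩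
    · refine liminf_le_of_le (by isBoundedDefault) fun b hb => ?_
      obtain ⟨n, hn⟩ := hb.exists
      refine hn.trans ?_
      have h1 (i : u n) : ediam (closedBall (i : E2) (5 * r n i)) ^ (1 : ℝ)
          ≤ ENNReal.ofReal (10 / c) * ν (closedBall (i : E2) (r n i)) := by
        rw [ENNReal.rpow_one, ← ofReal_measureReal, ← ENNReal.ofReal_mul (by positivity)]
        refine (hediam n i).trans (ENNReal.ofReal_le_ofReal ?_)
        have := (hr n i (huA n i.2)).2.2.2
        rw [div_mul_eq_mul_div, le_div_iff₀ hc]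
        linarith
      refine (ENNReal.tsum_le_tsum h1).trans ?_
      rw [ENNReal.tsum_mul_left, ← measure_iUnion]
      · gcongr
        exact Set.iUnion_subset fun i => (hr n i (huA n i.2)).2.2.1
      · exact fun i j hij => hdisj n i.2 j.2 (Subtype.coe_ne_coe.2 hij)
      · exact fun i => isClosed_closedBall.measurableSet
  refine ENNReal.le_of_forall_pos_le_add fun δ hδ _ => ?_
  have hC : 0 < 10 / c := by positivity
  obtain ⟨U, hAU, hU, hlt⟩ := A.exists_isOpen_le_add ν
    (ε := (δ : ℝ≥0∞) / ENNReal.ofReal (10 / c))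
    (ENNReal.div_pos (by simpa using hδ.ne') ENNReal.ofReal_ne_top).ne'
  refine (hopen U hU hAU).trans ((mul_le_mul_right hlt _).trans ?_)
  rw [mul_add, ENNReal.mul_div_cancel (ENNReal.ofReal_pos.2 hC).ne' ENNReal.ofReal_ne_top]

/-- A measure with linear growth on balls is controlled by the Hausdorff measure. -/
theorem restrict_le_smul_hausdorffMeasure {μ : Measure E2} [IsFiniteMeasure μ] {C δ : ℝ}
    (hC : 0 < C) (hδ : 0 < δ) {U : Set E2} (hU : MeasurableSet U)
    (h : ∀ x ∈ U, ∀ s, 0 < s → s < δ → μ.real (closedBall x s) ≤ C * s) :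
    μ.restrict U ≤ ENNReal.ofReal C • μH[1] := by
  have hC' : ENNReal.ofReal C ≠ 0 := (ENNReal.ofReal_pos.2 hC).ne'
  have h1 : (ENNReal.ofReal C)⁻¹ • μ.restrict U ≤ μH[1] := by
    refine Measure.le_hausdorffMeasure 1 _ (ENNReal.ofReal (δ / 2))
      (ENNReal.ofReal_pos.2 (by positivity)) fun s hs => ?_
    rw [ENNReal.rpow_one, Measure.smul_apply, smul_eq_mul, Measure.restrict_apply' hU,
      ENNReal.inv_mul_le_iff hC' ENNReal.ofReal_ne_top]
    rcases (s ∩ U).eq_empty_or_nonempty with he | ⟨x, hxs, hxU⟩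
    · simp [he]
    have hfin : ediam s ≠ ∞ := ne_top_of_le_ne_top ENNReal.ofReal_ne_top hs
    have hdiam : diam s ≤ δ / 2 := ENNReal.toReal_le_of_le_ofReal (by positivity) hs
    have hbound : ∀ᶠ t in 𝓝[>] (diam s), μ (s ∩ U) ≤ ENNReal.ofReal (C * t) := by
      filter_upwards [Ioo_mem_nhdsGT (hdiam.trans_lt (half_lt_self hδ))] with t ht
      have hsub : s ∩ U ⊆ closedBall x t := fun y hy => mem_closedBall.2
        ((dist_le_diam_of_mem' hfin hy.1 hxs).trans ht.1.le)
      rw [ENNReal.le_ofReal_iff_toReal_le (measure_ne_top _ _)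
        (mul_nonneg hC.le (diam_nonneg.trans ht.1.le))]
      exact (measureReal_mono hsub).trans (h x hxU t (diam_nonneg.trans_lt ht.1) ht.2)
    have hlim : Tendsto (fun t => ENNReal.ofReal (C * t)) (𝓝[>] (diam s))
        (𝓝 (ENNReal.ofReal (C * diam s))) :=
      (ENNReal.tendsto_ofReal (Continuous.tendsto (by fun_prop) _)).mono_left nhdsWithin_le_nhds
    refine (ge_of_tendsto hlim hbound).trans_eq ?_
    rw [ENNReal.ofReal_mul hC.le, diam, ENNReal.ofReal_toReal hfin]
  refine Measure.le_iff.2 fun s hs => ?_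
  have h2 := h1 s
  rw [Measure.smul_apply, smul_eq_mul, ENNReal.inv_mul_le_iff hC' ENNReal.ofReal_ne_top] at h2
  exact h2

section Global

variable {k : ℕ} {V : Evec k → ℝ} {Ω : Set E2} {ε : ℕ → ℝ} {u : ℕ → E2 → Evec k}
  {ν ζ : Measure E2}

theorem IsLimit.measureReal_le (hV : IsMultiWell V) (h : IsLimit V Ω ε u ν ζ)
    (hi : ∀ n, IntegrableOn (eDens V (ε n) (u n)) Ω) {M : ℝ}
    (hM : ∀ n, energy V (ε n) (u n) Ω ≤ M) (A : Set E2) : ν.real A ≤ M := by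
  have := h.finite
  have hΩ := h.isOpen
  have hM0 : 0 ≤ M := (setIntegral_nonneg hΩ.measurableSet fun x _ =>
    eDens_nonneg hV.nonneg (h.eps_pos 0) (u 0) x).trans (hM 0)
  have hK (K : Set E2) (hKΩ : K ⊆ Ω) (hK : IsCompact K) : ν.real K ≤ M := by
    obtain ⟨θ, hθ, hθ1, hθ01⟩ := exists_testFun_eq_one hK hΩ hKΩ
    refine (measureReal_le_integral (hθ.integrable ν) hK.measurableSet (fun x hx => (hθ1 x hx).ge)
      fun x => (hθ01 x).1).trans ?_
    refine le_of_tendsto' (h.tendsto θ hθ) fun n => le_trans ?_ (hM n)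
    have hc := (contDiffOn_eDens (ε := ε n) hΩ hV.smooth (h.sol n).1).continuousOn
    rw [← hθ.setIntegral_mul]
    refine integral_mono (hθ.integrable_mul hΩ hc _) (hi n) fun x => ?_
    exact mul_le_of_le_one_left (eDens_nonneg hV.nonneg (h.eps_pos n) (u n) x) (hθ01 x).2
  have hΩM : ν Ω ≤ ENNReal.ofReal M := by
    rw [hΩ.measure_eq_iSup_isCompact]
    refine iSup₂_le fun K hKΩ => iSup_le fun hKc => ?_
    rw [ENNReal.le_ofReal_iff_toReal_le (measure_ne_top _ _) hM0]
    exact hK K hKΩ hKc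
  refine ENNReal.toReal_le_of_le_ofReal hM0 ((measure_mono (Set.subset_univ A)).trans ?_)
  rw [← Set.union_compl_self Ω]
  refine (measure_union_le _ _).trans ?_
  rwa [h.compl, add_zero]

theorem closedBall_subset_of_le_infDist {x : E2} {r d : ℝ} (hr : r < d)
    (hx : d ≤ infDist x Ωᶜ) : closedBall x r ⊆ Ω := fun y hy => by
  by_contra hyΩ
  have := infDist_le_dist_of_mem (x := x) (s := Ωᶜ) hyΩ
  rw [mem_closedBall, dist_comm] at hy
  linarith

/-- Away from the boundary, the energy is controlled by the potential. -/
theorem IsMultiWell.exists_one_le_mul_density (hV : IsMultiWell V) (M : ℝ) {d : ℝ} (hd : 0 < d) :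
    ∃ K > (0 : ℝ), ∀ {Ω : Set E2} {ε : ℕ → ℝ} {u : ℕ → E2 → Evec k} {ν ζ : Measure E2}
      {a : Fin 2 → Fin 2 → E2 → ℝ} {z : E2 → ℝ}, IsLimit V Ω ε u ν ζ → StressLimit Ω ν ζ a z →
      (∀ A, ν.real A ≤ M) → ∀ᵐ x ∂ν, d < infDist x Ωᶜ → 1 ≤ K * z x := by
  obtain ⟨K, hK, hle⟩ := hV.exists_integral_le ((M + 1) / (d / 2))
  refine ⟨K, hK, fun {Ω ε u ν ζ a z} h hS hM => ?_⟩
  have := h.finite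
  have := h.finite'
  have hr : 0 < d / 2 := by positivity
  rw [ae_iff]
  refine measure_null_of_locally_null _ fun x hx => ?_
  simp only [Set.mem_ofPred_eq, Classical.not_imp] at hx
  have hsub : csq x (d / 2) ⊆ Ω := csq_subset_closedBall.trans
    (closedBall_subset_of_le_infDist (d := infDist x Ωᶜ) (by linarith [hx.1]) le_rfl)
  have hO : MeasurableSet (osq x (3 * (d / 2) / 4)) := (isOpen_osq _ _).measurableSet
  have h1 : ν.restrict (osq x (3 * (d / 2) / 4)) ≤ ENNReal.ofReal K • ζ :=
    restrict_le_smul_of_integral_le (isOpen_osq _ _) hK.le fun f hf hf0 => hle h x (d / 2) f hr hsub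
      (by rw [div_mul_cancel₀ _ hr.ne']; linarith [hM (csq x (d / 2))]) hf hf0
  have h2 : (fun _ => 1) ≤ᵐ[ν.restrict (osq x (3 * (d / 2) / 4))]
      fun y => ENNReal.ofReal (K * z y) := by
    refine ae_le_of_forall_setLIntegral_le_of_sigmaFinite measurable_const fun s hs _ => ?_
    rw [setLIntegral_const, one_mul]
    simp only [ENNReal.ofReal_mul hK.le]
    rw [lintegral_const_mul _ hS.measurable_z.ennreal_ofReal, Measure.restrict_restrict hs]
    have h3 := h1 (s ∩ osq x (3 * (d / 2) / 4))
    rwa [Measure.smul_apply, smul_eq_mul, hS.withDensity, withDensity_apply _ (hs.inter hO),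
      Measure.restrict_apply' hO, Set.inter_assoc, Set.inter_self,
      ← Measure.restrict_apply' hO] at h3
  refine ⟨{y | ¬(d < infDist y Ωᶜ → 1 ≤ K * z y)} ∩ osq x (3 * (d / 2) / 4),
    inter_mem_nhdsWithin _ ((isOpen_osq _ _).mem_nhds ?_), ?_⟩
  · simp [osq, hd]
  · rw [← Measure.restrict_apply' hO]
    refine measure_mono_null (fun y hy => ?_) (ae_iff.1 h2)
    simp only [Set.mem_ofPred_eq, Classical.not_imp] at hy ⊢
    rw [ENNReal.one_le_ofReal]
    exact hy.2

/-- Balls centred on the support of the limiting energy carry at least a linear amount of it. -/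
theorem IsMultiWell.exists_density_lower_bound (hV : IsMultiWell V) :
    ∃ c > (0 : ℝ), ∀ {Ω : Set E2} {ε : ℕ → ℝ} {u : ℕ → E2 → Evec k} {ν ζ : Measure E2},
      IsLimit V Ω ε u ν ζ → ∀ x ∈ Ω ∩ ν.support, ∀ᶠ ρ in 𝓝[>] (0 : ℝ),
      c * ρ ≤ ν.real (closedBall x ρ) := by
  obtain ⟨c, hc, hclear⟩ := hV.exists_clearing_out
  refine ⟨c, hc, fun {Ω ε u ν ζ} h x hx => ?_⟩
  obtain ⟨δ, hδ, hs⟩ := nhds_basis_closedBall.mem_iff.1 (h.isOpen.mem_nhds hx.1)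
  filter_upwards [Ioc_mem_nhdsGT hδ] with ρ hρ
  by_contra! hlt
  refine ((Measure.mem_support_iff_forall x).1 hx.2 (closedBall x (ρ / 4))
    (closedBall_mem_nhds x (by linarith [hρ.1]))).ne' ?_
  exact hclear h x ρ hρ.1 ((closedBall_subset_closedBall hρ.2).trans hs) hlt

end Global

/-- Densities with respect to a Hausdorff measure restricted to a set on which the given measure
has a positive lower density. -/
theorem exists_density_of_le_smul {ν lam : Measure E2} [IsFiniteMeasure ν] [IsFiniteMeasure lam]
    {η : ℝ} (hac : ν ≪ lam) (hle : ENNReal.ofReal η • lam ≤ ν) :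
    ∃ e : E2 → ℝ, Measurable e ∧ ν = lam.withDensity (fun x => ENNReal.ofReal (e x)) ∧
      ∀ᵐ x ∂lam, η ≤ e x := by
  have := Measure.haveLebesgueDecomposition_of_sigmaFinite ν lam
  have he : ν = lam.withDensity fun x => ENNReal.ofReal (ν.rnDeriv lam x).toReal := by
    refine (Measure.withDensity_rnDeriv_eq _ _ hac).symm.trans (withDensity_congr_ae ?_)
    filter_upwards [Measure.rnDeriv_lt_top ν lam] with x hx
    rw [ENNReal.ofReal_toReal hx.ne]
  refine ⟨fun x => (ν.rnDeriv lam x).toReal, (Measure.measurable_rnDeriv ν lam).ennreal_toReal,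
    he, ?_⟩
  have h : (fun _ => ENNReal.ofReal η) ≤ᵐ[lam]
      fun x => ENNReal.ofReal (ν.rnDeriv lam x).toReal := by
    refine ae_le_of_forall_setLIntegral_le_of_sigmaFinite measurable_const fun s hs _ => ?_
    rw [setLIntegral_const, ← withDensity_apply _ hs, ← he]
    exact hle s
  filter_upwards [h] with x hx
  exact (ENNReal.ofReal_le_ofReal_iff ENNReal.toReal_nonneg).1 hx

theorem withDensity_withDensity_ofReal {lam ν ζ : Measure E2} {e z : E2 → ℝ} (he : Measurable e)
    (hz : Measurable z) (hz0 : ∀ x, 0 ≤ z x)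
    (hν : ν = lam.withDensity fun x => ENNReal.ofReal (e x))
    (hζ : ζ = ν.withDensity fun x => ENNReal.ofReal (z x)) :
    ζ = lam.withDensity fun x => ENNReal.ofReal (z x * e x) := by
  rw [hζ, hν, ← withDensity_mul _ he.ennreal_ofReal hz.ennreal_ofReal]
  congr 1
  ext x
  rw [Pi.mul_apply, mul_comm, ENNReal.ofReal_mul (hz0 x)]

theorem ae_density_le {ζ μ : Measure E2} [IsFiniteMeasure ζ] {S U : Set E2} (hS : MeasurableSet S)
    (hU : MeasurableSet U) {C : ℝ} (hC : 0 ≤ C) (hle : ζ.restrict U ≤ ENNReal.ofReal C • μ)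
    {Θ : E2 → ℝ} (hΘ : Measurable Θ) [SigmaFinite (μ.restrict S)]
    (hζ : ζ = (μ.restrict S).withDensity fun x => ENNReal.ofReal (Θ x)) :
    ∀ᵐ x ∂μ.restrict S, x ∈ U → Θ x ≤ C := by
  rw [← ae_restrict_iff' hU]
  have h : (fun x => ENNReal.ofReal (Θ x)) ≤ᵐ[(μ.restrict S).restrict U]
      fun _ => ENNReal.ofReal C := by
    refine ae_le_of_forall_setLIntegral_le_of_sigmaFinite hΘ.ennreal_ofReal fun s hs _ => ?_
    rw [setLIntegral_const, Measure.restrict_restrict hs, ← withDensity_apply _ (hs.inter hU),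
      ← hζ, Measure.restrict_apply hs]
    have hSc : ζ Sᶜ = 0 := by
      rw [hζ]
      refine withDensity_absolutelyContinuous _ _ ?_
      rw [Measure.restrict_apply hS.compl, Set.compl_inter_self, measure_empty]
    have h1 := hle (s ∩ U ∩ S)
    rw [Measure.restrict_apply' hU, Measure.smul_apply, smul_eq_mul,
      Set.inter_right_comm, Set.inter_assoc s U U, Set.inter_self] at h1
    rw [Measure.restrict_apply (hs.inter hU)]
    refine le_trans ?_ h1
    refine (measure_le_inter_add_sdiff ζ (s ∩ U) S).trans_eq ?_
    have h2 : ζ ((s ∩ U) \ S) = 0 := measure_mono_null (fun x hx => hx.2) hSc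
    rw [h2, add_zero]
  filter_upwards [h] with x hx
  exact (ENNReal.ofReal_le_ofReal_iff hC).1 hx

section Assembly

variable {Ω : Set E2} {ν ζ : Measure E2} {a : Fin 2 → Fin 2 → E2 → ℝ} {z : E2 → ℝ}

theorem infDist_compl_pos (hΩ : IsOpen Ω) (hb : IsBounded Ω) {x : E2} (hx : x ∈ Ω) :
    0 < infDist x Ωᶜ := by
  have hne : Ωᶜ.Nonempty := by
    rw [Set.nonempty_compl]
    rintro rfl
    exact NormedSpace.unbounded_univ ℝ E2 hb
  exact (hΩ.isClosed_compl.notMem_iff_infDist_pos hne).1 fun h => h hx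

theorem concSet_eq {c η : ℝ} (hη : 0 < η) (hηc : η ≤ c)
    (hlow : ∀ x ∈ Ω ∩ ν.support, ∀ᶠ ρ in 𝓝[>] (0 : ℝ), c * ρ ≤ ν.real (closedBall x ρ))
    (hup : ∀ x ∈ Ω, ∃ C, ∀ᶠ ρ in 𝓝[>] (0 : ℝ), ν.real (closedBall x ρ) ≤ C * ρ) :
    concSet ν Ω η = Ω ∩ ν.support := by
  ext x
  simp only [concSet, densLow, Set.mem_ofPred_eq, Set.mem_inter_iff]
  refine and_congr_right fun hx => ⟨fun h => ?_, fun h => ?_⟩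
  · by_contra hns
    obtain ⟨t, ht, ht0⟩ := Measure.notMem_support_iff_exists.1 hns
    obtain ⟨δ, hδ, hs⟩ := nhds_basis_closedBall.mem_iff.1 ht
    have h0 : (fun r : ℝ => (ν (closedBall x r)).toReal / r) =ᶠ[𝓝[>] 0] fun _ => 0 := by
      filter_upwards [Ioc_mem_nhdsGT hδ] with r hr
      rw [measure_mono_null ((closedBall_subset_closedBall hr.2).trans hs) ht0]
      simp
    rw [liminf_congr h0, liminf_const] at h
    linarith
  · obtain ⟨C, hC⟩ := hup x hx
    refine hηc.trans (le_liminf_of_le (IsBoundedUnder.isCoboundedUnder_ge ⟨C, ?_⟩) ?_)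
    · rw [eventually_map]
      filter_upwards [hC, self_mem_nhdsWithin] with r hr hr0
      exact (div_le_iff₀ hr0).2 hr
    · filter_upwards [hlow x ⟨hx, h⟩, self_mem_nhdsWithin] with r hr hr0
      exact (le_div_iff₀ hr0).2 hr

theorem StressLimit.zeta_le (h : StressLimit Ω ν ζ a z) : ζ ≤ ν := by
  refine Measure.le_iff.2 fun s hs => ?_
  rw [h.withDensity, withDensity_apply _ hs]
  refine (lintegral_mono (g := 1) fun x => ?_).trans_eq (by simp)
  exact ENNReal.ofReal_le_one.2 (h.z_le x)

theorem StressLimit.exists_measureReal_closedBall_le (h : StressLimit Ω ν ζ a z)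
    (hdet : ∀ᵐ x ∂ν, a 0 0 x * a 1 1 x = a 0 1 x ^ 2)
    (hK : ∀ d : ℝ, 0 < d → ∃ K > (0 : ℝ), ∀ᵐ x ∂ν, d < infDist x Ωᶜ → 1 ≤ K * z x)
    {x : E2} (hx : 0 < infDist x Ωᶜ) :
    ∃ C, ∀ᶠ ρ in 𝓝[>] (0 : ℝ), ν.real (closedBall x ρ) ≤ C * ρ := by
  have := h.finite
  have := h.finite_zeta
  set d := infDist x Ωᶜ with hd
  obtain ⟨K, hK0, hKz⟩ := hK (d / 2) (by positivity)
  have hr : 0 < d / 4 := by positivity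
  refine ⟨K * (1 / (d / 4) * ζ.real (closedBall x (d / 4))), ?_⟩
  filter_upwards [Ioo_mem_nhdsGT hr] with ρ hρ
  have h1 : ν (closedBall x ρ) ≤ ENNReal.ofReal K * ζ (closedBall x ρ) := by
    rw [h.withDensity, withDensity_apply _ measurableSet_closedBall,
      ← lintegral_const_mul _ h.measurable_z.ennreal_ofReal, ← setLIntegral_one]
    refine setLIntegral_mono_ae' measurableSet_closedBall ?_
    filter_upwards [hKz] with y hy hyx
    rw [← ENNReal.ofReal_mul hK0.le, ENNReal.one_le_ofReal]
    refine hy ?_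
    have := infDist_le_infDist_add_dist (s := Ωᶜ) (x := x) (y := y)
    rw [mem_closedBall, dist_comm] at hyx
    linarith [hρ.2]
  have h2 : ν.real (closedBall x ρ) ≤ K * ζ.real (closedBall x ρ) := by
    have := ENNReal.toReal_mono (ENNReal.mul_ne_top ENNReal.ofReal_ne_top (measure_ne_top _ _)) h1
    rwa [ENNReal.toReal_mul, ENNReal.toReal_ofReal hK0.le] at this
  refine h2.trans ?_
  have h3 := h.measureReal_closedBall_le hdet hρ.1 hρ.2
    (closedBall_subset_of_le_infDist (d := d) (by linarith) le_rfl)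
  calc _ ≤ K * (ρ / (d / 4) * ζ.real (closedBall x (d / 4))) := by gcongr
    _ = _ := by ring

end Assembly

theorem smul_restrict_hausdorffMeasure_le {ν : Measure E2} [IsFiniteMeasure ν] {c : ℝ} (hc : 0 < c)
    {S : Set E2}
    (hS : MeasurableSet S) (h : ∀ x ∈ S, ∀ᶠ ρ in 𝓝[>] (0 : ℝ), c * ρ ≤ ν.real (closedBall x ρ)) :
    ENNReal.ofReal (c / 10) • (μH[1]).restrict S ≤ ν := by
  refine Measure.le_iff.2 fun s _ => ?_
  rw [Measure.smul_apply, smul_eq_mul, Measure.restrict_apply' hS]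
  have h1 := hausdorffMeasure_le_of_density hc (A := s ∩ S) fun x hx => h x hx.2
  calc _ ≤ ENNReal.ofReal (c / 10) * (ENNReal.ofReal (10 / c) * ν (s ∩ S)) := by gcongr
    _ = ν (s ∩ S) := by
      rw [← mul_assoc, ← ENNReal.ofReal_mul (by positivity)]
      field_simp
      simp
    _ ≤ _ := measure_mono Set.inter_subset_left

theorem isFiniteMeasure_of_smul_le {lam ν : Measure E2} [IsFiniteMeasure ν] {c : ℝ≥0∞}
    (hc : c ≠ 0) (h : c • lam ≤ ν) : IsFiniteMeasure lam := by
  refine ⟨lt_of_not_ge fun htop => ?_⟩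
  have h1 := h Set.univ
  rw [Measure.smul_apply, smul_eq_mul, top_le_iff.1 htop, ENNReal.mul_top hc, top_le_iff] at h1
  exact measure_ne_top ν _ h1

theorem absolutelyContinuous_of_smul_le {lam ν : Measure E2} {c : ℝ≥0∞}
    (hc : c ≠ 0) (h : c • lam ≤ ν) : lam ≪ ν := fun s hs => by
  have h1 := h s
  rw [hs, Measure.smul_apply, smul_eq_mul, nonpos_iff_eq_zero, mul_eq_zero] at h1
  exact h1.resolve_left hc

section Densities

variable {Ω : Set E2} {ν ζ : Measure E2} {a : Fin 2 → Fin 2 → E2 → ℝ} {z : E2 → ℝ}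

theorem StressLimit.ae_density_le_div (h : StressLimit Ω ν ζ a z) (hb : IsBounded Ω)
    (hdet : ∀ᵐ x ∂ν, a 0 0 x * a 1 1 x = a 0 1 x ^ 2) {M : ℝ} (hM : 0 < M)
    (hνM : ∀ A, ν.real A ≤ M) {S : Set E2} (hS : MeasurableSet S) (hSΩ : S ⊆ Ω)
    [SigmaFinite ((μH[1] : Measure E2).restrict S)] {Θ : E2 → ℝ} (hΘ : Measurable Θ)
    (hζ : ζ = ((μH[1] : Measure E2).restrict S).withDensity fun x => ENNReal.ofReal (Θ x)) :
    ∀ᵐ x ∂(μH[1] : Measure E2).restrict S, Θ x ≤ M / infDist x Ωᶜ := by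
  have := h.finite
  have := h.finite_zeta
  have hU (d : ℚ) : ∀ᵐ x ∂(μH[1] : Measure E2).restrict S,
      0 < (d : ℝ) → (d : ℝ) < infDist x Ωᶜ → Θ x ≤ M / d := by
    rcases le_or_gt (d : ℝ) 0 with hd | hd
    · exact .of_forall fun x hx => absurd hx hd.not_gt
    have hO : MeasurableSet {x | (d : ℝ) < infDist x Ωᶜ} :=
      (isOpen_lt continuous_const (continuous_infDist_pt _)).measurableSet
    have hle : ζ.restrict {x | (d : ℝ) < infDist x Ωᶜ} ≤ ENNReal.ofReal (M / d) • μH[1] := by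
      refine restrict_le_smul_hausdorffMeasure (by positivity) hd hO fun x hx s hs hsd => ?_
      refine (h.measureReal_closedBall_le hdet hs hsd
        (closedBall_subset_of_le_infDist hx le_rfl)).trans ?_
      have h1 : ζ.real (closedBall x d) ≤ M :=
        (ENNReal.toReal_mono (measure_ne_top _ _) (h.zeta_le _)).trans (hνM _)
      calc s / d * ζ.real (closedBall x d) ≤ s / d * M := by gcongr
        _ = M / d * s := by ring
    filter_upwards [ae_density_le hS hO (by positivity) hle hΘ hζ] with x hx _ hxd
    exact hx hxd
  filter_upwards [ae_all_iff.2 hU, ae_restrict_mem hS] with x hx hxS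
  have hpos := infDist_compl_pos h.isOpen hb (hSΩ hxS)
  rcases le_or_gt (Θ x) 0 with h0 | h0
  · exact h0.trans (by positivity)
  rw [le_div_iff₀' hpos, ← le_div_iff₀ h0]
  refine le_of_forall_rat_lt_imp_le fun q hq => ?_
  rcases le_or_gt (q : ℝ) 0 with hq0 | hq0
  · exact hq0.trans (by positivity)
  rw [le_div_iff₀ h0, ← le_div_iff₀' hq0]
  exact hx q hq0 hq

end Densities

/-- absolute continuity of the limiting measures. The
limiting measures `ν` and `ζ` vanish on `Ω \ 𝔖⋆` and are absolutely continuous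
with respect to `λ = ℋ¹⌞𝔖⋆`; writing `ν = 𝕖⋆ dλ` and `ζ = Θ⋆ dλ`, for
`λ`-a.e. `x` one has `η₁ ≤ 𝕖⋆(x) ≤ K(d(x))·Θ⋆(x)` and `Θ⋆(x) ≤ M₀/d(x)`. -/
theorem statement_2 (k : ℕ) (hk : 1 ≤ k) (V : Evec k → ℝ) (hV : IsMultiWell V) :
    ∃ η₁ > (0 : ℝ), ∀ M₀ : ℝ, 0 < M₀ →
    ∃ K : ℝ → ℝ, (∀ d : ℝ, 0 < d → 0 < K d) ∧
      ∀ (Ω : Set E2), IsOpen Ω → IsBounded Ω →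
      ∀ (ε : ℕ → ℝ) (u : ℕ → E2 → Evec k),
        (∀ n, 0 < ε n) →
        Tendsto ε atTop (𝓝 0) →
        (∀ n, IsSolution V (ε n) Ω (u n)) →
        (∀ n, IntegrableOn (eDens V (ε n) (u n)) Ω) →
        (∀ n, energy V (ε n) (u n) Ω ≤ M₀) →
      ∀ ν ζ : Measure E2, IsFiniteMeasure ν → IsFiniteMeasure ζ →
        ν Ωᶜ = 0 → ζ Ωᶜ = 0 →
        (∀ f : E2 → ℝ, TestFun Ω f →
          Tendsto (fun n => ∫ x in Ω, f x * eDens V (ε n) (u n) x) atTop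
            (𝓝 (∫ x, f x ∂ν))) →
        (∀ f : E2 → ℝ, TestFun Ω f →
          Tendsto (fun n => ∫ x in Ω, f x * ((ε n)⁻¹ * V (u n x))) atTop
            (𝓝 (∫ x, f x ∂ζ))) →
        ν (Ω \ concSet ν Ω η₁) = 0 ∧ ζ (Ω \ concSet ν Ω η₁) = 0 ∧
        ν ≪ (μH[1]).restrict (concSet ν Ω η₁) ∧
        ζ ≪ (μH[1]).restrict (concSet ν Ω η₁) ∧
        ∃ 𝕖 Θ : E2 → ℝ, Measurable 𝕖 ∧ Measurable Θ ∧
          ν = ((μH[1]).restrict (concSet ν Ω η₁)).withDensity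
                (fun x => ENNReal.ofReal (𝕖 x)) ∧
          ζ = ((μH[1]).restrict (concSet ν Ω η₁)).withDensity
                (fun x => ENNReal.ofReal (Θ x)) ∧
          ∀ᵐ x ∂(μH[1]).restrict (concSet ν Ω η₁),
            η₁ ≤ 𝕖 x ∧ 𝕖 x ≤ K (infDist x Ωᶜ) * Θ x ∧
            Θ x ≤ M₀ / infDist x Ωᶜ := by
  obtain ⟨c, hc, hlow⟩ := hV.exists_density_lower_bound
  refine ⟨c / 10, by positivity, fun M₀ hM₀ => ?_⟩
  choose! κ hκ hκz using fun (d : ℝ) (hd : 0 < d) => hV.exists_one_le_mul_density M₀ hd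
  refine ⟨fun d => κ (1 / ((⌊1 / d⌋₊ : ℝ) + 1)), fun d _ => hκ _ (by positivity), ?_⟩
  intro Ω hΩ hb ε u hε hε0 hsol hi hM ν ζ hν hζ hνc hζc hlim hlim'
  have h : IsLimit V Ω ε u ν ζ :=
    { isOpen := hΩ
      eps_pos := hε
      eps_tendsto := hε0
      sol := hsol
      finite := hν
      finite' := hζ
      compl := hνc
      compl' := hζc
      tendsto := fun f hf => by simpa only [hf.setIntegral_mul] using hlim f hf
      tendsto' := fun f hf => by simpa only [hf.setIntegral_mul] using hlim' f hf }
  obtain ⟨a, z, hS⟩ := h.exists_stressLimit hV hi hM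
  have hνM := h.measureReal_le hV hi hM
  have hz (d : ℝ) (hd : 0 < d) : ∀ᵐ x ∂ν, d < infDist x Ωᶜ → 1 ≤ κ d * z x :=
    hκz d hd h hS hνM
  have hmemΩ : ∀ᵐ x ∂ν, x ∈ Ω := measure_eq_zero_iff_ae_notMem.1 hνc |>.mono fun x hx => by
    simpa using hx
  have hmem : ∀ᵐ x ∂ν, x ∈ Ω ∩ ν.support := by
    filter_upwards [hmemΩ, Measure.support_mem_ae] with x hx hx' using ⟨hx, hx'⟩
  have hdet : ∀ᵐ x ∂ν, a 0 0 x * a 1 1 x = a 0 1 x ^ 2 :=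
    hS.ae_det_eq_zero hc (hmem.mono (hlow h))
  have hup (x : E2) (hx : x ∈ Ω) :
      ∃ C, ∀ᶠ ρ in 𝓝[>] (0 : ℝ), ν.real (closedBall x ρ) ≤ C * ρ :=
    hS.exists_measureReal_closedBall_le hdet (fun d hd => ⟨κ d, hκ d hd, hz d hd⟩)
      (infDist_compl_pos hΩ hb hx)
  have hfloor {d : ℝ} (hd : 0 < d) : 1 / ((⌊1 / d⌋₊ : ℝ) + 1) < d :=
    (one_div_lt (by positivity) hd).2 (Nat.lt_floor_add_one _)
  have hKz : ∀ᵐ x ∂ν, x ∈ Ω → 1 ≤ κ (1 / ((⌊1 / infDist x Ωᶜ⌋₊ : ℝ) + 1)) * z x := by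
    have hall : ∀ᵐ x ∂ν, ∀ m : ℕ, 1 / ((m : ℝ) + 1) < infDist x Ωᶜ →
        1 ≤ κ (1 / ((m : ℝ) + 1)) * z x := ae_all_iff.2 fun m => hz _ (by positivity)
    filter_upwards [hall] with x hx hxΩ
    exact hx _ (hfloor (infDist_compl_pos hΩ hb hxΩ))
  have hzpos : ∀ᵐ x ∂ν, 0 < z x := by
    filter_upwards [hKz, hmemΩ] with x hx hxΩ
    refine (hS.z_nonneg x).lt_of_ne fun h0 => ?_
    have := hx hxΩ
    rw [← h0, mul_zero] at this
    linarith
  rw [concSet_eq (by positivity) (by linarith) (hlow h) hup]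
  set S := Ω ∩ ν.support with hSdef
  have hSm : MeasurableSet S := hΩ.measurableSet.inter Measure.isClosed_support.measurableSet
  have hνS : ν Sᶜ = 0 := hmem
  set lam := (μH[1] : Measure E2).restrict S with hlam
  have hη : ENNReal.ofReal (c / 10) ≠ 0 := (ENNReal.ofReal_pos.2 (by positivity)).ne'
  have hle : ENNReal.ofReal (c / 10) • lam ≤ ν := smul_restrict_hausdorffMeasure_le hc hSm (hlow h)
  have hlamfin : IsFiniteMeasure lam := isFiniteMeasure_of_smul_le hη hle
  have hac : ν ≪ lam := Measure.AbsolutelyContinuous.mk fun s _ hs => by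
    rw [hlam, Measure.restrict_apply' hSm] at hs
    refine le_antisymm ((measure_le_inter_add_sdiff ν s S).trans ?_) zero_le
    have h2 : ν (s \ S) = 0 := measure_mono_null (fun x hx => hx.2) hνS
    rw [hS.ac_hausdorff hzpos hs, zero_add, h2]
  have hζν : ζ ≪ ν := hS.zeta_le.absolutelyContinuous
  have hνΩS : ν (Ω \ S) = 0 := measure_mono_null (t := Sᶜ) (fun x hx => hx.2) hνS
  obtain ⟨e, he, hνe, hηe⟩ := exists_density_of_le_smul hac hle
  have hζe := withDensity_withDensity_ofReal he hS.measurable_z hS.z_nonneg hνe hS.withDensity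
  refine ⟨hνΩS, hζν hνΩS, hac, hζν.trans hac, e, fun x => z x * e x, he,
    hS.measurable_z.mul he, hνe, hζe, ?_⟩
  filter_upwards [hηe, absolutelyContinuous_of_smul_le hη hle |>.ae_le hKz,
    hS.ae_density_le_div hb hdet hM₀ hνM hSm Set.inter_subset_left (hS.measurable_z.mul he) hζe,
    ae_restrict_mem hSm] with x hx hxK hxΘ hxS
  refine ⟨hx, ?_, hxΘ⟩
  rw [← mul_assoc]
  exact le_mul_of_one_le_left ((by positivity : (0 : ℝ) ≤ c / 10).trans hx) (hxK hxS.1)
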